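/- Let ℓ ∈ {7, 8} and let a be a fixed real number with 0.459085 ≤ a < 1/2. Then there exist real constants c_0, c_1, c_2, c_3 and c'_0, …, c'_{ℓ−1} such that for every ε > 0 there is a constant C(ε) > 0 with |∑_{n ≤ X} d_{4,ℓ}(n;a) − X·∑_{k=0}^{3} c_k (log X)^k − X^{1−a}·∑_{k=0}^{ℓ−1} c'_k (log X)^k| ≤ C(ε) X^{1/2+ε} for all X ≥ 2. -/

import Mathlib

open Real

/-- `d_k(n)`, the number of ordered ways of writing `n` as a product of `k` positive
integer factors: the `k`-th power of `ArithmeticFunction.zeta` under Dirichlet convolution. -/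
def dk (k : ℕ) (n : ℕ) : ℕ := (ArithmeticFunction.zeta ^ k : ArithmeticFunction ℕ) n

/-- The weighted divisor function `d_{4,ℓ}(n;a) = ∑_{n = n₁n₂} d₄(n₁) d_ℓ(n₂) n₂^{-a}`. -/
noncomputable def dWeighted (ℓ : ℕ) (a : ℝ) (n : ℕ) : ℝ :=
  ∑ p ∈ n.divisorsAntidiagonal, (dk 4 p.1 : ℝ) * (dk ℓ p.2 : ℝ) * (p.2 : ℝ) ^ (-a)

/-- For `0 < x < 2π`, `1 / (e^{ix} - 1) = -1/2 - (i/2) cot (x/2)`. -/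
theorem inv_exp_mul_I_sub_one {x : ℝ} (h0 : 0 < x) (h1 : x < 2 * π) :
    (Complex.exp (x * Complex.I) - 1)⁻¹ =
      -(1 / 2) - ((Real.cos (x / 2) / Real.sin (x / 2) / 2 : ℝ) : ℂ) * Complex.I := by
  have hs : 0 < Real.sin (x / 2) := Real.sin_pos_of_pos_of_lt_pi (by linarith) (by linarith)
  have hs' : (Complex.sin ((x : ℂ) / 2)) ≠ 0 := by
    have : ((Real.sin (x / 2) : ℝ) : ℂ) ≠ 0 := by exact_mod_cast hs.ne'
    simpa using this
  have hsc := Complex.sin_sq_add_cos_sq ((x : ℂ) / 2)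
  have key : Complex.exp (x * Complex.I) - 1 =
      (Complex.cos ((x : ℂ) / 2) + Complex.sin ((x : ℂ) / 2) * Complex.I) *
        (2 * Complex.I * Complex.sin ((x : ℂ) / 2)) := by
    have h2 : (x : ℂ) * Complex.I = (x : ℂ) / 2 * Complex.I + (x : ℂ) / 2 * Complex.I := by ring
    rw [h2, Complex.exp_add, Complex.exp_mul_I]
    linear_combination hsc - (Complex.sin ((x : ℂ) / 2)) ^ 2 * Complex.I_sq
  apply inv_eq_of_mul_eq_one_left
  rw [key]
  push_cast
  field_simp
  linear_combination (-Complex.I ^ 2) * hsc + (-Complex.I * Complex.sin ((x : ℂ) / 2) * Complex.cos ((x : ℂ) / 2) - 1) *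
    Complex.I_sq

theorem norm_inv_exp_sub_inv_exp {x y : ℝ} (h0 : 0 < x) (hxy : x ≤ y) (h1 : y < 2 * π) :
    ‖(Complex.exp (x * Complex.I) - 1)⁻¹ - (Complex.exp (y * Complex.I) - 1)⁻¹‖ =
      (Real.cos (x / 2) / Real.sin (x / 2) - Real.cos (y / 2) / Real.sin (y / 2)) / 2 := by
  rw [inv_exp_mul_I_sub_one h0 (by linarith), inv_exp_mul_I_sub_one (by linarith) h1]
  have hx : 0 < Real.sin (x / 2) := Real.sin_pos_of_pos_of_lt_pi (by linarith) (by linarith)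
  have hy : 0 < Real.sin (y / 2) := Real.sin_pos_of_pos_of_lt_pi (by linarith) (by linarith)
  have hd : 0 ≤ Real.sin (y / 2 - x / 2) :=
    Real.sin_nonneg_of_nonneg_of_le_pi (by linarith) (by linarith)
  have hc : 0 ≤ Real.cos (x / 2) / Real.sin (x / 2) - Real.cos (y / 2) / Real.sin (y / 2) := by
    rw [Real.sin_sub] at hd
    rw [div_sub_div _ _ hx.ne' hy.ne']
    apply div_nonneg _ (by positivity)
    linarith
  have : (-(1 / 2) - ((Real.cos (x / 2) / Real.sin (x / 2) / 2 : ℝ) : ℂ) * Complex.I) -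
      (-(1 / 2) - ((Real.cos (y / 2) / Real.sin (y / 2) / 2 : ℝ) : ℂ) * Complex.I) =
      (((-((Real.cos (x / 2) / Real.sin (x / 2) - Real.cos (y / 2) / Real.sin (y / 2)) / 2) : ℝ)) : ℂ)
        * Complex.I := by push_cast; ring
  rw [this, norm_mul, Complex.norm_I, mul_one, Complex.norm_real, norm_neg, Real.norm_of_nonneg]
  positivity

theorem norm_inv_exp_sub_one {x : ℝ} (h0 : 0 < x) (h1 : x < 2 * π) :
    ‖(Complex.exp (x * Complex.I) - 1)⁻¹‖ = (2 * Real.sin (x / 2))⁻¹ := by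
  have hs : 0 < Real.sin (x / 2) := Real.sin_pos_of_pos_of_lt_pi (by linarith) (by linarith)
  rw [norm_inv, mul_comm (x : ℂ), Complex.norm_exp_I_mul_ofReal_sub_one, norm_mul,
    Real.norm_of_nonneg (by norm_num), Real.norm_of_nonneg hs.le]

theorem sin_half_lower {δ x : ℝ} (hδ : 0 < δ) (h0 : δ ≤ x) (h1 : x ≤ 2 * π - δ) :
    δ / π ≤ Real.sin (x / 2) := by
  have hp := Real.pi_pos
  rcases le_total x π with h | h
  · have := Real.mul_le_sin (x := x / 2) (by linarith) (by linarith)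
    refine le_trans ?_ this
    rw [div_le_iff₀ hp]; field_simp; exact h0
  · have := Real.mul_le_sin (x := π - x / 2) (by linarith) (by linarith)
    rw [Real.sin_pi_sub] at this
    refine le_trans ?_ this
    rw [div_le_iff₀ hp]; field_simp; linarith

/-- The Kusmin–Landau inequality in discrete form. -/
theorem kusmin_landau_aux (f : ℕ → ℝ) (N : ℕ) {δ : ℝ} (hδ : 0 < δ)
    (hmono : ∀ n, n + 1 < N → f (n + 1) - f n ≤ f (n + 2) - f (n + 1))
    (hlo : ∀ n < N, δ ≤ f (n + 1) - f n) (hhi : ∀ n < N, f (n + 1) - f n ≤ 2 * π - δ) :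
    ‖∑ n ∈ Finset.range N, Complex.exp (f n * Complex.I)‖ ≤ 7 / δ := by
  have hp := Real.pi_pos
  set z : ℕ → ℂ := fun n => Complex.exp (f n * Complex.I) with hz
  set g : ℕ → ℝ := fun n => f (n + 1) - f n with hg
  set w : ℕ → ℂ := fun n => (Complex.exp (g n * Complex.I) - 1)⁻¹ with hw
  have hz1 : ∀ n, ‖z n‖ = 1 := fun n => Complex.norm_exp_ofReal_mul_I _
  have hne : ∀ n < N, Complex.exp (g n * Complex.I) - 1 ≠ 0 := by
    intro n hn h
    have h1 := norm_inv_exp_sub_one (x := g n) (by linarith [hlo n hn]) (by linarith [hhi n hn])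
    have h2 := sin_half_lower hδ (hlo n hn) (hhi n hn)
    rw [h] at h1
    have : 0 < δ / π := by positivity
    simp only [inv_zero, norm_zero] at h1
    have : 0 < (2 * Real.sin (g n / 2))⁻¹ := by
      have : 0 < Real.sin (g n / 2) := by linarith
      positivity
    linarith
  have hstep : ∀ n < N, z n = w n * (z (n + 1) - z n) := by
    intro n hn
    have h1 : z (n + 1) = Complex.exp (g n * Complex.I) * z n := by
      simp only [hz, hg]
      rw [← Complex.exp_add]; congr 1; push_cast; ring
    rw [h1, show Complex.exp (g n * Complex.I) * z n - z n
      = (Complex.exp (g n * Complex.I) - 1) * z n by ring, ← mul_assoc]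
    simp only [hw]
    rw [inv_mul_cancel₀ (hne n hn), one_mul]
  have hind : ∀ K, K + 1 ≤ N → ‖∑ n ∈ Finset.range (K + 1), z n - w K * z (K + 1) + w 0 * z 0‖ ≤
      (Real.cos (g 0 / 2) / Real.sin (g 0 / 2) - Real.cos (g K / 2) / Real.sin (g K / 2)) / 2 := by
    intro K
    induction K with
    | zero =>
      intro h
      have := hstep 0 (by omega)
      simp only [zero_add, Finset.range_one, Finset.sum_singleton, sub_self, zero_div]
      rw [show z 0 - w 0 * z 1 + w 0 * z 0 = z 0 - w 0 * (z 1 - z 0) by ring]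
      rw [zero_add] at this
      rw [← this]; simp
    | succ K ih =>
      intro h
      have h1 := ih (by omega)
      have h2 := hstep (K + 1) (by omega)
      have h3 := norm_inv_exp_sub_inv_exp (x := g K) (y := g (K + 1))
        (by linarith [hlo K (by omega)]) (hmono K (by omega)) (by linarith [hhi (K + 1) (by omega)])
      rw [Finset.sum_range_succ]
      have : ∑ n ∈ Finset.range (K + 1), z n + z (K + 1) - w (K + 1) * z (K + 1 + 1) + w 0 * z 0 =
        (∑ n ∈ Finset.range (K + 1), z n - w K * z (K + 1) + w 0 * z 0) +
          (w K - w (K + 1)) * z (K + 1) := by linear_combination h2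
      rw [this]
      refine (norm_add_le _ _).trans ?_
      rw [norm_mul, hz1, mul_one, h3]
      linarith
  rcases Nat.eq_zero_or_pos N with hN | hN
  · subst hN; simp; positivity
  obtain ⟨K, rfl⟩ : ∃ K, N = K + 1 := ⟨N - 1, by omega⟩
  have h1 := hind K le_rfl
  have hb : ∀ n < K + 1, (Real.sin (g n / 2))⁻¹ ≤ π / δ ∧ 0 < Real.sin (g n / 2) := by
    intro n hn
    have h2 := sin_half_lower hδ (hlo n hn) (hhi n hn)
    have h3 : 0 < δ / π := by positivity
    refine ⟨?_, by linarith⟩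
    have h4 := inv_anti₀ h3 h2
    rwa [inv_div] at h4
  have hwb : ∀ n < K + 1, ‖w n‖ ≤ π / δ / 2 := by
    intro n hn
    rw [hw]; simp only
    rw [norm_inv_exp_sub_one (by linarith [hlo n hn]) (by linarith [hhi n hn]), mul_inv]
    linarith [(hb n hn).1]
  have hcb : ∀ n < K + 1, |Real.cos (g n / 2) / Real.sin (g n / 2)| ≤ π / δ := by
    intro n hn
    rw [abs_div, abs_of_pos (hb n hn).2, div_eq_mul_inv]
    calc _ ≤ 1 * (Real.sin (g n / 2))⁻¹ := by
          gcongr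
          · exact (inv_pos.2 (hb n hn).2).le
          · exact Real.abs_cos_le_one _
      _ ≤ _ := by rw [one_mul]; exact (hb n hn).1
  have e : ∑ n ∈ Finset.range (K + 1), z n =
    (∑ n ∈ Finset.range (K + 1), z n - w K * z (K + 1) + w 0 * z 0) + w K * z (K + 1)
      - w 0 * z 0 := by ring
  rw [e]
  refine (norm_sub_le _ _).trans ?_
  have e1 := norm_add_le (∑ n ∈ Finset.range (K + 1), z n - w K * z (K + 1) + w 0 * z 0)
    (w K * z (K + 1))
  rw [norm_mul, hz1, mul_one] at e1 ⊢
  have a1 := hwb K (by omega)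
  have a2 := hwb 0 (by omega)
  have a3 := (abs_le.1 (hcb 0 (by omega))).2
  have a4 := (abs_le.1 (hcb K (by omega))).1
  have : 7 / δ = 2 * (π / δ) + (7 - 2 * π) / δ := by field_simp; ring
  have h7 : 0 ≤ (7 - 2 * π) / δ := by
    apply div_nonneg _ hδ.le
    linarith [Real.pi_lt_d2]
  linarith

/-- The Kusmin–Landau inequality in discrete form, for increments away from a fixed multiple
of `2π`. -/
theorem kusmin_landau (f : ℕ → ℝ) (N : ℕ) {δ : ℝ} (hδ : 0 < δ) (k : ℤ)
    (hmono : ∀ n, n + 1 < N → f (n + 1) - f n ≤ f (n + 2) - f (n + 1))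
    (hlo : ∀ n < N, 2 * π * k + δ ≤ f (n + 1) - f n)
    (hhi : ∀ n < N, f (n + 1) - f n ≤ 2 * π * k + 2 * π - δ) :
    ‖∑ n ∈ Finset.range N, Complex.exp (f n * Complex.I)‖ ≤ 7 / δ := by
  have h := kusmin_landau_aux (fun n => f n - 2 * π * k * n) N hδ
    (fun n hn => by have := hmono n hn; push_cast; linarith)
    (fun n hn => by have := hlo n hn; push_cast; linarith)
    (fun n hn => by have := hhi n hn; push_cast; linarith)
  convert h using 3 with n hn
  rw [show ((f n - 2 * π * k * n : ℝ) : ℂ) * Complex.I =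
    f n * Complex.I - ((k * n : ℤ) : ℂ) * (2 * π * Complex.I) by push_cast; ring,
    Complex.exp_sub, Complex.exp_int_mul_two_pi_mul_I, div_one]

theorem norm_sum_range_le_of_chunks (z : ℕ → ℂ) (N : ℕ) {L : ℕ} (hL : 0 < L) {B : ℝ}
    (hB : ∀ m k, k ≤ L → m + k ≤ N → ‖∑ i ∈ Finset.range k, z (m + i)‖ ≤ B) :
    ‖∑ i ∈ Finset.range N, z i‖ ≤ ((N : ℝ) / L + 1) * B := by
  have hB0 : 0 ≤ B := (norm_nonneg _).trans (hB 0 0 (by omega) (by omega))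
  have key : ∀ K : ℕ, ∀ M, M ≤ N → M ≤ K * L → ‖∑ i ∈ Finset.range M, z i‖ ≤ K * B := by
    intro K
    induction K with
    | zero => intro M _ h; simp at h; subst h; simp
    | succ K ih =>
      intro M hM h
      rcases le_total M (K * L) with h1 | h1
      · refine (ih M hM h1).trans ?_
        push_cast; nlinarith
      · obtain ⟨k, rfl⟩ := Nat.exists_eq_add_of_le h1
        rw [Finset.sum_range_add]
        refine (norm_add_le _ _).trans ?_
        have h2 := ih (K * L) (by omega) le_rfl
        have h3 := hB (K * L) k (by rw [Nat.add_mul] at h; omega) hM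
        push_cast; linarith
  have := key (N / L + 1) N le_rfl (by
    have := Nat.div_add_mod N L
    have h2 := Nat.mod_lt N hL
    nlinarith)
  refine this.trans ?_
  gcongr
  push_cast
  gcongr
  exact Nat.cast_div_le

theorem norm_sum_exp_le_card (f : ℕ → ℝ) (N : ℕ) :
    ‖∑ n ∈ Finset.range N, Complex.exp (f n * Complex.I)‖ ≤ N := by
  refine (norm_sum_le _ _).trans ?_
  simp [Complex.norm_exp_ofReal_mul_I]

/-- One chunk of van der Corput's second derivative test: the increments stay in an interval
of length `1`. -/
theorem second_derivative_chunk (f : ℕ → ℝ) (N : ℕ) {l : ℝ} (hl : 0 < l) (hl1 : l ≤ 1)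
    (hlo : ∀ n, n + 1 < N → l ≤ f (n + 2) - f (n + 1) - (f (n + 1) - f n))
    (hvar : ∀ n < N, f (n + 1) - f n ≤ f 1 - f 0 + 1) :
    ‖∑ n ∈ Finset.range N, Complex.exp (f n * Complex.I)‖ ≤ 17 / √l := by
  have hp := Real.pi_gt_three
  set δ := √l with hδdef
  have hδ : 0 < δ := Real.sqrt_pos.2 hl
  have hδ1 : δ ≤ 1 := Real.sqrt_le_one.2 hl1
  have hδ2 : δ * δ = l := Real.mul_self_sqrt hl.le
  set g : ℕ → ℝ := fun n => f (n + 1) - f n with hg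
  obtain ⟨k, hk1, hk2⟩ : ∃ k : ℤ, 2 * π * k - π ≤ g 0 ∧ g 0 < 2 * π * k + π := by
    refine ⟨⌊(g 0 + π) / (2 * π)⌋, ?_, ?_⟩
    · have := Int.floor_le ((g 0 + π) / (2 * π))
      rw [le_div_iff₀ (by positivity)] at this
      linarith
    · have := Int.lt_floor_add_one ((g 0 + π) / (2 * π))
      rw [div_lt_iff₀ (by positivity)] at this
      linarith
  have hgm : ∀ m n, m ≤ n → n < N → g m + l * ((n : ℝ) - m) ≤ g n := by
    intro m n hmn
    induction n, hmn using Nat.le_induction with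
    | base => intro _; simp
    | succ n hmn ih =>
      intro h
      have h1 := ih (by omega)
      have h2 := hlo n h
      simp only [hg] at h1 ⊢
      push_cast
      nlinarith
  have hgm' : ∀ m n, m ≤ n → n < N → g m ≤ g n := by
    intro m n h1 h2
    have h3 := hgm m n h1 h2
    have : (0 : ℝ) ≤ (n : ℝ) - m := by rw [sub_nonneg]; exact_mod_cast h1
    nlinarith
  have hex : ∀ c : ℝ, ∃ p ≤ N, (∀ n < p, g n < c) ∧ ∀ n, p ≤ n → n < N → c ≤ g n := by
    intro c
    classical
    have he : ∃ n, N ≤ n ∨ c ≤ g n := ⟨N, Or.inl le_rfl⟩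
    refine ⟨Nat.find he, Nat.find_min' he (Or.inl le_rfl), ?_, ?_⟩
    · intro n hn
      have := Nat.find_min he hn
      push Not at this
      exact this.2
    · intro n h1 h2
      rcases Nat.find_spec he with h | h
      · omega
      · exact h.trans (hgm' _ _ h1 h2)
  obtain ⟨p, hpN, hp1, hp2⟩ := hex (2 * π * k - δ)
  obtain ⟨q, hqN, hq1, hq2⟩ := hex (2 * π * k + δ)
  have hpq : p ≤ q := by
    by_contra h
    push Not at h
    have h1 := hp1 q h
    have h2 := hq2 q le_rfl (by omega)
    linarith
  obtain ⟨r, rfl⟩ := Nat.exists_eq_add_of_le hpq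
  obtain ⟨u, rfl⟩ := Nat.exists_eq_add_of_le hqN
  rw [Finset.sum_range_add, Finset.sum_range_add]
  have b1 : ‖∑ n ∈ Finset.range p, Complex.exp (f n * Complex.I)‖ ≤ 7 / δ := by
    apply kusmin_landau f p hδ (k - 1)
    · intro n hn; exact hgm' n (n + 1) (by omega) (by omega)
    · intro n hn
      have := hgm' 0 n (by omega) (by omega)
      simp only [hg] at this hk1
      push_cast
      linarith
    · intro n hn
      have := hp1 n hn
      simp only [hg] at this
      push_cast
      linarith
  have b3 : ‖∑ n ∈ Finset.range u, Complex.exp (f (p + r + n) * Complex.I)‖ ≤ 7 / δ := by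
    apply kusmin_landau (fun n => f (p + r + n)) u hδ k
    · intro n hn; exact hgm' (p + r + n) (p + r + n + 1) (by omega) (by omega)
    · intro n hn
      have := hq2 (p + r + n) (by omega) (by omega)
      simp only [hg] at this
      rw [← add_assoc]
      linarith
    · intro n hn
      have := hvar (p + r + n) (by omega)
      simp only [hg] at hk2
      rw [zero_add] at hk2
      rw [← add_assoc]
      linarith
  have b2 : ‖∑ n ∈ Finset.range r, Complex.exp (f (p + n) * Complex.I)‖ ≤ 3 / δ := by
    refine (norm_sum_exp_le_card (fun n => f (p + n)) r).trans ?_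
    rcases Nat.eq_zero_or_pos r with h | h
    · subst h; simp; positivity
    have h1 := hgm p (p + (r - 1)) (by omega) (by omega)
    have h2 := hp2 p le_rfl (by omega)
    have h3 := hq1 (p + (r - 1)) (by omega)
    obtain ⟨v, rfl⟩ : ∃ v, r = v + 1 := ⟨r - 1, by omega⟩
    simp only [Nat.add_sub_cancel] at h1 h3
    push_cast at h1 ⊢
    have h4 : l * v ≤ 2 * δ := by
      have : l * ((p : ℝ) + v - p) = l * v := by ring
      linarith
    rw [le_div_iff₀ hδ]
    rw [← hδ2] at h4
    have h5 : δ * v ≤ 2 := by nlinarith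
    nlinarith
  calc _ ≤ 7 / δ + 3 / δ + 7 / δ := by
        refine (norm_add_le _ _).trans ?_
        refine add_le_add ((norm_add_le _ _).trans (add_le_add b1 b2)) b3
    _ = 17 / δ := by ring

/-- Van der Corput's second derivative test in discrete form. -/
theorem second_derivative_test (f : ℕ → ℝ) (N : ℕ) {l C : ℝ} (hl : 0 < l) (hC : 1 ≤ C)
    (hlo : ∀ n, n + 1 < N → l ≤ f (n + 2) - f (n + 1) - (f (n + 1) - f n))
    (hhi : ∀ n, n + 1 < N → f (n + 2) - f (n + 1) - (f (n + 1) - f n) ≤ C * l) :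
    ‖∑ n ∈ Finset.range N, Complex.exp (f n * Complex.I)‖ ≤
      34 * C * (N * √l + 1 / √l) := by
  have hs : 0 < √l := Real.sqrt_pos.2 hl
  have hs2 : √l * √l = l := Real.mul_self_sqrt hl.le
  have hN : (0 : ℝ) ≤ N := Nat.cast_nonneg N
  rcases lt_or_ge 1 (C * l) with h | h
  · refine (norm_sum_exp_le_card f N).trans ?_
    have h1 : 1 ≤ C * √l := by
      by_contra hc
      push Not at hc
      nlinarith
    have : 0 < 1 / √l := by positivity
    nlinarith
  · have hl1 : l ≤ 1 := by nlinarith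
    have hCl : 0 < C * l := by positivity
    have hL : 0 < ⌊1 / (C * l)⌋₊ := by
      rw [Nat.floor_pos, le_div_iff₀ hCl]; linarith
    have hL1 : (⌊1 / (C * l)⌋₊ : ℝ) ≤ 1 / (C * l) := Nat.floor_le (by positivity)
    have hL2 : 1 / (C * l) / 2 ≤ (⌊1 / (C * l)⌋₊ : ℝ) := by
      have h1 := Nat.lt_floor_add_one (1 / (C * l))
      have : (1 : ℝ) ≤ ⌊1 / (C * l)⌋₊ := by exact_mod_cast hL
      linarith
    set L := ⌊1 / (C * l)⌋₊ with hLdef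
    have := norm_sum_range_le_of_chunks (fun n => Complex.exp (f n * Complex.I)) N hL
      (B := 17 / √l) (fun m k hk hmk => by
        apply second_derivative_chunk (fun i => f (m + i)) k hl hl1
        · intro n hn; exact hlo (m + n) (by omega)
        · intro n hn
          have : ∀ j, j < k → f (m + (j + 1)) - f (m + j) ≤ f (m + 1) - f (m + 0) + C * l * j := by
            intro j
            induction j with
            | zero => intro _; simp
            | succ j ih =>
              intro hj
              have h1 := ih (by omega)
              have h2 := hhi (m + j) (by omega)
              push_cast
              have e : m + (j + 1 + 1) = m + j + 2 := by ring
              rw [e]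
              rw [← add_assoc] at h1 ⊢
              linarith
          refine (this n hn).trans ?_
          have h3 : (n : ℝ) ≤ L := by exact_mod_cast (by omega : n ≤ L)
          have h4 : C * l * n ≤ C * l * (1 / (C * l)) := by gcongr; linarith
          rw [mul_one_div_cancel hCl.ne'] at h4
          linarith)
    refine this.trans ?_
    have h5 : (N : ℝ) / L ≤ 2 * C * l * N := by
      have hLp : (0 : ℝ) < L := by exact_mod_cast hL
      rw [div_le_iff₀ hLp]
      have : 1 ≤ 2 * C * l * L := by
        rw [div_div, div_le_iff₀ (by positivity)] at hL2
        linarith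
      nlinarith
    calc ((N : ℝ) / L + 1) * (17 / √l) ≤ (2 * C * l * N + 1) * (17 / √l) := by gcongr
      _ = 34 * C * N * √l + 17 * (1 / √l) := by
          rw [← hs2]; field_simp; rw [Real.sqrt_sq hs.le]; ring
      _ ≤ _ := by
          have : 0 < 1 / √l := by positivity
          nlinarith

/-- A double sum over differences is bounded by a single sum. -/
theorem sum_sum_dist_le (g : ℕ → ℝ) (hg : ∀ r, 0 ≤ g r) (H : ℕ) :
    ∑ i ∈ Finset.range H, ∑ j ∈ Finset.range H, g (max i j - min i j) ≤
      H * (2 * ∑ r ∈ Finset.range H, g r) := by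
  have : ∀ i ∈ Finset.range H, ∑ j ∈ Finset.range H, g (max i j - min i j) ≤
      2 * ∑ r ∈ Finset.range H, g r := by
    intro i hi
    rw [Finset.mem_range] at hi
    rw [← Finset.sum_filter_add_sum_filter_not _ (fun j => j ≤ i), two_mul]
    refine add_le_add ?_ ?_
    · have e : ∑ j ∈ (Finset.range H).filter (fun j => j ≤ i), g (max i j - min i j) =
          ∑ r ∈ ((Finset.range H).filter (fun j => j ≤ i)).image (fun j => i - j), g r := by
        rw [Finset.sum_image]
        · refine Finset.sum_congr rfl fun j hj => ?_
          simp only [Finset.mem_filter] at hj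
          rw [max_eq_left hj.2, min_eq_right hj.2]
        · intro x hx y hy h
          simp at hx hy h
          omega
      rw [e]
      refine Finset.sum_le_sum_of_subset_of_nonneg ?_ (fun r _ _ => hg r)
      intro r hr
      simp at hr ⊢
      omega
    · have e : ∑ j ∈ (Finset.range H).filter (fun j => ¬ j ≤ i), g (max i j - min i j) =
          ∑ r ∈ ((Finset.range H).filter (fun j => ¬ j ≤ i)).image (fun j => j - i), g r := by
        rw [Finset.sum_image]
        · refine Finset.sum_congr rfl fun j hj => ?_
          simp only [Finset.mem_filter] at hj
          rw [max_eq_right (by omega), min_eq_left (by omega)]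
        · intro x hx y hy h
          simp at hx hy h
          omega
      rw [e]
      refine Finset.sum_le_sum_of_subset_of_nonneg ?_ (fun r _ _ => hg r)
      intro r hr
      simp at hr ⊢
      omega
  refine (Finset.sum_le_sum this).trans ?_
  simp

theorem sum_shift_support (v : ℕ → ℂ) {a b A B : ℕ} (hv : ∀ k, ¬ (a ≤ k ∧ k < b) → v k = 0)
    (hA : A ≤ a) (hB : b ≤ A + B) :
    ∑ m ∈ Finset.range B, v (m + A) = ∑ k ∈ Finset.Ico a b, v k := by
  have : ∑ m ∈ Finset.range B, v (m + A) = ∑ k ∈ Finset.Ico A (A + B), v k := by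
    rw [Finset.sum_Ico_eq_sum_range]
    simp [add_comm]
  rw [this]
  symm
  refine Finset.sum_subset ?_ ?_
  · intro k hk; simp at hk ⊢; omega
  · intro k _ hk; apply hv; simpa using hk

/-- Van der Corput's (Weyl) differencing inequality. -/
theorem weyl_differencing (z : ℕ → ℂ) (N H : ℕ) (hH : 0 < H) (g : ℕ → ℝ)
    (hg : ∀ r, 0 ≤ g r)
    (hgz : ∀ r < H, ‖∑ n ∈ Finset.range (N - r), z (n + r) * (starRingEnd ℂ) (z n)‖ ≤ g r) :
    H * ‖∑ n ∈ Finset.range N, z n‖ ^ 2 ≤ (N + H) * (2 * ∑ r ∈ Finset.range H, g r) := by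
  set u : ℕ → ℂ := fun k => if H ≤ k ∧ k < H + N then z (k - H) else 0 with hu
  have hu0 : ∀ k, ¬ (H ≤ k ∧ k < H + N) → u k = 0 := fun k hk => by simp only [hu, if_neg hk]
  have hu1 : ∀ k, (H ≤ k ∧ k < H + N) → u k = z (k - H) := fun k hk => by simp only [hu, if_pos hk]
  set S := ∑ n ∈ Finset.range N, z n with hS
  have h1 : ∀ h ∈ Finset.range H, ∑ m ∈ Finset.range (N + H), u (m + h) = S := by
    intro h hh
    rw [Finset.mem_range] at hh
    rw [sum_shift_support u hu0 hh.le (by omega), Finset.sum_Ico_eq_sum_range]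
    simp only [add_tsub_cancel_left, hS]
    refine Finset.sum_congr rfl fun k hk => ?_
    rw [Finset.mem_range] at hk
    rw [hu1 _ (by omega)]
    congr 1; omega
  have h2 : (H : ℂ) * S = ∑ m ∈ Finset.range (N + H), ∑ h ∈ Finset.range H, u (m + h) := by
    rw [Finset.sum_comm, Finset.sum_congr rfl h1]; simp
  have h3 : ∀ i j : ℕ, i < H → j < H → i ≤ j →
      ∑ m ∈ Finset.range (N + H), u (m + j) * (starRingEnd ℂ) (u (m + i)) =
      ∑ n ∈ Finset.range (N - (j - i)), z (n + (j - i)) * (starRingEnd ℂ) (z n) := by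
    intro i j hi hj hij
    have := sum_shift_support (fun k => u (k + (j - i)) * (starRingEnd ℂ) (u k))
      (a := H) (b := H + (N - (j - i))) (A := i) (B := N + H) (by
        intro k hk
        by_cases hk1 : H ≤ k
        · simp only [hu0 (k + (j - i)) (by omega), zero_mul]
        · simp only [hu0 k (by omega), map_zero, mul_zero]) hi.le (by omega)
    rw [Finset.sum_Ico_eq_sum_range, add_tsub_cancel_left] at this
    refine Eq.trans (Eq.trans ?_ this) ?_
    · refine Finset.sum_congr rfl fun m _ => ?_
      rw [show m + i + (j - i) = m + j by omega]
    · refine Finset.sum_congr rfl fun n hn => ?_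
      rw [Finset.mem_range] at hn
      rw [hu1 _ (by omega), hu1 _ (by omega)]
      congr 2
      · omega
      · congr 1; omega
  have h4 : ∀ i ∈ Finset.range H, ∀ j ∈ Finset.range H,
      ‖∑ m ∈ Finset.range (N + H), u (m + i) * (starRingEnd ℂ) (u (m + j))‖ ≤
        g (max i j - min i j) := by
    intro i hi j hj
    rw [Finset.mem_range] at hi hj
    rcases le_total i j with h | h
    · rw [max_eq_right h, min_eq_left h, ← Complex.norm_conj, map_sum]
      simp only [map_mul, Complex.conj_conj]
      rw [Finset.sum_congr rfl (fun m _ => mul_comm _ _), h3 i j hi hj h]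
      exact hgz _ (by omega)
    · rw [max_eq_left h, min_eq_right h, h3 j i hj hi h]
      exact hgz _ (by omega)
  have h5 : ((∑ m ∈ Finset.range (N + H), ‖∑ h ∈ Finset.range H, u (m + h)‖ ^ 2 : ℝ) : ℂ) =
      ∑ i ∈ Finset.range H, ∑ j ∈ Finset.range H, ∑ m ∈ Finset.range (N + H),
        u (m + i) * (starRingEnd ℂ) (u (m + j)) := by
    push_cast
    rw [Finset.sum_congr rfl (fun i _ => Finset.sum_comm), Finset.sum_comm]
    refine Finset.sum_congr rfl fun m _ => ?_
    rw [← Complex.mul_conj', map_sum, Finset.sum_mul_sum]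
  have h6 : ∑ m ∈ Finset.range (N + H), ‖∑ h ∈ Finset.range H, u (m + h)‖ ^ 2 ≤
      H * (2 * ∑ r ∈ Finset.range H, g r) := by
    refine le_trans ?_ (sum_sum_dist_le g hg H)
    have : ∑ m ∈ Finset.range (N + H), ‖∑ h ∈ Finset.range H, u (m + h)‖ ^ 2 =
        ‖((∑ m ∈ Finset.range (N + H), ‖∑ h ∈ Finset.range H, u (m + h)‖ ^ 2 : ℝ) : ℂ)‖ := by
      rw [Complex.norm_real, Real.norm_of_nonneg (by positivity)]
    rw [this, h5]
    refine (norm_sum_le _ _).trans (Finset.sum_le_sum fun i hi => ?_)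
    refine (norm_sum_le _ _).trans (Finset.sum_le_sum fun j hj => h4 i hi j hj)
  have h7 : (H * ‖S‖) ^ 2 ≤ (N + H) * (H * (2 * ∑ r ∈ Finset.range H, g r)) := by
    have : H * ‖S‖ ≤ ∑ m ∈ Finset.range (N + H), ‖∑ h ∈ Finset.range H, u (m + h)‖ := by
      have := congrArg norm h2
      rw [norm_mul, Complex.norm_natCast] at this
      rw [this]; exact norm_sum_le _ _
    calc (H * ‖S‖) ^ 2 ≤ (∑ m ∈ Finset.range (N + H), ‖∑ h ∈ Finset.range H, u (m + h)‖) ^ 2 := by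
          gcongr
      _ ≤ (N + H : ℕ) * ∑ m ∈ Finset.range (N + H), ‖∑ h ∈ Finset.range H, u (m + h)‖ ^ 2 := by
          have := sq_sum_le_card_mul_sum_sq (s := Finset.range (N + H))
            (f := fun m => ‖∑ h ∈ Finset.range H, u (m + h)‖)
          simpa using this
      _ ≤ _ := by push_cast; gcongr
  have hHp : (0 : ℝ) < H := by exact_mod_cast hH
  have : (H : ℝ) * (H * ‖S‖ ^ 2) ≤ H * ((N + H) * (2 * ∑ r ∈ Finset.range H, g r)) := by
    nlinarith
  exact le_of_mul_le_mul_left this hHp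

theorem log_second_diff (x : ℝ) (hx : 0 < x) :
    Real.log (x + 2) - Real.log (x + 1) - (Real.log (x + 1) - Real.log x) =
      Real.log (1 - 1 / (x + 1) ^ 2) := by
  have : 1 - 1 / (x + 1) ^ 2 = ((x + 2) / (x + 1)) / ((x + 1) / x) := by field_simp; ring
  rw [this, Real.log_div (by positivity) (by positivity), Real.log_div (by positivity) (by positivity),
    Real.log_div (by positivity) (by positivity)]

theorem norm_block_sum_le_first (M N : ℕ) (hM : 1 ≤ M) (hN : N ≤ M) {t : ℝ} (ht : 0 < t)
    (htM : t ≤ M) :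
    ‖∑ n ∈ Finset.range N, Complex.exp (((-(t * Real.log (M + n)) : ℝ) : ℂ) * Complex.I)‖ ≤
      14 * (M / t) := by
  have hMp : (1 : ℝ) ≤ M := by exact_mod_cast hM
  have hp := Real.pi_gt_three
  have hlog : ∀ x : ℝ, 0 < x → 1 / (x + 1) ≤ Real.log (x + 1) - Real.log x ∧
      Real.log (x + 1) - Real.log x ≤ 1 / x := by
    intro x hx
    rw [← Real.log_div (by positivity) (by positivity)]
    constructor
    · have := Real.one_sub_inv_le_log_of_pos (x := (x + 1) / x) (by positivity)
      refine le_trans (le_of_eq ?_) this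
      field_simp; ring
    · refine (Real.log_le_sub_one_of_pos (by positivity)).trans (le_of_eq ?_)
      field_simp; ring
  have := kusmin_landau (fun n : ℕ => -(t * Real.log (M + n))) N (δ := t / (2 * M)) (by positivity)
    (-1) ?_ ?_ ?_
  · refine this.trans (le_of_eq ?_)
    field_simp; norm_num
  · intro n hn
    have h := log_second_diff (M + n) (by positivity)
    have : Real.log (1 - 1 / ((M : ℝ) + n + 1) ^ 2) ≤ 0 := by
      refine Real.log_nonpos ?_ ?_
      · rw [sub_nonneg, div_le_one (by positivity)]
        have : (0:ℝ) ≤ n := by positivity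
        nlinarith
      · have : 0 ≤ 1 / ((M : ℝ) + n + 1) ^ 2 := by positivity
        linarith
    rw [← h] at this
    push_cast
    rw [← add_assoc, ← add_assoc]
    nlinarith
  · intro n hn
    have h := (hlog (M + n) (by positivity)).2
    have h2 : 1 / ((M : ℝ) + n) ≤ 1 / M := by gcongr; simp
    have h3 : t * (Real.log (M + n + 1) - Real.log (M + n)) ≤ t * (1 / M) := by
      gcongr; exact h.trans h2
    have h4 : t * (1 / M) ≤ 1 := by rw [mul_one_div, div_le_one (by positivity)]; exact htM
    have h5 : t / (2 * M) = t * (1 / M) / 2 := by field_simp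
    push_cast
    rw [← add_assoc, h5]
    nlinarith
  · intro n hn
    have h := (hlog (M + n) (by positivity)).1
    have hnN : (n : ℝ) + 1 ≤ N := by exact_mod_cast (by omega : n + 1 ≤ N)
    have hNM : (N : ℝ) ≤ M := by exact_mod_cast hN
    have h2 : 1 / (2 * (M : ℝ)) ≤ 1 / (M + n + 1) := by gcongr; linarith
    have h3 : t * (1 / (2 * M)) ≤ t * (Real.log (M + n + 1) - Real.log (M + n)) := by
      gcongr; exact h2.trans h
    push_cast
    rw [← add_assoc]
    rw [mul_one_div] at h3
    nlinarith

theorem norm_block_sum_le_second (M N : ℕ) (hM : 1 ≤ M) (hN : N ≤ M) {t : ℝ} (ht : 0 < t) :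
    ‖∑ n ∈ Finset.range N, Complex.exp (((-(t * Real.log (M + n)) : ℝ) : ℂ) * Complex.I)‖ ≤
      272 * (√t + M / √t) := by
  have hMp : (1 : ℝ) ≤ M := by exact_mod_cast hM
  have hNM : (N : ℝ) ≤ M := by exact_mod_cast hN
  have hs : 0 < √t := Real.sqrt_pos.2 ht
  have := second_derivative_test (fun n : ℕ => -(t * Real.log (M + n))) N (l := t / (2 * M) ^ 2)
    (C := 4) (by positivity) (by norm_num) ?_ ?_
  · refine this.trans ?_
    rw [Real.sqrt_div ht.le, Real.sqrt_sq (by positivity)]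
    have h1 : N * (√t / (2 * M)) ≤ √t := by
      rw [mul_div_assoc', div_le_iff₀ (by positivity)]
      nlinarith
    have h2 : 1 / (√t / (2 * M)) = 2 * (M / √t) := by field_simp
    rw [h2]
    nlinarith
  · intro n hn
    have h := log_second_diff (M + n) (by positivity)
    have hn1 : (n : ℝ) + 1 ≤ N := by exact_mod_cast (by omega : n + 1 ≤ N)
    have h1 : Real.log (1 - 1 / ((M : ℝ) + n + 1) ^ 2) ≤ - (1 / (2 * M) ^ 2) := by
      refine (Real.log_le_sub_one_of_pos ?_).trans ?_
      · rw [sub_pos, div_lt_one (by positivity)]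
        have : (0:ℝ) ≤ n := by positivity
        nlinarith
      · have : 1 / (2 * (M : ℝ)) ^ 2 ≤ 1 / ((M : ℝ) + n + 1) ^ 2 := by
          gcongr; linarith
        linarith
    rw [← h] at h1
    push_cast
    rw [← add_assoc, ← add_assoc, div_eq_mul_one_div]
    nlinarith
  · intro n hn
    have h := log_second_diff (M + n) (by positivity)
    have hn0 : (0:ℝ) ≤ n := by positivity
    have h1 : - (1 / (M : ℝ) ^ 2) ≤ Real.log (1 - 1 / ((M : ℝ) + n + 1) ^ 2) := by
      have hx : 0 < 1 - 1 / ((M : ℝ) + n + 1) ^ 2 := by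
        rw [sub_pos, div_lt_one (by positivity)]
        nlinarith
      refine le_trans ?_ (Real.one_sub_inv_le_log_of_pos hx)
      have e : 1 - (1 - 1 / ((M : ℝ) + n + 1) ^ 2)⁻¹ = - (1 / ((M + n + 1 : ℝ) ^ 2 - 1)) := by
        have h7 : ((M + n + 1 : ℝ) ^ 2 - 1) ≠ 0 := by nlinarith
        have : 1 - 1 / ((M : ℝ) + n + 1) ^ 2 = ((M + n + 1 : ℝ) ^ 2 - 1) / (M + n + 1) ^ 2 := by
          field_simp
        rw [this]
        field_simp
        ring
      rw [e, neg_le_neg_iff]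
      gcongr
      nlinarith
    rw [← h] at h1
    push_cast
    have e : 4 * (t / (2 * M) ^ 2) = t * (1 / (M : ℝ) ^ 2) := by field_simp; norm_num
    rw [← add_assoc, ← add_assoc, e]
    nlinarith

theorem log_one_sub_inv_sq_diff {M y r : ℝ} (hM : 1 ≤ M) (hr : 0 < r) (hy : M + 1 ≤ y)
    (hyr : y + r ≤ 2 * M) :
    r / (8 * M ^ 3) ≤ Real.log (1 - 1 / (y + r) ^ 2) - Real.log (1 - 1 / y ^ 2) ∧
    Real.log (1 - 1 / (y + r) ^ 2) - Real.log (1 - 1 / y ^ 2) ≤ 16 * (r / (8 * M ^ 3)) := by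
  have hy0 : 0 < y := by linarith
  have hyr0 : 0 < y + r := by linarith
  have h1 : M ^ 2 ≤ y ^ 2 - 1 := by nlinarith
  have h1' : 0 < y ^ 2 - 1 := by nlinarith
  have h2 : 0 < (y + r) ^ 2 - 1 := by nlinarith
  have e1 : 1 - 1 / y ^ 2 = (y ^ 2 - 1) / y ^ 2 := by field_simp
  have e2 : 1 - 1 / (y + r) ^ 2 = ((y + r) ^ 2 - 1) / (y + r) ^ 2 := by field_simp
  rw [e1, e2, ← Real.log_div (by positivity) (by positivity)]
  set q := ((y + r) ^ 2 - 1) / (y + r) ^ 2 / ((y ^ 2 - 1) / y ^ 2) with hq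
  have hq0 : 0 < q := by positivity
  constructor
  · refine le_trans ?_ (Real.one_sub_inv_le_log_of_pos hq0)
    have : 1 - q⁻¹ = r * (2 * y + r) / (y ^ 2 * ((y + r) ^ 2 - 1)) := by
      rw [hq]; field_simp; ring
    rw [this]
    calc r / (8 * M ^ 3) = r * (2 * M) / (16 * M ^ 4) := by field_simp; norm_num
      _ ≤ r * (2 * y + r) / ((2 * M) ^ 2 * (2 * M) ^ 2) := by
        have : (2 * M) ^ 2 * (2 * M) ^ 2 = 16 * M ^ 4 := by ring
        rw [this]
        gcongr
        linarith
      _ ≤ _ := by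
        gcongr
        · linarith
        · have : (y + r) ^ 2 ≤ (2 * M) ^ 2 := by gcongr
          linarith
  · refine (Real.log_le_sub_one_of_pos hq0).trans ?_
    have : q - 1 = r * (2 * y + r) / ((y + r) ^ 2 * (y ^ 2 - 1)) := by
      rw [hq]; field_simp; ring
    rw [this]
    calc r * (2 * y + r) / ((y + r) ^ 2 * (y ^ 2 - 1)) ≤
        r * (2 * (y + r)) / ((y + r) ^ 2 * M ^ 2) := by
          gcongr; linarith
      _ = 2 * r / ((y + r) * M ^ 2) := by field_simp
      _ ≤ 2 * r / (M * M ^ 2) := by gcongr; linarith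
      _ = _ := by field_simp; norm_num

theorem sum_inv_sqrt_le (H : ℕ) : ∑ r ∈ Finset.range (H + 1), 1 / √(r : ℝ) ≤ 2 * √(H : ℝ) := by
  induction H with
  | zero => simp
  | succ n ih =>
    rw [Finset.sum_range_succ]
    have hb : 0 < √((n + 1 : ℕ) : ℝ) := Real.sqrt_pos.2 (by positivity)
    have ha : 0 ≤ √(n : ℝ) := Real.sqrt_nonneg _
    have ha2 : √(n : ℝ) ^ 2 = n := Real.sq_sqrt (by positivity)
    have hb2 : √((n + 1 : ℕ) : ℝ) ^ 2 = n + 1 := by rw [Real.sq_sqrt (by positivity)]; push_cast; rfl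
    have : 1 / √((n + 1 : ℕ) : ℝ) ≤ 2 * √((n + 1 : ℕ) : ℝ) - 2 * √(n : ℝ) := by
      rw [div_le_iff₀ hb]
      nlinarith [sq_nonneg (√((n + 1 : ℕ) : ℝ) - √(n : ℝ))]
    linarith

theorem norm_block_sum_le_third (M N : ℕ) (hM : 1 ≤ M) (hN : N ≤ M) {τ : ℝ} (hτ : 1 ≤ τ)
    (hτM : τ ≤ M) :
    ‖∑ n ∈ Finset.range N, Complex.exp (((-(τ ^ 3 * Real.log (M + n)) : ℝ) : ℂ) * Complex.I)‖ ^ 2 ≤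
      17408 * (M * (τ + M / τ)) := by
  have hMp : (1 : ℝ) ≤ M := by exact_mod_cast hM
  have hNM : (N : ℝ) ≤ M := by exact_mod_cast hN
  have hτ0 : 0 < τ := by linarith
  set H := ⌈(M : ℝ) / τ⌉₊ with hHdef
  have hH1 : (M : ℝ) / τ ≤ H := Nat.le_ceil _
  have hMτ : 1 ≤ (M : ℝ) / τ := by rw [le_div_iff₀ hτ0]; linarith
  have hH2 : (H : ℝ) ≤ 2 * (M / τ) := by
    have := Nat.ceil_lt_add_one (a := (M : ℝ) / τ) (by positivity)
    linarith
  have hH3 : (H : ℝ) ≤ M := by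
    have : H ≤ M := by
      rw [hHdef, Nat.ceil_le]
      exact div_le_self (by positivity) hτ
    exact_mod_cast this
  have hH0 : 0 < H := by
    have : (0 : ℝ) < H := by linarith
    exact_mod_cast this
  set Q := √(8 * (M : ℝ) ^ 3 / τ ^ 3) with hQ
  set g : ℕ → ℝ := fun r => if r = 0 then (N : ℝ) else 544 * (τ / 2 + Q * (1 / √(r : ℝ))) with hg
  set z : ℕ → ℂ := fun n => Complex.exp (((-(τ ^ 3 * Real.log (M + n)) : ℝ) : ℂ) * Complex.I) with hz
  have hg0 : ∀ r, 0 ≤ g r := by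
    intro r
    simp only [hg]
    split_ifs <;> positivity
  have key := weyl_differencing z N H hH0 g hg0 ?_
  · have hsum : ∑ r ∈ Finset.range H, g r ≤ N + 544 * (H * (τ / 2) + Q * (2 * √(H : ℝ))) := by
      have h1 : ∀ r ∈ Finset.range H, g r ≤ (if r = 0 then (N : ℝ) else 0) +
          544 * (τ / 2 + Q * (1 / √(r : ℝ))) := by
        intro r _
        simp only [hg]
        split_ifs
        · have : 0 ≤ 544 * (τ / 2 + Q * (1 / √(r : ℝ))) := by positivity
          linarith
        · simp
      refine (Finset.sum_le_sum h1).trans ?_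
      rw [Finset.sum_add_distrib, ← Finset.mul_sum, Finset.sum_add_distrib, ← Finset.mul_sum]
      have h2 : ∑ r ∈ Finset.range H, 1 / √(r : ℝ) ≤ 2 * √(H : ℝ) := by
        refine le_trans ?_ (sum_inv_sqrt_le H)
        rw [Finset.sum_range_succ]
        have : 0 ≤ 1 / √(H : ℝ) := by positivity
        linarith
      have h3 : ∑ i ∈ Finset.range H, (if i = 0 then (N : ℝ) else 0) ≤ N := by
        rw [Finset.sum_ite_eq']
        split_ifs
        · exact le_rfl
        · positivity
      simp only [Finset.sum_const, Finset.card_range, nsmul_eq_mul]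
      gcongr
    have hQH : Q * √(H : ℝ) ≤ 4 * (M ^ 2 / τ ^ 2) := by
      rw [hQ, ← Real.sqrt_mul (by positivity)]
      refine Real.sqrt_le_iff.2 ⟨by positivity, ?_⟩
      calc 8 * (M : ℝ) ^ 3 / τ ^ 3 * H ≤ 8 * (M : ℝ) ^ 3 / τ ^ 3 * (2 * (M / τ)) := by gcongr
        _ = _ := by field_simp; norm_num
    have hHt : (H : ℝ) * (τ / 2) ≤ M := by
      calc (H : ℝ) * (τ / 2) ≤ 2 * (M / τ) * (τ / 2) := by gcongr
        _ = M := by field_simp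
    have hs2 : ∑ r ∈ Finset.range H, g r ≤ 545 * M + 4352 * (M ^ 2 / τ ^ 2) := by linarith
    have h5 : (M / τ) * ‖∑ n ∈ Finset.range N, z n‖ ^ 2 ≤
        (M / τ) * (17408 * (M * (τ + M / τ))) := by
      calc (M / τ) * ‖∑ n ∈ Finset.range N, z n‖ ^ 2 ≤ H * ‖∑ n ∈ Finset.range N, z n‖ ^ 2 := by
            gcongr
        _ ≤ _ := key
        _ ≤ (M + M) * (2 * (545 * M + 4352 * (M ^ 2 / τ ^ 2))) := by
            have : 0 ≤ ∑ r ∈ Finset.range H, g r := Finset.sum_nonneg fun r _ => hg0 r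
            gcongr
        _ ≤ (M + M) * (2 * (4352 * M + 4352 * (M ^ 2 / τ ^ 2))) := by
            gcongr; norm_num
        _ = _ := by field_simp; ring
    exact le_of_mul_le_mul_left h5 (by positivity)
  · intro r hr
    rcases Nat.eq_zero_or_pos r with h | h
    · subst h
      simp only [hg, if_true, tsub_zero, add_zero]
      refine (norm_sum_le _ _).trans ?_
      simp only [norm_mul, Complex.norm_conj, hz, Complex.norm_exp_ofReal_mul_I]
      simp
    · have hrp : (0 : ℝ) < r := by exact_mod_cast h
      have hrH : (r : ℝ) ≤ H := by exact_mod_cast hr.le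
      have hl : 0 < τ ^ 3 * (r / (8 * (M : ℝ) ^ 3)) := by positivity
      have hzz : ∀ n, (starRingEnd ℂ) (z (n + r) * (starRingEnd ℂ) (z n)) =
          Complex.exp (((fun n : ℕ => τ ^ 3 * (Real.log (M + n + r) - Real.log (M + n))) n : ℝ) *
            Complex.I) := by
        intro n
        simp only [hz, map_mul, ← Complex.exp_conj, Complex.conj_ofReal, Complex.conj_I, map_neg]
        rw [← Complex.exp_add]
        congr 1
        push_cast
        rw [← add_assoc]
        ring
      rw [← Complex.norm_conj, map_sum]
      rw [Finset.sum_congr rfl fun n _ => hzz n]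
      have hb : ∀ n, n + 1 < N - r → (M : ℝ) + n + 1 + r ≤ 2 * M := by
        intro n hn
        have : M + n + 1 + r ≤ 2 * M := by omega
        exact_mod_cast this
      have hd : ∀ n : ℕ, τ ^ 3 * (Real.log (M + (n + 2 : ℕ) + r) - Real.log (M + (n + 2 : ℕ))) -
          τ ^ 3 * (Real.log (M + (n + 1 : ℕ) + r) - Real.log (M + (n + 1 : ℕ))) -
          (τ ^ 3 * (Real.log (M + (n + 1 : ℕ) + r) - Real.log (M + (n + 1 : ℕ))) -
          τ ^ 3 * (Real.log (M + n + r) - Real.log (M + n))) =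
          τ ^ 3 * (Real.log (1 - 1 / (M + n + 1 + r) ^ 2) - Real.log (1 - 1 / (M + n + 1 : ℝ) ^ 2)) := by
        intro n
        have h1 := log_second_diff (M + n) (by positivity)
        have h2 := log_second_diff (M + n + r) (by positivity)
        rw [show (M : ℝ) + n + 1 + r = M + n + r + 1 by ring, ← h1, ← h2]
        push_cast
        rw [show (M : ℝ) + (n + 2) + r = M + n + r + 2 by ring,
          show (M : ℝ) + (n + 1) + r = M + n + r + 1 by ring,
          show (M : ℝ) + (n + 2) = M + n + 2 by ring, show (M : ℝ) + (n + 1) = M + n + 1 by ring]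
        ring
      have := second_derivative_test
        (fun n : ℕ => τ ^ 3 * (Real.log (M + n + r) - Real.log (M + n))) (N - r)
        (C := 16) hl (by norm_num) (fun n hn => by
          simp only [hd]
          gcongr
          exact (log_one_sub_inv_sq_diff hMp hrp (by simp) (hb n hn)).1)
        (fun n hn => by
          simp only [hd]
          rw [mul_left_comm]
          gcongr
          exact (log_one_sub_inv_sq_diff hMp hrp (by simp) (hb n hn)).2)
      refine this.trans ?_
      simp only [hg, if_neg h.ne']
      norm_num only
      gcongr
      · have : ((N - r : ℕ) : ℝ) ≤ M := le_trans (by exact_mod_cast Nat.sub_le N r) hNM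
        calc ((N - r : ℕ) : ℝ) * √(τ ^ 3 * (r / (8 * (M : ℝ) ^ 3))) ≤
            M * √(τ ^ 3 * (2 * (M / τ) / (8 * (M : ℝ) ^ 3))) := by
              gcongr; linarith
          _ = M * √((τ / (2 * M)) ^ 2) := by
              congr 2; field_simp; norm_num
          _ = τ / 2 := by
              rw [Real.sqrt_sq (by positivity)]; field_simp
      · rw [hQ, mul_one_div, ← Real.sqrt_div (by positivity), one_div, ← Real.sqrt_inv]
        refine le_of_eq ?_
        congr 1
        field_simp

theorem hasDerivAt_ofReal_cpow {x : ℝ} (hx : 0 < x) (r : ℂ) :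
    HasDerivAt (fun y : ℝ => (y : ℂ) ^ r) (r * (x : ℂ) ^ (r - 1)) x := by
  rcases eq_or_ne r 0 with rfl | hr
  · simpa using hasDerivAt_const x (1 : ℂ)
  · exact hasDerivAt_ofReal_cpow_const hx.ne' hr

theorem norm_cpow_sub_cpow_le (s : ℂ) (hs : -1 ≤ s.re) {a b : ℝ} (ha : 0 < a) (hab : a ≤ b) :
    ‖(b : ℂ) ^ (-s) - (a : ℂ) ^ (-s)‖ ≤ ‖s‖ * a ^ (-s.re - 1) * (b - a) := by
  have := norm_image_sub_le_of_norm_deriv_le_segment' (f := fun y : ℝ => (y : ℂ) ^ (-s))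
    (f' := fun x => -s * (x : ℂ) ^ (-s - 1)) (a := a) (b := b) (C := ‖s‖ * a ^ (-s.re - 1))
    (fun x hx => (hasDerivAt_ofReal_cpow (ha.trans_le hx.1) (-s)).hasDerivWithinAt) ?_
  · exact this b ⟨hab, le_rfl⟩
  · intro x hx
    rw [norm_mul, norm_neg, Complex.norm_cpow_eq_rpow_re_of_pos (ha.trans_le hx.1)]
    simp only [Complex.sub_re, Complex.neg_re, Complex.one_re]
    gcongr ?_ * ?_
    exact Real.rpow_le_rpow_of_nonpos ha hx.1 (by linarith)

/-- The increment of the Euler–Maclaurin approximation to `(s - 1) ζ(s)`. -/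
noncomputable def zetaIncr (n : ℕ) (s : ℂ) : ℂ :=
  (s - 1) * ((n : ℂ) + 1) ^ (-s) + (((n : ℂ) + 2) ^ (1 - s) - ((n : ℂ) + 1) ^ (1 - s))

theorem norm_zetaIncr_le (n : ℕ) (s : ℂ) (hs : -1 ≤ s.re) :
    ‖zetaIncr n s‖ ≤ ‖s - 1‖ * ‖s‖ * ((n : ℝ) + 1) ^ (-s.re - 1) := by
  have hn : (0 : ℝ) < (n : ℝ) + 1 := by positivity
  have := norm_image_sub_le_of_norm_deriv_le_segment'
    (f := fun y : ℝ => (s - 1) * ((n : ℂ) + 1) ^ (-s) * (y : ℂ) + (y : ℂ) ^ (1 - s))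
    (f' := fun x => (s - 1) * ((n : ℂ) + 1) ^ (-s) * 1 + (1 - s) * (x : ℂ) ^ (1 - s - 1))
    (a := (n : ℝ) + 1) (b := (n : ℝ) + 2) (C := ‖s - 1‖ * ‖s‖ * ((n : ℝ) + 1) ^ (-s.re - 1))
    (fun x hx => by
      refine HasDerivAt.hasDerivWithinAt ?_
      refine HasDerivAt.add ?_ (hasDerivAt_ofReal_cpow (hn.trans_le hx.1) _)
      exact (Complex.ofRealCLM.hasDerivAt (x := x)).const_mul _) ?_
  · have h := this ((n : ℝ) + 2) ⟨by linarith, le_rfl⟩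
    have e : ((n : ℝ) + 2 - (n + 1)) = 1 := by ring
    rw [e, mul_one] at h
    refine le_trans (le_of_eq ?_) h
    rw [zetaIncr]
    congr 1
    push_cast
    ring
  · intro x hx
    have e : (s - 1) * ((n : ℂ) + 1) ^ (-s) * 1 + (1 - s) * (x : ℂ) ^ (1 - s - 1) =
        -(s - 1) * ((x : ℂ) ^ (-s) - (((n : ℝ) + 1 : ℝ) : ℂ) ^ (-s)) := by
      rw [show 1 - s - 1 = -s by ring]; push_cast; ring
    rw [e, norm_mul, norm_neg, mul_assoc]
    gcongr
    refine (norm_cpow_sub_cpow_le s hs hn hx.1).trans ?_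
    refine mul_le_of_le_one_right (by positivity) ?_
    have := hx.2
    linarith

theorem sum_zetaIncr (N : ℕ) (s : ℂ) :
    1 + ∑ n ∈ Finset.range N, zetaIncr n s =
      (s - 1) * ∑ n ∈ Finset.range N, ((n : ℂ) + 1) ^ (-s) + ((N : ℂ) + 1) ^ (1 - s) := by
  induction N with
  | zero => simp
  | succ n ih =>
    rw [Finset.sum_range_succ, Finset.sum_range_succ, ← add_assoc, ih, zetaIncr]
    push_cast
    rw [show (n : ℂ) + 1 + 1 = n + 2 by ring]
    ring

theorem differentiable_zetaIncr (n : ℕ) : Differentiable ℂ (zetaIncr n) := by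
  have h1 : (n : ℂ) + 1 ≠ 0 := by exact_mod_cast Nat.succ_ne_zero n
  have h2 : (n : ℂ) + 2 ≠ 0 := by exact_mod_cast (Nat.succ_ne_zero (n + 1))
  have e1 : Differentiable ℂ fun s : ℂ => ((n : ℂ) + 1) ^ (-s) :=
    fun s => (differentiableAt_id.neg).const_cpow (Or.inl h1)
  have e2 : Differentiable ℂ fun s : ℂ => ((n : ℂ) + 1) ^ (1 - s) :=
    fun s => (differentiableAt_id.const_sub 1).const_cpow (Or.inl h1)
  have e3 : Differentiable ℂ fun s : ℂ => ((n : ℂ) + 2) ^ (1 - s) :=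
    fun s => (differentiableAt_id.const_sub 1).const_cpow (Or.inl h2)
  unfold zetaIncr
  fun_prop

theorem summable_add_one_rpow {r : ℝ} (hr : 1 < r) : Summable fun n : ℕ => ((n : ℝ) + 1) ^ (-r) := by
  have := (summable_nat_add_iff 1).2 (Real.summable_nat_rpow.2 (by linarith : -r < -1))
  simpa using this

theorem riemannZeta₁_eq_tsum {s : ℂ} (hs : 0 < s.re) :
    riemannZeta₁ s = 1 + ∑' n, zetaIncr n s := by
  have hU : IsOpen {s : ℂ | 0 < s.re} := isOpen_lt continuous_const Complex.continuous_re
  have hUc : Convex ℝ {s : ℂ | 0 < s.re} := convex_halfSpace_re_gt 0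
  have hd : DifferentiableOn ℂ (fun s => 1 + ∑' n, zetaIncr n s) {s : ℂ | 0 < s.re} := by
    intro s0 hs0
    have hs0' : 0 < s0.re := hs0
    refine (DifferentiableAt.const_add _ ?_).differentiableWithinAt
    have hV : IsOpen ({s : ℂ | s0.re / 2 < s.re} ∩ Metric.ball s0 1) :=
      (isOpen_lt continuous_const Complex.continuous_re).inter Metric.isOpen_ball
    have := Complex.differentiableOn_tsum_of_summable_norm
      (F := zetaIncr) (U := {s : ℂ | s0.re / 2 < s.re} ∩ Metric.ball s0 1)
      (u := fun n : ℕ => (‖s0‖ + 2) * (‖s0‖ + 1) * ((n : ℝ) + 1) ^ (-(1 + s0.re / 2)))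
      ((summable_add_one_rpow (by linarith)).mul_left _)
      (fun n => (differentiable_zetaIncr n).differentiableOn) hV ?_
    · exact this.differentiableAt (hV.mem_nhds ⟨by simpa using hs0', by simp⟩)
    · rintro n w ⟨hw1, hw2⟩
      have hw1' : s0.re / 2 < w.re := hw1
      have hw3 : ‖w‖ ≤ ‖s0‖ + 1 := by
        have h := norm_add_le (w - s0) s0
        have : ‖w - s0‖ < 1 := by simpa [dist_eq_norm] using hw2
        rw [sub_add_cancel] at h; linarith
      refine (norm_zetaIncr_le n w (by linarith)).trans ?_
      gcongr
      · refine (norm_sub_le _ _).trans ?_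
        rw [norm_one]; linarith
      · simp
      · linarith
  refine AnalyticOnNhd.eqOn_of_preconnected_of_eventuallyEq
    (differentiable_riemannZeta₁.differentiableOn.analyticOnNhd hU) (hd.analyticOnNhd hU)
    hUc.isPreconnected (z₀ := 2) (by simp) ?_ hs
  have : {s : ℂ | 1 < s.re} ∈ nhds (2 : ℂ) :=
    (isOpen_lt continuous_const Complex.continuous_re).mem_nhds (by simp)
  filter_upwards [this] with s (hs : 1 < s.re)
  have hs1 : s ≠ 1 := by rintro rfl; simp at hs
  have hsum : Summable fun n => zetaIncr n s := by
    refine Summable.of_norm_bounded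
      ((summable_add_one_rpow (r := s.re + 1) (by linarith)).mul_left (‖s - 1‖ * ‖s‖)) fun n => ?_
    have := norm_zetaIncr_le n s (by linarith)
    rwa [show -s.re - 1 = -(s.re + 1) by ring] at this
  have hL : Filter.Tendsto (fun N : ℕ => 1 + ∑ n ∈ Finset.range N, zetaIncr n s) Filter.atTop
      (nhds (1 + ∑' n, zetaIncr n s)) := (hsum.hasSum.tendsto_sum_nat).const_add 1
  have hz : Summable fun n : ℕ => ((n : ℂ) + 1) ^ (-s) := by
    have := (summable_nat_add_iff 1).2 (Complex.summable_one_div_nat_cpow.2 hs)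
    simpa [Complex.cpow_neg] using this
  have hzeta : riemannZeta s = ∑' n : ℕ, ((n : ℂ) + 1) ^ (-s) := by
    rw [zeta_eq_tsum_one_div_nat_add_one_cpow hs]
    simp [Complex.cpow_neg]
  have h0 : Filter.Tendsto (fun N : ℕ => ((N : ℂ) + 1) ^ (1 - s)) Filter.atTop (nhds 0) := by
    rw [tendsto_zero_iff_norm_tendsto_zero]
    have h1 : ∀ N : ℕ, ‖((N : ℂ) + 1) ^ (1 - s)‖ = ((N : ℝ) + 1) ^ (-(s.re - 1)) := by
      intro N
      have := Complex.norm_cpow_eq_rpow_re_of_pos (x := (N : ℝ) + 1) (by positivity) (1 - s)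
      push_cast at this
      rw [this]; simp
    simp only [h1]
    exact (tendsto_rpow_neg_atTop (by linarith : 0 < s.re - 1)).comp
      (Filter.tendsto_atTop_add_const_right _ _ tendsto_natCast_atTop_atTop)
  have hR := ((hz.hasSum.tendsto_sum_nat).const_mul (s - 1)).add h0
  rw [← hzeta, add_zero] at hR
  simp only [← sum_zetaIncr] at hR
  rw [tendsto_nhds_unique hL hR, riemannZeta_eq_inv_sub_mul hs1, ← mul_assoc,
    mul_inv_cancel₀ (sub_ne_zero.2 hs1), one_mul]

theorem rpow_neg_three_halves_le (n : ℕ) :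
    ((n : ℝ) + 1) ^ (-(3 / 2) : ℝ) ≤ 4 / √((n : ℝ) + 1) - 4 / √((n : ℝ) + 2) := by
  have h1 : (0 : ℝ) < (n : ℝ) + 1 := by positivity
  set a := √((n : ℝ) + 1) with ha
  set b := √((n : ℝ) + 2) with hb
  have ha0 : 0 < a := Real.sqrt_pos.2 h1
  have hb0 : 0 < b := Real.sqrt_pos.2 (by positivity)
  have ha2 : a ^ 2 = n + 1 := Real.sq_sqrt h1.le
  have hb2 : b ^ 2 = n + 2 := Real.sq_sqrt (by positivity)
  have e : ((n : ℝ) + 1) ^ (-(3 / 2) : ℝ) = 1 / a ^ 3 := by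
    rw [Real.rpow_neg h1.le, ← one_div]
    congr 1
    rw [ha, Real.sqrt_eq_rpow, ← Real.rpow_natCast, ← Real.rpow_mul h1.le]; norm_num
  have ha1 : 1 ≤ a := by nlinarith [(Nat.cast_nonneg n : (0:ℝ) ≤ n)]
  have hab : b ≤ 3 / 2 * a := by
    refine abs_le_of_sq_le_sq' ?_ (by positivity) |>.2
    nlinarith
  have hba : (b - a) * (b + a) = 1 := by nlinarith
  rw [e, show 4 / a - 4 / b = 4 * (b - a) / (a * b) by field_simp,
    div_le_div_iff₀ (by positivity) (by positivity)]
  have : a ^ 2 * ((b - a) * (b + a)) = a ^ 2 := by rw [hba, mul_one]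
  have h3 : b - a = 1 / (b + a) := by field_simp; linarith
  rw [h3]
  have h4 : a * b * (b + a) ≤ 4 * a ^ 3 := by
    calc a * b * (b + a) ≤ a * (3 / 2 * a) * (3 / 2 * a + a) := by gcongr
      _ ≤ 4 * a ^ 3 := by nlinarith [pow_pos ha0 3]
  rw [one_mul, mul_one_div, div_mul_eq_mul_div, le_div_iff₀ (by positivity)]
  exact h4

/-- The Euler–Maclaurin approximation to `ζ` in the half-plane `1/2 ≤ Re s`. -/
theorem norm_riemannZeta₁_sub_le {s : ℂ} (hs : 1 / 2 ≤ s.re) (N : ℕ) :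
    ‖riemannZeta₁ s - ((s - 1) * ∑ n ∈ Finset.range N, ((n : ℂ) + 1) ^ (-s) +
      ((N : ℂ) + 1) ^ (1 - s))‖ ≤ 4 * (‖s - 1‖ * ‖s‖) / √((N : ℝ) + 1) := by
  have hb : ∀ n : ℕ, ‖zetaIncr n s‖ ≤ ‖s - 1‖ * ‖s‖ * (4 / √((n : ℝ) + 1) - 4 / √((n : ℝ) + 2)) := by
    intro n
    refine (norm_zetaIncr_le n s (by linarith)).trans ?_
    gcongr
    refine le_trans ?_ (rpow_neg_three_halves_le n)
    exact Real.rpow_le_rpow_of_exponent_le (by linarith [(Nat.cast_nonneg n : (0:ℝ) ≤ n)])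
      (by linarith)
  have hsum : Summable fun n => zetaIncr n s := by
    refine Summable.of_norm_bounded
      ((summable_add_one_rpow (r := s.re + 1) (by linarith)).mul_left (‖s - 1‖ * ‖s‖)) fun n => ?_
    have := norm_zetaIncr_le n s (by linarith)
    rwa [show -s.re - 1 = -(s.re + 1) by ring] at this
  rw [← sum_zetaIncr, riemannZeta₁_eq_tsum (by linarith)]
  have hL : Filter.Tendsto (fun K : ℕ => ‖1 + ∑ n ∈ Finset.range K, zetaIncr n s -
      (1 + ∑ n ∈ Finset.range N, zetaIncr n s)‖) Filter.atTop
      (nhds ‖1 + ∑' n, zetaIncr n s - (1 + ∑ n ∈ Finset.range N, zetaIncr n s)‖) :=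
    (((hsum.hasSum.tendsto_sum_nat).const_add 1).sub_const _).norm
  refine le_of_tendsto hL ?_
  filter_upwards [Filter.eventually_ge_atTop N] with K hK
  rw [add_sub_add_left_eq_sub]
  have key : ‖∑ n ∈ Finset.range K, zetaIncr n s - ∑ n ∈ Finset.range N, zetaIncr n s‖ ≤
      ‖s - 1‖ * ‖s‖ * (4 / √((N : ℝ) + 1) - 4 / √((K : ℝ) + 1)) := by
    induction K, hK using Nat.le_induction with
    | base => simp
    | succ K hK ih =>
      rw [Finset.sum_range_succ, add_sub_right_comm]
      refine (norm_add_le _ _).trans ((add_le_add ih (hb K)).trans (le_of_eq ?_))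
      push_cast
      rw [show (K : ℝ) + 1 + 1 = K + 2 by ring]
      ring
  refine key.trans ?_
  have : 0 ≤ 4 / √((K : ℝ) + 1) := by positivity
  calc _ ≤ ‖s - 1‖ * ‖s‖ * (4 / √((N : ℝ) + 1)) := by gcongr; linarith
    _ = _ := by ring

/-- Abel's inequality for antitone nonnegative weights. -/
theorem norm_sum_antitone_mul_le (w : ℕ → ℝ) (z : ℕ → ℂ) (hw : Antitone w) (hw0 : ∀ n, 0 ≤ w n)
    (N : ℕ) {B : ℝ} (hB : ∀ k ≤ N, ‖∑ i ∈ Finset.range k, z i‖ ≤ B) :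
    ‖∑ i ∈ Finset.range N, (w i : ℂ) * z i‖ ≤ w 0 * B := by
  have key : ∀ k ≤ N, ‖∑ i ∈ Finset.range k, (w i : ℂ) * z i - w k * ∑ i ∈ Finset.range k, z i‖ ≤
      (w 0 - w k) * B := by
    intro k
    induction k with
    | zero => simp
    | succ k ih =>
      intro hk
      have e : ∑ i ∈ Finset.range (k + 1), (w i : ℂ) * z i -
          w (k + 1) * ∑ i ∈ Finset.range (k + 1), z i =
          (∑ i ∈ Finset.range k, (w i : ℂ) * z i - w k * ∑ i ∈ Finset.range k, z i) +
          ((w k - w (k + 1) : ℝ) : ℂ) * ∑ i ∈ Finset.range (k + 1), z i := by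
        rw [Finset.sum_range_succ, Finset.sum_range_succ]; push_cast; ring
      rw [e]
      refine (norm_add_le _ _).trans ?_
      have h1 : 0 ≤ w k - w (k + 1) := sub_nonneg.2 (hw (Nat.le_succ k))
      rw [norm_mul, Complex.norm_real, Real.norm_of_nonneg h1]
      have h2 := ih (by omega)
      have h3 : (w k - w (k + 1)) * ‖∑ i ∈ Finset.range (k + 1), z i‖ ≤ (w k - w (k + 1)) * B := by
        gcongr; exact hB _ hk
      linarith
  have h1 := key N le_rfl
  have h2 : ‖(w N : ℂ) * ∑ i ∈ Finset.range N, z i‖ ≤ w N * B := by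
    rw [norm_mul, Complex.norm_real, Real.norm_of_nonneg (hw0 N)]
    exact mul_le_mul_of_nonneg_left (hB N le_rfl) (hw0 N)
  have h3 := norm_add_le (∑ i ∈ Finset.range N, (w i : ℂ) * z i - w N * ∑ i ∈ Finset.range N, z i)
    ((w N : ℂ) * ∑ i ∈ Finset.range N, z i)
  rw [sub_add_cancel] at h3
  linarith

theorem natCast_cpow_neg {n : ℕ} (hn : 0 < n) (s : ℂ) :
    (n : ℂ) ^ (-s) = (((n : ℝ) ^ (-s.re) : ℝ) : ℂ) *
      Complex.exp (((-(s.im * Real.log n) : ℝ) : ℂ) * Complex.I) := by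
  have hn' : (0 : ℝ) < n := by exact_mod_cast hn
  rw [Complex.cpow_def_of_ne_zero (by exact_mod_cast hn.ne'), ← Complex.natCast_log,
    Real.rpow_def_of_pos hn', Complex.ofReal_exp, ← Complex.exp_add]
  congr 1
  conv_lhs => rw [← Complex.re_add_im s]
  push_cast
  ring

theorem norm_sum_cpow_le (M N : ℕ) (hM : 1 ≤ M) {s : ℂ} (hs : 0 ≤ s.re) {B : ℝ}
    (hB : ∀ k ≤ N, ‖∑ n ∈ Finset.range k,
      Complex.exp (((-(s.im * Real.log (M + n)) : ℝ) : ℂ) * Complex.I)‖ ≤ B) :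
    ‖∑ n ∈ Finset.range N, ((M + n : ℕ) : ℂ) ^ (-s)‖ ≤ (M : ℝ) ^ (-s.re) * B := by
  have hMp : (0 : ℝ) < M := by exact_mod_cast hM
  have := norm_sum_antitone_mul_le (fun n => ((M : ℝ) + n) ^ (-s.re))
    (fun n => Complex.exp (((-(s.im * Real.log (M + n)) : ℝ) : ℂ) * Complex.I)) ?_
    (fun n => by positivity) N hB
  · simp only [Nat.cast_zero, add_zero] at this
    refine le_trans (le_of_eq ?_) this
    congr 1
    refine Finset.sum_congr rfl fun n _ => ?_
    rw [natCast_cpow_neg (by omega)]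
    push_cast
    rfl
  · intro a b hab
    refine Real.rpow_le_rpow_of_nonpos (by positivity) ?_ (by linarith)
    have : (a : ℝ) ≤ b := by exact_mod_cast hab
    linarith

/-- The dyadic block `∑ n^{-s}` over `2^j ≤ n < 2^(j+1)`. -/
noncomputable def dyad (j : ℕ) (s : ℂ) : ℂ := ∑ n ∈ Finset.range (2 ^ j), ((2 ^ j + n : ℕ) : ℂ) ^ (-s)

theorem sum_dyad (K : ℕ) (s : ℂ) :
    ∑ j ∈ Finset.range K, dyad j s = ∑ n ∈ Finset.range (2 ^ K - 1), ((n : ℂ) + 1) ^ (-s) := by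
  induction K with
  | zero => simp
  | succ K ih =>
    have h : 0 < 2 ^ K := by positivity
    rw [Finset.sum_range_succ, ih, show 2 ^ (K + 1) - 1 = (2 ^ K - 1) + 2 ^ K by rw [pow_succ]; omega,
      Finset.sum_range_add, dyad]
    congr 1
    refine Finset.sum_congr rfl fun n _ => ?_
    congr 1
    rw [show 2 ^ K + n = (2 ^ K - 1 + n) + 1 by omega]
    push_cast
    rfl

theorem rpow_neg_le_inv_sqrt {M σ : ℝ} (hM : 1 ≤ M) (hσ : 1 / 2 ≤ σ) : M ^ (-σ) ≤ 1 / √M := by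
  rw [Real.sqrt_eq_rpow, one_div (M ^ _), ← Real.rpow_neg (by linarith)]
  exact Real.rpow_le_rpow_of_exponent_le hM (by linarith)

theorem norm_dyad_le_trivial (j : ℕ) {s : ℂ} (hs : 0 ≤ s.re) :
    ‖dyad j s‖ ≤ ((2 : ℝ) ^ j) ^ (1 - s.re) := by
  have h := norm_sum_cpow_le (2 ^ j) (2 ^ j) Nat.one_le_two_pow hs (B := (2 : ℝ) ^ j) (fun k hk => by
    refine (norm_sum_exp_le_card (fun n : ℕ => -(s.im * Real.log ((2 ^ j : ℕ) + n))) k).trans ?_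
    exact_mod_cast hk)
  refine h.trans (le_of_eq ?_)
  rw [sub_eq_neg_add, Real.rpow_add (by positivity), Real.rpow_one]
  push_cast; rfl

theorem norm_dyad_le_first (j : ℕ) {s : ℂ} (hs : 1 / 2 ≤ s.re) (ht : 0 < s.im)
    (htj : s.im ≤ 2 ^ j) : ‖dyad j s‖ ≤ 14 / s.im * √((2 : ℝ) ^ j) := by
  have h := norm_sum_cpow_le (2 ^ j) (2 ^ j) Nat.one_le_two_pow (s := s) (by linarith)
    (B := 14 * ((2 ^ j : ℕ) / s.im)) (fun k hk =>
    norm_block_sum_le_first (2 ^ j) k Nat.one_le_two_pow hk ht (by push_cast; exact htj))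
  refine h.trans ?_
  have h1 : (1 : ℝ) ≤ 2 ^ j := one_le_pow₀ (by norm_num)
  push_cast
  calc ((2 : ℝ) ^ j) ^ (-s.re) * (14 * (2 ^ j / s.im)) ≤ 1 / √((2 : ℝ) ^ j) * (14 * (2 ^ j / s.im)) := by
        gcongr; exact rpow_neg_le_inv_sqrt h1 hs
    _ = 14 / s.im * (2 ^ j / √((2 : ℝ) ^ j)) := by ring
    _ = _ := by rw [Real.div_sqrt]

theorem norm_dyad_le_weyl (j : ℕ) {s : ℂ} (hs : 1 / 2 ≤ s.re) (ht : 1 ≤ s.im)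
    (htj : 2 ^ j ≤ 4 * s.im) : ‖dyad j s‖ ≤ 1200 * s.im ^ (1 / 6 : ℝ) := by
  set t := s.im with htdef
  set M : ℝ := 2 ^ j with hM
  have hM1 : 1 ≤ M := one_le_pow₀ (by norm_num)
  have ht0 : 0 < t := by linarith
  set u := t ^ (1 / 6 : ℝ) with hu
  have hu1 : 1 ≤ u := Real.one_le_rpow ht (by norm_num)
  have hu6 : u ^ 6 = t := by
    rw [hu, ← Real.rpow_natCast, ← Real.rpow_mul ht0.le]; norm_num
  have hst : √t = u ^ 3 := by
    rw [← hu6, show u ^ 6 = (u ^ 3) ^ 2 by ring, Real.sqrt_sq (by positivity)]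
  have hsM : 0 < √M := Real.sqrt_pos.2 (by linarith)
  have hsM2 : √M ^ 2 = M := Real.sq_sqrt (by linarith)
  have red : ∀ B : ℝ, 0 ≤ B → (∀ k ≤ 2 ^ j, ‖∑ n ∈ Finset.range k,
      Complex.exp (((-(t * Real.log ((2 ^ j : ℕ) + n)) : ℝ) : ℂ) * Complex.I)‖ ≤ B) →
      ‖dyad j s‖ ≤ 1 / √M * B := by
    intro B hB0 hB
    refine (norm_sum_cpow_le (2 ^ j) (2 ^ j) Nat.one_le_two_pow (s := s) (by linarith) hB).trans ?_
    gcongr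
    push_cast
    exact rpow_neg_le_inv_sqrt hM1 hs
  rcases le_total M (u ^ 2) with h1 | h1
  · refine (red M (by linarith) fun k hk => ?_).trans ?_
    · refine (norm_sum_exp_le_card (fun n : ℕ => -(t * Real.log ((2 ^ j : ℕ) + n))) k).trans ?_
      rw [hM]; exact_mod_cast hk
    · rw [one_div_mul_eq_div, Real.div_sqrt]
      have : √M ≤ u := Real.sqrt_le_iff.2 ⟨by linarith, h1⟩
      linarith
  rcases le_total M (u ^ 4) with h2 | h2
  · refine (red (187 * (√M * u)) (by positivity) fun k hk => ?_).trans ?_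
    · have h := norm_block_sum_le_third (2 ^ j) k Nat.one_le_two_pow hk (τ := u ^ 2)
        (one_le_pow₀ hu1) (by push_cast; exact h1)
      rw [show (u ^ 2) ^ 3 = t by rw [← hu6]; ring] at h
      refine abs_le_of_sq_le_sq' (h.trans ?_) (by positivity) |>.2
      have h3 : M / u ^ 2 ≤ u ^ 2 := by
        rw [div_le_iff₀ (by positivity)]; nlinarith
      push_cast
      rw [← hM]
      calc 17408 * (M * (u ^ 2 + M / u ^ 2)) ≤ 17408 * (M * (u ^ 2 + u ^ 2)) := by gcongr
        _ ≤ (187 * (√M * u)) ^ 2 := by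
          rw [mul_pow, mul_pow, hsM2]
          have : 0 ≤ M * u ^ 2 := by positivity
          nlinarith
    · have : 1 / √M * (187 * (√M * u)) = 187 * u := by field_simp
      rw [this]; linarith
  · refine (red (272 * (√t + M / √t)) (by positivity) fun k hk => ?_).trans ?_
    · have h := norm_block_sum_le_second (2 ^ j) k Nat.one_le_two_pow hk ht0
      push_cast at h ⊢
      exact h
    · have h3 : u ^ 2 ≤ √M := Real.le_sqrt_of_sq_le (by nlinarith)
      have h4 : √M ≤ 2 * u ^ 3 := by
        refine Real.sqrt_le_iff.2 ⟨by positivity, ?_⟩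
        nlinarith
      rw [hst]
      have h5 : 1 / √M * (272 * (u ^ 3 + M / u ^ 3)) = 272 * (u ^ 3 / √M + √M / u ^ 3) := by
        rw [← hsM2]; field_simp; rw [Real.sqrt_sq hsM.le]
      rw [h5]
      have h6 : u ^ 3 / √M ≤ u := by
        rw [div_le_iff₀ hsM]; nlinarith
      have h7 : √M / u ^ 3 ≤ 2 := by rw [div_le_iff₀ (by positivity)]; exact h4
      nlinarith

theorem sum_sqrt_two_pow_le (K : ℕ) :
    ∑ j ∈ Finset.range K, √((2 : ℝ) ^ j) ≤ 3 * √((2 : ℝ) ^ K) := by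
  induction K with
  | zero => simp
  | succ K ih =>
    rw [Finset.sum_range_succ, pow_succ, Real.sqrt_mul (by positivity)]
    have h : (4 / 3 : ℝ) ≤ √2 := Real.le_sqrt_of_sq_le (by norm_num)
    have : 0 ≤ √((2 : ℝ) ^ K) := Real.sqrt_nonneg _
    nlinarith

/-- `ζ(s)` is approximated by the dyadic blocks up to height `Im s`. -/
theorem norm_riemannZeta_sub_sum_dyad_le {s : ℂ} (hs : 1 / 2 ≤ s.re) (hs3 : s.re ≤ 3)
    (ht : 1 ≤ s.im) (J : ℕ) (hJ1 : s.im ≤ 2 ^ J) (hJ2 : (2 : ℝ) ^ J ≤ 4 * s.im) :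
    ‖riemannZeta s - ∑ j ∈ Finset.range J, dyad j s‖ ≤ 200 := by
  set t := s.im with htdef
  have ht0 : 0 < t := by linarith
  obtain ⟨n, hn1, hn2⟩ := exists_nat_pow_near (x := 4 * t ^ 2) (y := 2) (by nlinarith) (by norm_num)
  set K := n + 1 with hK
  have hK1 : 4 * t ^ 2 ≤ 2 ^ K := hn2.le
  have hK2 : (2 : ℝ) ^ K ≤ 8 * t ^ 2 := by rw [hK, pow_succ]; linarith
  have hs1 : s - 1 ≠ 0 := by
    intro h
    have := congrArg Complex.im h
    simp at this; linarith
  have hJK : J ≤ K := by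
    have : (2 : ℝ) ^ J ≤ 2 ^ K := by nlinarith
    exact (pow_le_pow_iff_right₀ (by norm_num : (1 : ℝ) < 2)).1 this
  have hsK1 : 2 * t ≤ √((2 : ℝ) ^ K) := Real.le_sqrt_of_sq_le (by nlinarith)
  have hsK2 : √((2 : ℝ) ^ K) ≤ 3 * t := Real.sqrt_le_iff.2 ⟨by linarith, by nlinarith⟩
  have hN : ((2 ^ K - 1 : ℕ) : ℝ) + 1 = 2 ^ K := by
    have : 2 ^ K - 1 + 1 = 2 ^ K := Nat.sub_add_cancel Nat.one_le_two_pow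
    exact_mod_cast this
  have hN' : ((2 ^ K - 1 : ℕ) : ℂ) + 1 = ((2 ^ K : ℝ) : ℂ) := by
    rw [← hN]; push_cast; rfl
  have h := norm_riemannZeta₁_sub_le hs (2 ^ K - 1)
  rw [← sum_dyad, hN, hN'] at h
  have hst : t ≤ ‖s - 1‖ := by
    have := Complex.abs_im_le_norm (s - 1)
    simp only [Complex.sub_im, Complex.one_im, sub_zero, ← htdef, abs_of_pos ht0] at this
    exact this
  have hsn : ‖s‖ ≤ 4 * t := by
    have := Complex.norm_le_abs_re_add_abs_im s
    rw [abs_of_nonneg (by linarith : 0 ≤ s.re), ← htdef, abs_of_pos ht0] at this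
    linarith
  have h1 : ‖riemannZeta s - (∑ j ∈ Finset.range K, dyad j s + (((2 ^ K : ℝ) : ℂ) ^ (1 - s)) / (s - 1))‖
      ≤ 8 := by
    rw [riemannZeta_eq_inv_sub_mul (sub_ne_zero.1 hs1)]
    have e : (s - 1)⁻¹ * riemannZeta₁ s - (∑ j ∈ Finset.range K, dyad j s +
        (((2 ^ K : ℝ) : ℂ) ^ (1 - s)) / (s - 1)) = (s - 1)⁻¹ * (riemannZeta₁ s -
        ((s - 1) * ∑ j ∈ Finset.range K, dyad j s + ((2 ^ K : ℝ) : ℂ) ^ (1 - s))) := by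
      field_simp
    rw [e, norm_mul, norm_inv]
    calc ‖s - 1‖⁻¹ * _ ≤ ‖s - 1‖⁻¹ * (4 * (‖s - 1‖ * ‖s‖) / √((2 : ℝ) ^ K)) := by gcongr
      _ = 4 * ‖s‖ / √((2 : ℝ) ^ K) := by
        have : ‖s - 1‖ ≠ 0 := norm_ne_zero_iff.2 hs1
        field_simp
      _ ≤ 4 * (4 * t) / (2 * t) := by gcongr
      _ = 8 := by field_simp; norm_num
  have h2 : ‖(((2 ^ K : ℝ) : ℂ) ^ (1 - s)) / (s - 1)‖ ≤ 3 := by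
    rw [norm_div, Complex.norm_cpow_eq_rpow_re_of_pos (by positivity)]
    simp only [Complex.sub_re, Complex.one_re]
    have h3 : ((2 : ℝ) ^ K) ^ (1 - s.re) ≤ √((2 : ℝ) ^ K) := by
      rw [Real.sqrt_eq_rpow]
      exact Real.rpow_le_rpow_of_exponent_le (one_le_pow₀ (by norm_num)) (by linarith)
    calc ((2 : ℝ) ^ K) ^ (1 - s.re) / ‖s - 1‖ ≤ (3 * t) / t := by gcongr; linarith
      _ = 3 := by field_simp
  have h4 : ‖∑ j ∈ Finset.Ico J K, dyad j s‖ ≤ 126 := by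
    calc ‖∑ j ∈ Finset.Ico J K, dyad j s‖ ≤ ∑ j ∈ Finset.Ico J K, 14 / t * √((2 : ℝ) ^ j) := by
          refine (norm_sum_le _ _).trans (Finset.sum_le_sum fun j hj => ?_)
          rw [Finset.mem_Ico] at hj
          refine norm_dyad_le_first j hs ht0 (hJ1.trans ?_)
          exact pow_le_pow_right₀ (by norm_num) hj.1
      _ ≤ ∑ j ∈ Finset.range K, 14 / t * √((2 : ℝ) ^ j) := by
          refine Finset.sum_le_sum_of_subset_of_nonneg ?_ fun _ _ _ => by positivity
          intro j hj; simp at hj ⊢; omega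
      _ ≤ 14 / t * (3 * (3 * t)) := by
          rw [← Finset.mul_sum]
          gcongr
          exact (sum_sqrt_two_pow_le K).trans (by gcongr)
      _ = 126 := by field_simp; norm_num
  have e : riemannZeta s - ∑ j ∈ Finset.range J, dyad j s =
      (riemannZeta s - (∑ j ∈ Finset.range K, dyad j s + (((2 ^ K : ℝ) : ℂ) ^ (1 - s)) / (s - 1))) +
      (((2 ^ K : ℝ) : ℂ) ^ (1 - s)) / (s - 1) + ∑ j ∈ Finset.Ico J K, dyad j s := by
    rw [← Finset.sum_range_add_sum_Ico _ hJK]; ring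
  rw [e]
  refine (norm_add₃_le).trans ?_
  linarith

theorem norm_riemannZeta_le_of_dyad {s : ℂ} (hs : 1 / 2 ≤ s.re) (hs3 : s.re ≤ 3)
    (ht : 1 ≤ s.im) {B : ℝ} (hB0 : 0 ≤ B)
    (hB : ∀ j : ℕ, (2 : ℝ) ^ j ≤ s.im → ‖dyad j s‖ ≤ B) :
    ‖riemannZeta s‖ ≤ 200 + (1 + 2 * Real.log s.im) * B := by
  obtain ⟨n, hn1, hn2⟩ := exists_nat_pow_near (x := s.im) (y := 2) ht (by norm_num)
  have h := norm_riemannZeta_sub_sum_dyad_le hs hs3 ht (n + 1) hn2.le (by rw [pow_succ]; linarith)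
  have hn : (n : ℝ) ≤ 2 * Real.log s.im := by
    have h1 := Real.log_le_log (by positivity) hn1
    rw [Real.log_pow] at h1
    have := Real.log_two_gt_d9
    nlinarith [(Nat.cast_nonneg n : (0 : ℝ) ≤ n)]
  have h2 : ‖∑ j ∈ Finset.range (n + 1), dyad j s‖ ≤ (n + 1 : ℕ) * B := by
    refine (norm_sum_le _ _).trans ?_
    rw [← nsmul_eq_mul]
    have : ∀ j ∈ Finset.range (n + 1), ‖dyad j s‖ ≤ B := by
      intro j hj
      rw [Finset.mem_range] at hj
      exact hB j ((pow_le_pow_right₀ (by norm_num) (by omega)).trans hn1)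
    simpa using Finset.sum_le_card_nsmul _ _ _ this
  have h3 := norm_add_le (riemannZeta s - ∑ j ∈ Finset.range (n + 1), dyad j s)
    (∑ j ∈ Finset.range (n + 1), dyad j s)
  rw [sub_add_cancel] at h3
  push_cast at h2
  nlinarith

/-- Weyl's bound for `ζ` near the critical line. -/
theorem norm_riemannZeta_le_weyl {s : ℂ} (hs : 1 / 2 ≤ s.re) (hs3 : s.re ≤ 3) (ht : 1 ≤ s.im) :
    ‖riemannZeta s‖ ≤ 200 + (1 + 2 * Real.log s.im) * (1200 * s.im ^ (1 / 6 : ℝ)) :=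
  norm_riemannZeta_le_of_dyad hs hs3 ht (by positivity) fun j hj =>
    norm_dyad_le_weyl j hs ht (by linarith)

theorem norm_riemannZeta_le_trivial {s : ℂ} {σ : ℝ} (hσ : 1 / 2 ≤ σ) (hσ1 : σ ≤ 1)
    (hs : σ ≤ s.re) (hs3 : s.re ≤ 3) (ht : 1 ≤ s.im) :
    ‖riemannZeta s‖ ≤ 200 + (1 + 2 * Real.log s.im) * s.im ^ (1 - σ) :=
  norm_riemannZeta_le_of_dyad (by linarith) hs3 ht (by positivity) fun j hj => by
    refine (norm_dyad_le_trivial j (by linarith)).trans ?_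
    calc ((2 : ℝ) ^ j) ^ (1 - s.re) ≤ ((2 : ℝ) ^ j) ^ (1 - σ) :=
          Real.rpow_le_rpow_of_exponent_le (one_le_pow₀ (by norm_num)) (by linarith)
      _ ≤ _ := Real.rpow_le_rpow (by positivity) hj (by linarith)

theorem exists_log_mul_rpow_le {p q A B : ℝ} (hA : 0 ≤ A) (hB : 0 ≤ B) (hp : 0 ≤ p) (hpq : p < q) :
    ∃ C : ℝ, 0 < C ∧ ∀ t : ℝ, 1 ≤ t → A + (1 + 2 * Real.log t) * (B * t ^ p) ≤ C * t ^ q := by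
  refine ⟨A + (1 + 2 / (q - p)) * B + 1, ?_, ?_⟩
  · have : 0 < q - p := by linarith
    positivity
  intro t ht
  have hqp : 0 < q - p := by linarith
  have h1 : Real.log t ≤ t ^ (q - p) / (q - p) := Real.log_le_rpow_div (by linarith) hqp
  have h2 : 1 ≤ t ^ (q - p) := Real.one_le_rpow ht hqp.le
  have h3 : 1 ≤ t ^ q := Real.one_le_rpow ht (by linarith)
  have h4 : 1 + 2 * Real.log t ≤ (1 + 2 / (q - p)) * t ^ (q - p) := by
    have : 2 / (q - p) * t ^ (q - p) = 2 * (t ^ (q - p) / (q - p)) := by ring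
    nlinarith
  have h5 : t ^ (q - p) * t ^ p = t ^ q := by
    rw [← Real.rpow_add (by linarith)]; congr 1; ring
  have h6 : (1 + 2 * Real.log t) * (B * t ^ p) ≤ (1 + 2 / (q - p)) * B * t ^ q := by
    calc (1 + 2 * Real.log t) * (B * t ^ p) ≤ ((1 + 2 / (q - p)) * t ^ (q - p)) * (B * t ^ p) := by
          gcongr
      _ = (1 + 2 / (q - p)) * B * (t ^ (q - p) * t ^ p) := by ring
      _ = _ := by rw [h5]
  nlinarith

theorem add_one_le_mul_rpow {ε : ℝ} (hε : 0 < ε) {p : ℝ} (hp : 2 ≤ p) (a : ℕ) :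
    (a : ℝ) + 1 ≤ (1 + 2 / ε) * (p ^ a) ^ ε := by
  have h0 : (1 : ℝ) ≤ (2 ^ a) ^ ε := Real.one_le_rpow (one_le_pow₀ (by norm_num)) hε.le
  have h1 : ((2 : ℝ) ^ a) ^ ε ≤ (p ^ a) ^ ε := by gcongr
  have h2 : (a : ℝ) * ε / 2 ≤ (2 ^ a) ^ ε := by
    have e : ((2 : ℝ) ^ a) ^ ε = Real.exp (Real.log 2 * (a * ε)) := by
      rw [← Real.rpow_natCast, ← Real.rpow_mul (by norm_num), Real.rpow_def_of_pos (by norm_num)]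
    rw [e]
    have h3 := Real.add_one_le_exp (Real.log 2 * (a * ε))
    have h4 := Real.log_two_gt_d9
    have : 0 ≤ (a : ℝ) * ε := by positivity
    nlinarith
  have h5 : (a : ℝ) ≤ 2 / ε * (2 ^ a) ^ ε := by
    rw [div_mul_eq_mul_div, le_div_iff₀ hε]; linarith
  have : 0 < 1 + 2 / ε := by positivity
  calc (a : ℝ) + 1 ≤ (1 + 2 / ε) * (2 ^ a) ^ ε := by linarith
    _ ≤ _ := by gcongr

/-- The divisor bound. -/
theorem exists_card_divisors_le {ε : ℝ} (hε : 0 < ε) :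
    ∃ C : ℝ, 1 ≤ C ∧ ∀ n : ℕ, n ≠ 0 → (n.divisors.card : ℝ) ≤ C * (n : ℝ) ^ ε := by
  obtain ⟨P, hP⟩ := exists_nat_ge ((2 : ℝ) ^ (1 / ε))
  have hK : 1 ≤ 1 + 2 / ε := by have : 0 < 2 / ε := by positivity
                                linarith
  refine ⟨(1 + 2 / ε) ^ P, one_le_pow₀ hK, fun n hn => ?_⟩
  rw [Nat.card_divisors hn]
  have hn2 : (n : ℝ) ^ ε = ∏ p ∈ n.primeFactors, ((p : ℝ) ^ (n.factorization p)) ^ ε := by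
    conv_lhs => rw [← Nat.prod_factorization_pow_eq_self hn]
    rw [Finsupp.prod, Nat.support_factorization, Nat.cast_prod,
      ← Real.finsetProd_rpow _ _ (fun i _ => by positivity)]
    push_cast
    rfl
  have h1 : ∀ p ∈ n.primeFactors, ((n.factorization p + 1 : ℕ) : ℝ) ≤
      (if p < P then 1 + 2 / ε else 1) * ((p : ℝ) ^ (n.factorization p)) ^ ε := by
    intro p hp
    have hp2 : (2 : ℝ) ≤ p := by exact_mod_cast (Nat.prime_of_mem_primeFactors hp).two_le
    push_cast
    split_ifs with h
    · exact add_one_le_mul_rpow hε hp2 _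
    · have hpP : (2 : ℝ) ^ (1 / ε) ≤ p := hP.trans (by exact_mod_cast not_lt.1 h)
      have h2 : (2 : ℝ) ≤ (p : ℝ) ^ ε := by
        calc (2 : ℝ) = ((2 : ℝ) ^ (1 / ε)) ^ ε := by
              rw [← Real.rpow_mul (by norm_num), one_div_mul_cancel hε.ne', Real.rpow_one]
          _ ≤ _ := by gcongr
      have e : ((p : ℝ) ^ (n.factorization p)) ^ ε = ((p : ℝ) ^ ε) ^ (n.factorization p) := by
        rw [← Real.rpow_natCast, ← Real.rpow_natCast, ← Real.rpow_mul (by positivity),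
          ← Real.rpow_mul (by positivity), mul_comm]
      rw [one_mul, e]
      have h3 := one_add_mul_le_pow (a := (1 : ℝ)) (by norm_num) (n.factorization p)
      calc (n.factorization p : ℝ) + 1 ≤ (1 + 1) ^ (n.factorization p) := by linarith
        _ ≤ _ := by gcongr; linarith
  push_cast at h1 ⊢
  refine (Finset.prod_le_prod (fun i _ => by positivity) h1).trans ?_
  rw [Finset.prod_mul_distrib, hn2]
  refine mul_le_mul_of_nonneg_right ?_ (Finset.prod_nonneg fun i _ => by positivity)
  rw [← Finset.prod_filter, Finset.prod_const]
  refine pow_le_pow_right₀ hK ?_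
  calc _ ≤ (Finset.range P).card := Finset.card_le_card fun p hp => by
        simp at hp ⊢; exact hp.2
    _ = P := Finset.card_range P

theorem dk_succ (k n : ℕ) : dk (k + 1) n = ∑ p ∈ n.divisorsAntidiagonal, dk k p.1 := by
  unfold dk
  rw [pow_succ, ArithmeticFunction.mul_apply]
  refine Finset.sum_congr rfl fun p hp => ?_
  have := (Nat.mem_divisorsAntidiagonal.1 hp)
  rw [ArithmeticFunction.zeta_apply_ne (by rintro h; simp [h] at this; exact this.2 this.1.symm), mul_one]

theorem exists_dk_le (k : ℕ) {ε : ℝ} (hε : 0 < ε) :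
    ∃ C : ℝ, 1 ≤ C ∧ ∀ n : ℕ, n ≠ 0 → (dk k n : ℝ) ≤ C * (n : ℝ) ^ ε := by
  induction k generalizing ε with
  | zero =>
    refine ⟨1, le_rfl, fun n hn => ?_⟩
    have h1 : (1 : ℝ) ≤ (n : ℝ) ^ ε :=
      Real.one_le_rpow (by exact_mod_cast Nat.one_le_iff_ne_zero.2 hn) hε.le
    simp only [dk, pow_zero, ArithmeticFunction.one_apply]
    split_ifs <;> simp <;> linarith
  | succ k ih =>
    obtain ⟨C1, hC1, h1⟩ := ih (half_pos hε)
    obtain ⟨C2, hC2, h2⟩ := exists_card_divisors_le (half_pos hε)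
    refine ⟨C2 * C1, one_le_mul_of_one_le_of_one_le hC2 hC1, fun n hn => ?_⟩
    rw [dk_succ]
    push_cast
    have h3 : ∀ p ∈ n.divisorsAntidiagonal, (dk k p.1 : ℝ) ≤ C1 * (n : ℝ) ^ (ε / 2) := by
      intro p hp
      have hp' := Nat.mem_divisorsAntidiagonal.1 hp
      have hp0 : p.1 ≠ 0 := by rintro h; simp [h] at hp'; exact hp'.2 hp'.1.symm
      refine (h1 p.1 hp0).trans ?_
      gcongr
      exact Nat.le_of_dvd (Nat.pos_of_ne_zero hn) ⟨p.2, hp'.1.symm⟩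
    refine (Finset.sum_le_card_nsmul _ _ _ h3).trans ?_
    have hcard : n.divisorsAntidiagonal.card = n.divisors.card := by
      rw [← Nat.map_div_right_divisors, Finset.card_map]
    rw [hcard, nsmul_eq_mul]
    calc (n.divisors.card : ℝ) * (C1 * (n : ℝ) ^ (ε / 2)) ≤
        (C2 * (n : ℝ) ^ (ε / 2)) * (C1 * (n : ℝ) ^ (ε / 2)) := by
          gcongr; exact h2 n hn
      _ = C2 * C1 * ((n : ℝ) ^ (ε / 2) * (n : ℝ) ^ (ε / 2)) := by ring
      _ = _ := by
        rw [← Real.rpow_add (by exact_mod_cast Nat.pos_of_ne_zero hn), add_halves]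

lemma norm_integral_cexp_mul_I_le {l : ℝ} (hl : l ≠ 0) (A B : ℝ) :
    ‖∫ t in A..B, Complex.exp ((t * l : ℝ) * Complex.I)‖ ≤ 2 / |l| := by
  have hc : (l : ℂ) * Complex.I ≠ 0 := by simp [hl]
  have h : ∀ t : ℝ, Complex.exp ((t * l : ℝ) * Complex.I) =
      Complex.exp (((l : ℂ) * Complex.I) * t) := by
    intro t; congr 1; push_cast; ring
  simp_rw [h]
  rw [integral_exp_mul_complex hc, norm_div]
  have h1 : ‖(l : ℂ) * Complex.I‖ = |l| := by simp
  rw [h1]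
  gcongr
  refine (norm_sub_le _ _).trans ?_
  rw [← h, ← h, Complex.norm_exp_ofReal_mul_I, Complex.norm_exp_ofReal_mul_I]
  norm_num

lemma sum_abs_sub_rpow_neg_le {b : ℝ} (hb : 1 < b) (S : Finset ℕ) (m : ℕ) :
    ∑ n ∈ S, |(m : ℝ) - n| ^ (-b) ≤ ∑' k : ℤ, |(k : ℝ)| ^ (-b) := by
  have hinj : Set.InjOn (fun n : ℕ => (m : ℤ) - n) (S : Set ℕ) := by
    intro x _ y _ h
    simp only at h
    omega
  have h1 : ∑ n ∈ S, |(m : ℝ) - n| ^ (-b) =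
      ∑ k ∈ S.image (fun n : ℕ => (m : ℤ) - n), |(k : ℝ)| ^ (-b) := by
    rw [Finset.sum_image hinj]
    push_cast; rfl
  rw [h1]
  exact (Real.summable_abs_int_rpow hb).sum_le_tsum _ (fun k _ => by positivity)

lemma inv_abs_log_sub_log_le {δ : ℝ} (hδ : 0 < δ) {m n : ℕ} (hm : 0 < m) (hn : 0 < n)
    (hmn : m ≠ n) :
    1 / |log m - log n| ≤
      1 + ((m : ℝ) ^ (1 / 2 + δ) * (n : ℝ) ^ (1 / 2 + δ)) * |(m : ℝ) - n| ^ (-(1 + δ)) := by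
  wlog h : n < m generalizing m n
  · have h' := this hn hm hmn.symm (by omega)
    rw [abs_sub_comm, abs_sub_comm (m : ℝ), mul_comm ((m : ℝ) ^ _)]
    exact h'
  have hm' : (0 : ℝ) < m := by exact_mod_cast hm
  have hn' : (1 : ℝ) ≤ n := by exact_mod_cast hn
  have hnm : (n : ℝ) + 1 ≤ m := by exact_mod_cast h
  set d : ℝ := m - n with hd
  have hd1 : 1 ≤ d := by linarith
  have hlog : d / m ≤ log m - log n := by
    have := Real.one_sub_inv_le_log_of_pos (x := (m : ℝ) / n) (by positivity)
    rw [Real.log_div (by positivity) (by positivity)] at this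
    have e : 1 - ((m : ℝ) / n)⁻¹ = d / m := by rw [hd]; field_simp
    linarith
  have hpos : 0 < d / m := by positivity
  rw [abs_of_pos (lt_of_lt_of_le hpos hlog), abs_of_pos (by linarith : 0 < d)]
  calc 1 / (log m - log n) ≤ 1 / (d / m) := by gcongr
    _ = 1 + n * d⁻¹ := by
      have : (m : ℝ) = n + d := by rw [hd]; ring
      rw [this]; field_simp; ring
    _ ≤ 1 + ((m : ℝ) ^ (1 / 2 + δ) * (n : ℝ) ^ (1 / 2 + δ)) * d ^ (-(1 + δ)) := by
      gcongr 1 + ?_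
      have e1 : d⁻¹ = d ^ δ * d ^ (-(1 + δ)) := by
        rw [← rpow_add (by linarith), ← rpow_neg_one]; congr 1; ring
      have e2 : d ^ δ ≤ (m : ℝ) ^ δ * (n : ℝ) ^ δ := by
        calc d ^ δ ≤ (m : ℝ) ^ δ := by
              apply rpow_le_rpow (by linarith) (by linarith) hδ.le
          _ ≤ (m : ℝ) ^ δ * (n : ℝ) ^ δ :=
              le_mul_of_one_le_right (by positivity) (one_le_rpow hn' hδ.le)
      have e3 : (n : ℝ) ≤ (m : ℝ) ^ (1 / 2 : ℝ) * (n : ℝ) ^ (1 / 2 : ℝ) := by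
        calc (n : ℝ) = (n : ℝ) ^ (1 / 2 : ℝ) * (n : ℝ) ^ (1 / 2 : ℝ) := by
              rw [← rpow_add (by linarith)]; norm_num
          _ ≤ _ := by gcongr
      rw [e1, ← mul_assoc]
      refine mul_le_mul_of_nonneg_right ?_ (by positivity)
      calc (n : ℝ) * d ^ δ ≤ ((m : ℝ) ^ (1 / 2 : ℝ) * (n : ℝ) ^ (1 / 2 : ℝ)) *
            ((m : ℝ) ^ δ * (n : ℝ) ^ δ) := by gcongr
        _ = (m : ℝ) ^ (1 / 2 + δ) * (n : ℝ) ^ (1 / 2 + δ) := by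
            rw [rpow_add hm', rpow_add (by linarith)]; ring

lemma sum_sum_mul_inv_log_le {ε : ℝ} (hε : 0 < ε) : ∃ C : ℝ, 0 < C ∧
    ∀ (S : Finset ℕ) (x : ℕ → ℝ), (∀ n ∈ S, 0 < n) → (∀ n, 0 ≤ x n) →
    ∑ m ∈ S, ∑ n ∈ S, (if m = n then 0 else x m * x n * (1 / |log m - log n|)) ≤
      C * ∑ n ∈ S, (n : ℝ) ^ (1 + ε) * x n ^ 2 := by
  set δ := ε / 2 with hδ
  have hδ0 : 0 < δ := by positivity
  set K := ∑' k : ℤ, |(k : ℝ)| ^ (-(1 + δ)) with hK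
  set L := ∑' n : ℕ, (n : ℝ) ^ (-(1 + ε)) with hL
  have hK0 : 0 ≤ K := tsum_nonneg fun k => by positivity
  have hL0 : 0 ≤ L := tsum_nonneg fun k => by positivity
  have hsL : Summable fun n : ℕ => (n : ℝ) ^ (-(1 + ε)) :=
    Real.summable_nat_rpow.2 (by linarith)
  refine ⟨L + K + 1, by positivity, fun S x hS hx => ?_⟩
  set Q := ∑ n ∈ S, (n : ℝ) ^ (1 + ε) * x n ^ 2 with hQ
  have hQ0 : 0 ≤ Q := Finset.sum_nonneg fun n _ => by positivity
  have hpt : ∀ m ∈ S, ∀ n ∈ S,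
      (if m = n then 0 else x m * x n * (1 / |log m - log n|)) ≤
      x m * x n + ((m : ℝ) ^ (1 + ε) * x m ^ 2 * |(m : ℝ) - n| ^ (-(1 + δ)) / 2 +
        (n : ℝ) ^ (1 + ε) * x n ^ 2 * |(n : ℝ) - m| ^ (-(1 + δ)) / 2) := by
    intro m hm n hn
    have h1 := hx m
    have h2 := hx n
    split_ifs with h
    · positivity
    · have := inv_abs_log_sub_log_le hδ0 (hS m hm) (hS n hn) h
      rw [abs_sub_comm (n : ℝ)]
      set D := |(m : ℝ) - n| ^ (-(1 + δ)) with hD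
      have hD0 : 0 ≤ D := by positivity
      have e : ∀ k : ℕ, 0 < k → (k : ℝ) ^ (1 + ε) = ((k : ℝ) ^ (1 / 2 + δ)) ^ 2 := by
        intro k hk
        rw [← rpow_natCast, ← rpow_mul (by positivity)]
        congr 1; rw [hδ]; push_cast; ring
      rw [e m (hS m hm), e n (hS n hn)]
      set p := (m : ℝ) ^ (1 / 2 + δ)
      set q := (n : ℝ) ^ (1 / 2 + δ)
      calc x m * x n * (1 / |log m - log n|) ≤ x m * x n * (1 + p * q * D) := by gcongr
        _ ≤ _ := by nlinarith [mul_nonneg hD0 (sq_nonneg (p * x m - q * x n))]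
  have hcs : (∑ n ∈ S, x n) ^ 2 ≤ L * Q := by
    have h := Finset.sum_mul_sq_le_sq_mul_sq S (fun n => (n : ℝ) ^ (-(1 + ε) / 2))
      (fun n => (n : ℝ) ^ ((1 + ε) / 2) * x n)
    have e0 : ∑ n ∈ S, (n : ℝ) ^ (-(1 + ε) / 2) * ((n : ℝ) ^ ((1 + ε) / 2) * x n) =
        ∑ n ∈ S, x n := by
      refine Finset.sum_congr rfl fun n hn => ?_
      have : (0 : ℝ) < n := by exact_mod_cast hS n hn
      rw [← mul_assoc, ← rpow_add this, show -(1 + ε) / 2 + (1 + ε) / 2 = 0 by ring,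
        rpow_zero, one_mul]
    have e1 : ∑ n ∈ S, ((n : ℝ) ^ (-(1 + ε) / 2)) ^ 2 ≤ L := by
      have : ∑ n ∈ S, ((n : ℝ) ^ (-(1 + ε) / 2)) ^ 2 = ∑ n ∈ S, (n : ℝ) ^ (-(1 + ε)) := by
        refine Finset.sum_congr rfl fun n hn => ?_
        rw [← rpow_natCast, ← rpow_mul (by positivity)]
        congr 1; push_cast; ring
      rw [this]
      exact hsL.sum_le_tsum _ fun k _ => by positivity
    have e2 : ∑ n ∈ S, ((n : ℝ) ^ ((1 + ε) / 2) * x n) ^ 2 = Q := by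
      refine Finset.sum_congr rfl fun n hn => ?_
      rw [mul_pow, ← rpow_natCast, ← rpow_mul (by positivity)]
      congr 2; push_cast; ring
    rw [e0, e2] at h
    exact h.trans (by gcongr)
  have hrow : ∀ m : ℕ, ∑ n ∈ S, |(m : ℝ) - n| ^ (-(1 + δ)) ≤ K := fun m =>
    sum_abs_sub_rpow_neg_le (by linarith) S m
  calc ∑ m ∈ S, ∑ n ∈ S, (if m = n then 0 else x m * x n * (1 / |log m - log n|))
      ≤ ∑ m ∈ S, ∑ n ∈ S, (x m * x n +
        ((m : ℝ) ^ (1 + ε) * x m ^ 2 * |(m : ℝ) - n| ^ (-(1 + δ)) / 2 +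
        (n : ℝ) ^ (1 + ε) * x n ^ 2 * |(n : ℝ) - m| ^ (-(1 + δ)) / 2)) :=
        Finset.sum_le_sum fun m hm => Finset.sum_le_sum fun n hn => hpt m hm n hn
    _ = (∑ n ∈ S, x n) ^ 2 +
        ∑ m ∈ S, ∑ n ∈ S, (m : ℝ) ^ (1 + ε) * x m ^ 2 * |(m : ℝ) - n| ^ (-(1 + δ)) := by
        simp_rw [Finset.sum_add_distrib]
        rw [sq, Finset.sum_mul_sum]
        congr 1
        rw [Finset.sum_comm (f := fun m n : ℕ =>
          (n : ℝ) ^ (1 + ε) * x n ^ 2 * |(n : ℝ) - m| ^ (-(1 + δ)) / 2)]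
        simp_rw [← Finset.sum_div]
        ring
    _ ≤ L * Q + ∑ m ∈ S, (m : ℝ) ^ (1 + ε) * x m ^ 2 * K := by
        gcongr with m hm
        rw [← Finset.mul_sum]
        gcongr
        exact hrow m
    _ ≤ (L + K + 1) * Q := by rw [← Finset.sum_mul]; nlinarith

/-- Mean value theorem for Dirichlet polynomials, with an `ε`-loss. -/
theorem integral_norm_sq_dirichlet_le {ε : ℝ} (hε : 0 < ε) : ∃ C : ℝ, 0 < C ∧
    ∀ (S : Finset ℕ) (a : ℕ → ℂ), (∀ n ∈ S, 0 < n) → ∀ A B : ℝ, A ≤ B →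
    ∫ t in A..B, ‖∑ n ∈ S, a n * Complex.exp ((t * -log n : ℝ) * Complex.I)‖ ^ 2 ≤
      C * ∑ n ∈ S, (B - A + (n : ℝ) ^ (1 + ε)) * ‖a n‖ ^ 2 := by
  obtain ⟨C, hC0, hC⟩ := sum_sum_mul_inv_log_le hε
  refine ⟨1 + 2 * C, by positivity, fun S a hS A B hAB => ?_⟩
  have hexp : ∀ t : ℝ,
      ((‖∑ n ∈ S, a n * Complex.exp ((t * -log n : ℝ) * Complex.I)‖ ^ 2 : ℝ) : ℂ) =
      ∑ m ∈ S, ∑ n ∈ S, a m * (starRingEnd ℂ) (a n) *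
        Complex.exp ((t * (log n - log m) : ℝ) * Complex.I) := by
    intro t
    push_cast
    rw [← Complex.mul_conj', map_sum, Finset.sum_mul_sum]
    refine Finset.sum_congr rfl fun m _ => Finset.sum_congr rfl fun n _ => ?_
    rw [map_mul, ← Complex.exp_conj]
    simp only [map_mul, Complex.conj_I, Complex.conj_ofReal, map_neg, ← Complex.natCast_log]
    rw [mul_mul_mul_comm, ← Complex.exp_add]
    congr 2
    ring
  have hInt : ((∫ t in A..B,
      ‖∑ n ∈ S, a n * Complex.exp ((t * -log n : ℝ) * Complex.I)‖ ^ 2 : ℝ) : ℂ) =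
      ∑ m ∈ S, ∑ n ∈ S, a m * (starRingEnd ℂ) (a n) *
        ∫ t in A..B, Complex.exp ((t * (log n - log m) : ℝ) * Complex.I) := by
    rw [← intervalIntegral.integral_ofReal]
    simp_rw [hexp]
    rw [intervalIntegral.integral_finsetSum]
    · refine Finset.sum_congr rfl fun m _ => ?_
      rw [intervalIntegral.integral_finsetSum]
      · simp_rw [intervalIntegral.integral_const_mul]
      · intro n _; apply Continuous.intervalIntegrable; fun_prop
    · intro m _; apply Continuous.intervalIntegrable; fun_prop
  set I := ∫ t in A..B, ‖∑ n ∈ S, a n * Complex.exp ((t * -log n : ℝ) * Complex.I)‖ ^ 2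
  have hI : I ≤ ‖(I : ℂ)‖ := by rw [Complex.norm_real]; exact le_abs_self _
  refine hI.trans ?_
  rw [hInt]
  have hpt : ∀ m ∈ S, ∀ n ∈ S, ‖a m * (starRingEnd ℂ) (a n) *
      ∫ t in A..B, Complex.exp ((t * (log n - log m) : ℝ) * Complex.I)‖ ≤
      (if m = n then (B - A) * ‖a m‖ ^ 2 else 0) +
      2 * (if m = n then 0 else ‖a m‖ * ‖a n‖ * (1 / |log m - log n|)) := by
    intro m hm n hn
    rw [norm_mul, norm_mul, RCLike.norm_conj]
    split_ifs with h
    · subst h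
      simp only [sub_self, mul_zero, Complex.ofReal_zero, zero_mul, Complex.exp_zero,
        intervalIntegral.integral_const, Complex.real_smul, mul_one, Complex.norm_real,
        Real.norm_eq_abs, abs_of_nonneg (sub_nonneg.2 hAB)]
      exact le_of_eq (by ring)
    · have hl : log n - log m ≠ 0 := by
        rw [sub_ne_zero]
        intro h'
        have := Real.log_injOn_pos (Set.mem_Ioi.2 (by exact_mod_cast hS n hn))
          (Set.mem_Ioi.2 (by exact_mod_cast hS m hm)) h'
        exact h (by exact_mod_cast this.symm)
      have := norm_integral_cexp_mul_I_le hl A B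
      rw [abs_sub_comm (log m)]
      calc _ ≤ ‖a m‖ * ‖a n‖ * (2 / |log n - log m|) := by gcongr
        _ = _ := by ring
  calc _ ≤ ∑ m ∈ S, ∑ n ∈ S, ((if m = n then (B - A) * ‖a m‖ ^ 2 else 0) +
      2 * (if m = n then 0 else ‖a m‖ * ‖a n‖ * (1 / |log m - log n|))) := by
        refine (norm_sum_le _ _).trans (Finset.sum_le_sum fun m hm => ?_)
        exact (norm_sum_le _ _).trans (Finset.sum_le_sum fun n hn => hpt m hm n hn)
    _ ≤ ∑ m ∈ S, (B - A) * ‖a m‖ ^ 2 + 2 * (C * ∑ n ∈ S, (n : ℝ) ^ (1 + ε) * ‖a n‖ ^ 2) := by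
        simp_rw [Finset.sum_add_distrib, ← Finset.mul_sum]
        gcongr
        · rw [Finset.mul_sum]
          exact Finset.sum_le_sum fun m hm => by simp [hm]
        · exact hC S (fun n => ‖a n‖) hS fun n => norm_nonneg _
    _ ≤ _ := by
        simp_rw [add_mul, Finset.sum_add_distrib, one_mul, ← Finset.mul_sum, mul_add]
        have h1 : 0 ≤ (B - A) * ∑ n ∈ S, ‖a n‖ ^ 2 :=
          mul_nonneg (sub_nonneg.2 hAB) (Finset.sum_nonneg fun n _ => by positivity)
        have h2 : 0 ≤ ∑ n ∈ S, (n : ℝ) ^ (1 + ε) * ‖a n‖ ^ 2 :=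
          Finset.sum_nonneg fun n _ => by positivity
        nlinarith [mul_nonneg hC0.le h1]

lemma LSeries_term_add_mul_I (f : ℕ → ℂ) (σ t : ℝ) (n : ℕ) :
    LSeries.term f (σ + t * Complex.I) n =
      LSeries.term f σ n * Complex.exp ((t * -log n : ℝ) * Complex.I) := by
  rcases eq_or_ne n 0 with rfl | hn
  · simp
  have hn' : (n : ℂ) ≠ 0 := by exact_mod_cast hn
  rw [LSeries.term_of_ne_zero hn, LSeries.term_of_ne_zero hn, Complex.cpow_add _ _ hn',
    div_mul_eq_div_div, div_eq_mul_inv _ ((n : ℂ) ^ ((t : ℂ) * Complex.I)), ← Complex.cpow_neg,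
    Complex.cpow_def_of_ne_zero hn' (-(_)), ← Complex.natCast_log]
  congr 2
  push_cast
  ring

/-- Mean value theorem for absolutely convergent Dirichlet series. -/
theorem integral_norm_sq_LSeries_le {ε : ℝ} (hε : 0 < ε) : ∃ C : ℝ, 0 < C ∧
    ∀ (f : ℕ → ℂ) (σ A B : ℝ), A ≤ B → LSeriesSummable f σ →
    (Summable fun n : ℕ => (B - A + (n : ℝ) ^ (1 + ε)) * ‖LSeries.term f σ n‖ ^ 2) →
    ∫ t in A..B, ‖LSeries f (σ + t * Complex.I)‖ ^ 2 ≤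
      C * ∑' n : ℕ, (B - A + (n : ℝ) ^ (1 + ε)) * ‖LSeries.term f σ n‖ ^ 2 := by
  obtain ⟨C, hC0, hC⟩ := integral_norm_sq_dirichlet_le hε
  refine ⟨C, hC0, fun f σ A B hAB hf hs => ?_⟩
  set a : ℕ → ℂ := LSeries.term f σ with ha
  have hnorm : Summable fun n => ‖a n‖ := hf.norm
  have hterm : ∀ (t : ℝ) n, ‖a n * Complex.exp ((t * -log n : ℝ) * Complex.I)‖ = ‖a n‖ := by
    intro t n
    rw [norm_mul, Complex.norm_exp_ofReal_mul_I, mul_one]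
  have hlim : Filter.Tendsto (fun N : ℕ => ∫ t in A..B,
      ‖∑ n ∈ Finset.range N, a n * Complex.exp ((t * -log n : ℝ) * Complex.I)‖ ^ 2) Filter.atTop
      (nhds (∫ t in A..B, ‖LSeries f (σ + t * Complex.I)‖ ^ 2)) := by
    refine intervalIntegral.tendsto_integral_filter_of_dominated_convergence
      (fun _ => (∑' n, ‖a n‖) ^ 2) ?_ ?_ ?_ ?_
    · refine Filter.Eventually.of_forall fun N => ?_
      apply Continuous.aestronglyMeasurable
      fun_prop
    · refine Filter.Eventually.of_forall fun N => Filter.Eventually.of_forall fun t _ => ?_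
      rw [norm_pow, norm_norm]
      gcongr
      refine (norm_sum_le _ _).trans ?_
      simp_rw [hterm]
      exact hnorm.sum_le_tsum _ fun n _ => norm_nonneg _
    · exact intervalIntegrable_const
    · refine Filter.Eventually.of_forall fun t _ => ?_
      have h1 : HasSum (fun n => a n * Complex.exp ((t * -log n : ℝ) * Complex.I))
          (LSeries f (σ + t * Complex.I)) := by
        have : Summable (LSeries.term f (σ + t * Complex.I)) := by
          refine Summable.of_norm (hnorm.congr fun n => ?_)
          rw [LSeries_term_add_mul_I, hterm]
        have e : (fun n => a n * Complex.exp ((t * -log n : ℝ) * Complex.I)) =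
            LSeries.term f (σ + t * Complex.I) := by
          funext n; rw [LSeries_term_add_mul_I]
        rw [e]
        exact this.hasSum
      exact (h1.tendsto_sum_nat.norm).pow 2
  refine le_of_tendsto hlim (Filter.Eventually.of_forall fun N => ?_)
  have h0 : a 0 = 0 := by simp [ha]
  have h1 : ∀ t : ℝ, ∑ n ∈ Finset.range N, a n * Complex.exp ((t * -log n : ℝ) * Complex.I) =
      ∑ n ∈ (Finset.range N).filter (0 < ·),
        a n * Complex.exp ((t * -log n : ℝ) * Complex.I) := by
    intro t
    rw [Finset.sum_filter]
    refine Finset.sum_congr rfl fun n _ => ?_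
    split_ifs with h
    · rfl
    · rw [Nat.eq_zero_of_not_pos h, h0, zero_mul]
  simp_rw [h1]
  refine (hC _ a (fun n hn => (Finset.mem_filter.1 hn).2) A B hAB).trans ?_
  gcongr
  exact hs.sum_le_tsum _ fun n _ => mul_nonneg
    (add_nonneg (sub_nonneg.2 hAB) (by positivity)) (by positivity)

lemma LSeriesHasSum_pow {f : ArithmeticFunction ℂ} {s : ℂ} (hf : LSeriesSummable f s) (k : ℕ) :
    LSeriesHasSum (f ^ k : ArithmeticFunction ℂ) s (LSeries f s ^ k) := by
  induction k with
  | zero =>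
    have h0 : ((1 : ArithmeticFunction ℂ) : ℕ → ℂ) = LSeries.delta :=
      ArithmeticFunction.one_eq_delta
    rw [pow_zero, pow_zero, h0]
    have h : LSeriesSummable LSeries.delta s := by
      refine summable_of_ne_finset_zero (s := {1}) fun n hn => ?_
      rw [LSeries.term_delta, if_neg (by simpa using hn)]
    have := h.LSeriesHasSum
    rwa [congrFun LSeries_delta s] at this
  | succ k ih =>
    rw [pow_succ, pow_succ]
    exact ArithmeticFunction.LSeriesHasSum_mul ih hf.LSeriesHasSum

lemma coe_dk (k : ℕ) : (fun n => (dk k n : ℂ)) =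
    ((ArithmeticFunction.zeta : ArithmeticFunction ℂ) ^ k : ArithmeticFunction ℂ) := by
  induction k with
  | zero =>
    funext n
    simp only [dk, pow_zero, ArithmeticFunction.one_apply]
    split_ifs <;> simp
  | succ k ih =>
    funext n
    rw [pow_succ, ArithmeticFunction.mul_apply, ← ih, dk_succ]
    push_cast
    refine Finset.sum_congr rfl fun p hp => ?_
    have : p.2 ≠ 0 := by
      have := Nat.mem_divisorsAntidiagonal.1 hp
      rintro h
      simp [h] at this
      omega
    simp [ArithmeticFunction.natCoe_apply, ArithmeticFunction.zeta_apply, this]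

lemma LSeriesHasSum_dk (k : ℕ) {s : ℂ} (hs : 1 < s.re) :
    LSeriesHasSum (fun n => (dk k n : ℂ)) s (riemannZeta s ^ k) := by
  have e : ((ArithmeticFunction.zeta : ArithmeticFunction ℂ) : ℕ → ℂ) =
      fun n => ((ArithmeticFunction.zeta n : ℕ) : ℂ) := by
    funext n; rw [ArithmeticFunction.natCoe_apply]
  have h := LSeriesHasSum_pow (f := (ArithmeticFunction.zeta : ArithmeticFunction ℂ)) (s := s)
    (by rw [e]; exact ArithmeticFunction.LSeriesSummable_zeta_iff.2 hs) k
  rw [e, ArithmeticFunction.LSeries_zeta_eq_riemannZeta hs, ← coe_dk] at h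
  exact h

lemma norm_arithmeticFunction_pow_le {f : ArithmeticFunction ℂ} (hf : ∀ n, ‖f n‖ ≤ 1) (k n : ℕ) :
    ‖(f ^ k : ArithmeticFunction ℂ) n‖ ≤ dk k n := by
  induction k generalizing n with
  | zero =>
    simp only [dk, pow_zero, ArithmeticFunction.one_apply]
    split_ifs <;> simp
  | succ k ih =>
    rw [pow_succ, ArithmeticFunction.mul_apply, dk_succ]
    push_cast
    refine (norm_sum_le _ _).trans (Finset.sum_le_sum fun p _ => ?_)
    rw [norm_mul]
    exact (mul_le_mul (ih _) (hf _) (norm_nonneg _) (by positivity)).trans_eq (mul_one _)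

lemma mem_Icc_of_arithmeticFunction_pow_ne_zero {f : ArithmeticFunction ℂ} {M₁ M₂ : ℕ}
    (hf : ∀ n, f n ≠ 0 → M₁ ≤ n ∧ n ≤ M₂) (k n : ℕ)
    (h : (f ^ k : ArithmeticFunction ℂ) n ≠ 0) : M₁ ^ k ≤ n ∧ n ≤ M₂ ^ k := by
  induction k generalizing n with
  | zero =>
    simp only [pow_zero, ArithmeticFunction.one_apply] at h ⊢
    split_ifs at h with h1
    · omega
    · simp at h
  | succ k ih =>
    rw [pow_succ, ArithmeticFunction.mul_apply] at h
    obtain ⟨p, hp, hne⟩ := Finset.exists_ne_zero_of_sum_ne_zero h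
    obtain ⟨h1, h2⟩ := ih p.1 (left_ne_zero_of_mul hne)
    obtain ⟨h3, h4⟩ := hf p.2 (right_ne_zero_of_mul hne)
    rw [pow_succ, pow_succ, ← (Nat.mem_divisorsAntidiagonal.1 hp).1]
    exact ⟨Nat.mul_le_mul h1 h3, Nat.mul_le_mul h2 h4⟩

lemma intervalIntegral_mul_sq_le {f g : ℝ → ℝ} (hf : Continuous f) (hg : Continuous g) {A B : ℝ}
    (hAB : A ≤ B) :
    (∫ t in A..B, f t * g t) ^ 2 ≤ (∫ t in A..B, f t ^ 2) * ∫ t in A..B, g t ^ 2 := by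
  have h : ∀ x : ℝ, 0 ≤ (∫ t in A..B, f t ^ 2) * (x * x) + (-2 * ∫ t in A..B, f t * g t) * x +
      ∫ t in A..B, g t ^ 2 := by
    intro x
    have e : (∫ t in A..B, f t ^ 2) * (x * x) + (-2 * ∫ t in A..B, f t * g t) * x +
        ∫ t in A..B, g t ^ 2 = ∫ t in A..B, (x * f t - g t) ^ 2 := by
      have : ∀ t, (x * f t - g t) ^ 2 = (x * x) * f t ^ 2 + (-2 * x) * (f t * g t) + g t ^ 2 := by
        intro t; ring
      simp_rw [this]
      rw [intervalIntegral.integral_add, intervalIntegral.integral_add,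
        intervalIntegral.integral_const_mul, intervalIntegral.integral_const_mul]
      · ring
      all_goals apply Continuous.intervalIntegrable; fun_prop
    rw [e]
    exact intervalIntegral.integral_nonneg hAB fun t _ => sq_nonneg _
  have := discrim_le_zero h
  rw [discrim] at this
  nlinarith

lemma differentiableAt_integral_shift {F : ℂ → ℂ} {σ : ℝ}
    (hF : DifferentiableOn ℂ F {s | s.re < σ}) {g : ℝ → ℂ} (hg : Continuous g) (A B : ℝ) {z : ℂ}
    (hz : z.re < σ) :
    DifferentiableAt ℂ (fun z => ∫ t in A..B, F (z + t * Complex.I) * g t) z := by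
  have hU : IsOpen {s : ℂ | s.re < σ} := isOpen_lt Complex.continuous_re continuous_const
  obtain ⟨r, hr, hball⟩ := Metric.nhds_basis_closedBall.mem_iff.1 (hU.mem_nhds hz)
  have hmem : ∀ w ∈ Metric.closedBall z r, ∀ t : ℝ, w + t * Complex.I ∈ {s : ℂ | s.re < σ} := by
    intro w hw t
    have : w.re < σ := hball hw
    simpa using this
  have hd : ContinuousOn (deriv F) {s | s.re < σ} :=
    (hF.analyticOnNhd hU).deriv.continuousOn
  have hcont : ∀ w ∈ Metric.closedBall z r, Continuous fun t : ℝ => F (w + t * Complex.I) := by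
    intro w hw
    exact hF.continuousOn.comp_continuous (by fun_prop) (hmem w hw)
  have hK : IsCompact ((fun p : ℂ × ℝ => p.1 + p.2 * Complex.I) ''
      (Metric.closedBall z r ×ˢ Set.uIcc A B)) :=
    ((isCompact_closedBall z r).prod isCompact_uIcc).image (by fun_prop)
  obtain ⟨M, hM⟩ := hK.exists_bound_of_continuousOn (f := deriv F) (hd.mono (by
    rintro _ ⟨⟨w, t⟩, ⟨hw, _⟩, rfl⟩
    exact hmem w hw t))
  have hb : Metric.closedBall z r ∈ nhds z := Metric.closedBall_mem_nhds z hr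
  have hzz : z ∈ Metric.closedBall z r := Metric.mem_closedBall_self hr.le
  refine (intervalIntegral.hasDerivAt_integral_of_dominated_loc_of_deriv_le
    (F' := fun w t => deriv F (w + t * Complex.I) * g t) (bound := fun t => M * ‖g t‖) hb
    ?_ ?_ ?_ ?_ ?_ ?_).2.differentiableAt
  · filter_upwards [hb] with w hw
    exact ((hcont w hw).mul hg).aestronglyMeasurable
  · exact ((hcont z hzz).mul hg).intervalIntegrable _ _
  · exact ((hd.comp_continuous (by fun_prop) (hmem z hzz)).mul hg).aestronglyMeasurable
  · refine Filter.Eventually.of_forall fun t ht w hw => ?_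
    rw [norm_mul]
    gcongr
    exact hM _ ⟨(w, t), ⟨hw, Set.uIoc_subset_uIcc ht⟩, rfl⟩
  · exact (continuous_const.mul hg.norm).intervalIntegrable _ _
  · refine Filter.Eventually.of_forall fun t _ w hw => ?_
    have h1 : HasDerivAt F (deriv F (w + t * Complex.I)) (w + t * Complex.I) :=
      (hF.differentiableAt (hU.mem_nhds (hmem w hw t))).hasDerivAt
    exact (h1.comp_add_const w (t * Complex.I)).mul_const _

/-- A convexity principle for mean squares over vertical segments. -/
theorem integral_norm_sq_le_of_strip {F : ℂ → ℂ} (hF : DifferentiableOn ℂ F {s | s.re < 2})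
    {c K : ℝ} (hgrowth : ∀ s : ℂ, -1 / 2 ≤ s.re → s.re ≤ 3 / 2 →
      ‖F s‖ ≤ K * Real.exp (c * |s.im|))
    {A B P Q : ℝ} (hAB : A ≤ B) (hP : 0 ≤ P) (hQ : 0 ≤ Q)
    (hl : ∀ v : ℝ, Real.exp (2 * (1 - v ^ 2)) *
      ∫ t in A..B, ‖F (((-1 / 2 : ℝ) : ℂ) + ((v + t : ℝ) : ℂ) * Complex.I)‖ ^ 2 ≤ P ^ 2)
    (hr : ∀ v : ℝ, Real.exp (2 * (1 - v ^ 2)) *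
      ∫ t in A..B, ‖F (((3 / 2 : ℝ) : ℂ) + ((v + t : ℝ) : ℂ) * Complex.I)‖ ^ 2 ≤ Q ^ 2) :
    ∫ t in A..B, ‖F (((1 / 2 : ℝ) : ℂ) + (t : ℂ) * Complex.I)‖ ^ 2 ≤ P * Q := by
  have hcontF : ∀ w : ℂ, w.re < 2 → Continuous fun t : ℝ => F (w + t * Complex.I) := by
    intro w hw
    exact hF.continuousOn.comp_continuous (by fun_prop) (fun t => by simpa using hw)
  set g : ℝ → ℂ := fun t => (starRingEnd ℂ) (F (((1 / 2 : ℝ) : ℂ) + (t : ℂ) * Complex.I)) with hg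
  have hgc : Continuous g := Complex.continuous_conj.comp (hcontF _ (by norm_num))
  set J := ∫ t in A..B, ‖F (((1 / 2 : ℝ) : ℂ) + (t : ℂ) * Complex.I)‖ ^ 2 with hJ
  have hJ0 : 0 ≤ J := intervalIntegral.integral_nonneg hAB fun t _ => by positivity
  have hgJ : ∫ t in A..B, ‖g t‖ ^ 2 = J := by simp [hg, hJ]
  set h : ℂ → ℂ := fun z => Complex.exp ((z - 1 / 2) ^ 2) *
    ∫ t in A..B, F (z + t * Complex.I) * g t with hh
  have hnormexp : ∀ z : ℂ, ‖Complex.exp ((z - 1 / 2) ^ 2)‖ =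
      Real.exp ((z.re - 1 / 2) ^ 2 - z.im ^ 2) := by
    intro z
    rw [Complex.norm_exp]
    congr 1
    simp [sq]
  have hInt : ∀ z : ℂ, z.re < 2 → ‖∫ t in A..B, F (z + t * Complex.I) * g t‖ ^ 2 ≤
      (∫ t in A..B, ‖F (z + t * Complex.I)‖ ^ 2) * J := by
    intro z hz
    rw [← hgJ]
    refine le_trans ?_ (intervalIntegral_mul_sq_le (hcontF z hz).norm hgc.norm hAB)
    gcongr
    refine (intervalIntegral.norm_integral_le_integral_norm hAB).trans ?_
    simp_rw [norm_mul]
    exact le_rfl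
  have hline : ∀ (σ R : ℝ), σ < 2 → (σ - 1 / 2) ^ 2 = 1 → 0 ≤ R →
      (∀ v : ℝ, Real.exp (2 * (1 - v ^ 2)) *
      ∫ t in A..B, ‖F ((σ : ℂ) + ((v + t : ℝ) : ℂ) * Complex.I)‖ ^ 2 ≤ R ^ 2) →
      ∀ z ∈ Complex.re ⁻¹' {σ}, ‖h z‖ ≤ R * √J := by
    intro σ R hσ hσ1 hR hb z hz
    have hz' : z.re = σ := hz
    refine abs_le_of_sq_le_sq' ?_ (by positivity) |>.2
    rw [hh]
    simp only
    rw [norm_mul, mul_pow, mul_pow, Real.sq_sqrt hJ0, hnormexp, hz', hσ1]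
    have e1 : Real.exp (1 - z.im ^ 2) ^ 2 = Real.exp (2 * (1 - z.im ^ 2)) := by
      rw [← Real.exp_nat_mul]; norm_num
    have e2 : ∀ t : ℝ, (σ : ℂ) + ((z.im + t : ℝ) : ℂ) * Complex.I = z + t * Complex.I := by
      intro t
      rw [← hz']
      conv_rhs => rw [← Complex.re_add_im z]
      push_cast; ring
    have := hb z.im
    simp_rw [e2] at this
    rw [e1]
    calc _ ≤ Real.exp (2 * (1 - z.im ^ 2)) *
          ((∫ t in A..B, ‖F (z + t * Complex.I)‖ ^ 2) * J) := by
          gcongr; exact hInt z (by linarith)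
      _ ≤ _ := by rw [← mul_assoc]; gcongr
  have hbdd : BddAbove ((norm ∘ h) '' Complex.HadamardThreeLines.verticalClosedStrip
      (-1 / 2) (3 / 2)) := by
    have hK : 0 ≤ K := by
      have := (norm_nonneg _).trans (hgrowth 0 (by norm_num) (by norm_num))
      simpa using this
    refine ⟨Real.exp (1 + c ^ 2) * ∫ t in A..B, K * Real.exp (|c| * |t|) * ‖g t‖, ?_⟩
    rintro _ ⟨z, hz, rfl⟩
    have hz1 : -1 / 2 ≤ z.re := hz.1
    have hz2 : z.re ≤ 3 / 2 := hz.2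
    simp only [Function.comp, hh, norm_mul, hnormexp]
    have h1 : ‖∫ t in A..B, F (z + t * Complex.I) * g t‖ ≤
        Real.exp (|c| * |z.im|) * ∫ t in A..B, K * Real.exp (|c| * |t|) * ‖g t‖ := by
      rw [← intervalIntegral.integral_const_mul]
      refine (intervalIntegral.norm_integral_le_integral_norm hAB).trans ?_
      refine intervalIntegral.integral_mono_on hAB ?_ ?_ fun t _ => ?_
      · exact ((hcontF z (by linarith)).mul hgc).norm.intervalIntegrable _ _
      · apply Continuous.intervalIntegrable; fun_prop
      · rw [norm_mul]
        have h2 := hgrowth (z + t * Complex.I) (by simpa using hz1) (by simpa using hz2)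
        have h3 : c * |(z + t * Complex.I).im| ≤ |c| * |z.im| + |c| * |t| := by
          simp only [Complex.add_im, Complex.mul_im, Complex.ofReal_re, Complex.I_im, mul_one,
            Complex.ofReal_im, Complex.I_re, mul_zero, add_zero]
          calc c * |z.im + t| ≤ |c| * |z.im + t| := by gcongr; exact le_abs_self c
            _ ≤ |c| * (|z.im| + |t|) := by gcongr; exact abs_add_le _ _
            _ = _ := by ring
        calc _ ≤ K * Real.exp (|c| * |z.im| + |c| * |t|) * ‖g t‖ := by
              gcongr; exact h2.trans (by gcongr)
          _ = _ := by rw [Real.exp_add]; ring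
    have hI : 0 ≤ ∫ t in A..B, K * Real.exp (|c| * |t|) * ‖g t‖ :=
      intervalIntegral.integral_nonneg hAB fun t _ => by positivity
    calc _ ≤ Real.exp ((z.re - 1 / 2) ^ 2 - z.im ^ 2) * (Real.exp (|c| * |z.im|) *
          ∫ t in A..B, K * Real.exp (|c| * |t|) * ‖g t‖) := by gcongr
      _ ≤ _ := by
        rw [← mul_assoc, ← Real.exp_add]
        refine mul_le_mul_of_nonneg_right (Real.exp_le_exp.2 ?_) hI
        nlinarith [sq_nonneg (|c| - |z.im|), sq_abs c, sq_abs z.im]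
  have hdiff : DiffContOnCl ℂ h (Complex.HadamardThreeLines.verticalStrip (-1 / 2) (3 / 2)) := by
    apply DifferentiableOn.diffContOnCl
    intro z hz
    have hz2 : z.re < 2 := by
      have hc : IsClosed (Complex.re ⁻¹' Set.Icc (-1 / 2 : ℝ) (3 / 2)) :=
        isClosed_Icc.preimage Complex.continuous_re
      have := closure_minimal (Set.preimage_mono Set.Ioo_subset_Icc_self) hc hz
      have := this.2
      linarith
    refine DifferentiableAt.differentiableWithinAt ?_
    exact DifferentiableAt.mul (by fun_prop) (differentiableAt_integral_shift hF hgc A B hz2)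
  have key := Complex.HadamardThreeLines.norm_le_interp_of_mem_verticalClosedStrip' (f := h)
    (z := ((1 / 2 : ℝ) : ℂ)) (l := -1 / 2) (u := 3 / 2) (by norm_num)
    (by constructor <;> rw [Complex.ofReal_re] <;> norm_num) hdiff hbdd
    (hline (-1 / 2) P (by norm_num) (by norm_num) hP hl)
    (hline (3 / 2) Q (by norm_num) (by norm_num) hQ hr)
  have hhalf : ‖h ((1 / 2 : ℝ) : ℂ)‖ = J := by
    have : h ((1 / 2 : ℝ) : ℂ) = (J : ℂ) := by
      rw [hh, hJ]
      simp only
      rw [← intervalIntegral.integral_ofReal]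
      have : ((((1 / 2 : ℝ) : ℂ) - 1 / 2) ^ 2) = 0 := by push_cast; ring
      rw [this, Complex.exp_zero, one_mul]
      refine intervalIntegral.integral_congr fun t _ => ?_
      simp only [hg]
      rw [Complex.mul_conj']
      push_cast; rfl
    rw [this, Complex.norm_real, Real.norm_eq_abs, abs_of_nonneg hJ0]
  rw [hhalf, Complex.ofReal_re] at key
  norm_num at key
  rw [← Real.sqrt_eq_rpow, ← Real.sqrt_eq_rpow, ← Real.sqrt_mul (by positivity)] at key
  have e : √(P * √J * (Q * √J)) = √(P * Q) * √J := by
    rw [show P * √J * (Q * √J) = P * Q * (√J * √J) by ring, Real.mul_self_sqrt hJ0,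
      Real.sqrt_mul (by positivity)]
  rw [e] at key
  rcases hJ0.eq_or_lt with h0 | h0
  · rw [← h0]; positivity
  · have hs : 0 < √J := Real.sqrt_pos.2 h0
    have h1 : √J ≤ √(P * Q) := by
      have : √J * √J ≤ √(P * Q) * √J := by rwa [Real.mul_self_sqrt hJ0]
      exact le_of_mul_le_mul_right this hs
    exact (Real.sqrt_le_sqrt_iff (by positivity)).1 h1

/-- The factor `(s - 1) * χ(s)`, where `ζ(s) = χ(s) ζ(1 - s)`. -/
noncomputable def zetaFactor (s : ℂ) : ℂ :=
  -2 * (2 * π : ℂ) ^ (s - 1) * Complex.Gamma (2 - s) * Complex.cos (π * (1 - s) / 2)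

lemma two_pi_ne_zero_complex : (2 * π : ℂ) ≠ 0 := by
  simp [Real.pi_ne_zero]

lemma differentiableOn_zetaFactor : DifferentiableOn ℂ zetaFactor {s | s.re < 2} := by
  intro s hs
  have hs' : s.re < 2 := hs
  refine DifferentiableAt.differentiableWithinAt ?_
  have hG : DifferentiableAt ℂ (fun s => Complex.Gamma (2 - s)) s := by
    refine DifferentiableAt.comp (g := Complex.Gamma) s
      (Complex.differentiableAt_Gamma _ fun m h => ?_) (by fun_prop)
    have := congrArg Complex.re h
    simp at this
    have : (0 : ℝ) ≤ m := by positivity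
    linarith
  unfold zetaFactor
  refine DifferentiableAt.mul (DifferentiableAt.mul (DifferentiableAt.const_mul ?_ _) hG)
    (by fun_prop)
  exact DifferentiableAt.const_cpow (by fun_prop) (Or.inl two_pi_ne_zero_complex)

lemma mul_riemannZeta₁_eq {s : ℂ} (hs : s.re < 1) :
    s * riemannZeta₁ s = -zetaFactor s * riemannZeta₁ (1 - s) := by
  rcases eq_or_ne s 0 with rfl | h0
  · simp [zetaFactor]
  have h1 : s ≠ 1 := by rintro rfl; simp at hs
  have hn : ∀ n : ℕ, 1 - s ≠ -n := by
    intro n h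
    have := congrArg Complex.re h
    simp at this
    have : (0 : ℝ) ≤ n := by positivity
    linarith
  have h := riemannZeta_one_sub hn (by simpa using h0)
  rw [sub_sub_cancel] at h
  rw [riemannZeta_eq_inv_sub_mul h1, riemannZeta_eq_inv_sub_mul (by simpa using h0 : 1 - s ≠ 1)] at h
  have hs1 : s - 1 ≠ 0 := sub_ne_zero.2 h1
  have hG : Complex.Gamma (2 - s) = (1 - s) * Complex.Gamma (1 - s) := by
    rw [← Complex.Gamma_add_one _ (sub_ne_zero.2 h1.symm)]; congr 1; ring
  rw [inv_mul_eq_iff_eq_mul₀ hs1] at h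
  rw [h, zetaFactor, hG, show s - 1 = -(1 - s) by ring, show 1 - s - 1 = -s by ring]
  field_simp

lemma zetaFactor_mul_one_sub {s : ℂ} (h1 : -1 < s.re) (h2 : s.re < 2) :
    zetaFactor s * zetaFactor (1 - s) = -(s * (s - 1)) := by
  have hc : Complex.cos (π * (1 - s) / 2) = Complex.sin (π * s / 2) := by
    rw [← Complex.cos_pi_div_two_sub]; congr 1; ring
  rcases eq_or_ne s 0 with rfl | hs0
  · simp [zetaFactor]
  rcases eq_or_ne s 1 with rfl | hs1
  · simp [zetaFactor]
  have hsin : Complex.sin (π * s) ≠ 0 := by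
    rw [Complex.sin_ne_zero_iff]
    intro k hk
    have hk' : s = k := by
      have : (π : ℂ) ≠ 0 := by exact_mod_cast Real.pi_ne_zero
      exact mul_left_cancel₀ this (by rw [hk]; ring)
    rw [hk'] at h1 h2 hs0 hs1
    simp at h1 h2
    have a1 : (-1 : ℤ) < k := by exact_mod_cast h1
    have a2 : k < (2 : ℤ) := by exact_mod_cast h2
    obtain rfl | rfl : k = 0 ∨ k = 1 := by omega
    · simp at hs0
    · simp at hs1
  have hG1 : Complex.Gamma (2 - s) = (1 - s) * Complex.Gamma (1 - s) := by
    rw [← Complex.Gamma_add_one _ (sub_ne_zero.2 hs1.symm)]; congr 1; ring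
  have hG2 : Complex.Gamma (2 - (1 - s)) = s * Complex.Gamma s := by
    rw [← Complex.Gamma_add_one _ hs0]; congr 1; ring
  have hpow : (2 * π : ℂ) ^ (s - 1) * (2 * π : ℂ) ^ (1 - s - 1) = (2 * π : ℂ)⁻¹ := by
    rw [← Complex.cpow_add _ _ two_pi_ne_zero_complex, ← Complex.cpow_neg_one]
    congr 1; ring
  have hpi : (π : ℂ) ≠ 0 := by exact_mod_cast Real.pi_ne_zero
  have hrefl := Complex.Gamma_mul_Gamma_one_sub s
  have hdouble : Complex.sin (π * s) = 2 * Complex.sin (π * s / 2) * Complex.cos (π * s / 2) := by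
    rw [← Complex.sin_two_mul]; congr 1; ring
  rw [eq_div_iff hsin, hdouble] at hrefl
  rw [zetaFactor, zetaFactor, hG1, hG2, hc, sub_sub_cancel]
  calc _ = 2 * ((2 * π : ℂ) ^ (s - 1) * (2 * π : ℂ) ^ (1 - s - 1)) * (1 - s) * s *
        (Complex.Gamma s * Complex.Gamma (1 - s) *
          (2 * Complex.sin (π * s / 2) * Complex.cos (π * s / 2))) := by ring
    _ = _ := by
      rw [hpow, hrefl]; field_simp; ring

lemma zetaFactor_conj (s : ℂ) :
    zetaFactor ((starRingEnd ℂ) s) = (starRingEnd ℂ) (zetaFactor s) := by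
  have e : (2 * π : ℂ) = ((2 * π : ℝ) : ℂ) := by push_cast; rfl
  have hp : ∀ w : ℂ, (starRingEnd ℂ) ((2 * π : ℂ) ^ w) = (2 * π : ℂ) ^ (starRingEnd ℂ w) := by
    intro w
    rw [e, Complex.cpow_conj, Complex.conj_ofReal]
    rw [Complex.arg_ofReal_of_nonneg (by positivity)]
    exact Real.pi_ne_zero.symm
  simp only [zetaFactor, map_mul, hp, ← Complex.Gamma_conj, ← Complex.cos_conj, map_sub, map_one,
    map_neg, map_div₀, Complex.conj_ofReal, Complex.conj_ofNat]

lemma norm_zetaFactor_half (t : ℝ) :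
    ‖zetaFactor (((1 / 2 : ℝ) : ℂ) + t * Complex.I)‖ ^ 2 = 1 / 4 + t ^ 2 := by
  set s : ℂ := ((1 / 2 : ℝ) : ℂ) + t * Complex.I with hs
  have h := zetaFactor_mul_one_sub (s := s) (by simp [hs]; norm_num) (by simp [hs]; norm_num)
  have hc : 1 - s = (starRingEnd ℂ) s := by
    rw [hs, map_add, map_mul, Complex.conj_ofReal, Complex.conj_ofReal, Complex.conj_I]
    push_cast; ring
  rw [hc, zetaFactor_conj, Complex.mul_conj'] at h
  have h2 : ((‖zetaFactor s‖ ^ 2 : ℝ) : ℂ) = ((1 / 4 + t ^ 2 : ℝ) : ℂ) := by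
    push_cast
    rw [h, hs]; push_cast; ring_nf; rw [Complex.I_sq]; ring
  exact_mod_cast h2

lemma norm_zetaFactor_three_halves (u : ℝ) :
    ‖zetaFactor (((3 / 2 : ℝ) : ℂ) + u * Complex.I)‖ = 2 * π := by
  set s : ℂ := ((3 / 2 : ℝ) : ℂ) + u * Complex.I with hs
  have hc : (starRingEnd ℂ) s = ((3 / 2 : ℝ) : ℂ) - u * Complex.I := by
    rw [hs, map_add, map_mul, Complex.conj_ofReal, Complex.conj_ofReal, Complex.conj_I]
    ring
  have key : zetaFactor s * zetaFactor ((starRingEnd ℂ) s) = (2 * π : ℂ) ^ 2 := by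
    have hrefl := Complex.Gamma_mul_Gamma_one_sub (1 / 2 + u * Complex.I)
    have hcos : Complex.sin (π * (1 / 2 + u * Complex.I)) = Complex.cos (π * u * Complex.I) := by
      rw [← Complex.cos_pi_div_two_sub, ← Complex.cos_neg]; congr 1; ring
    have hne : Complex.cos (π * u * Complex.I) ≠ 0 := by
      rw [show (π * u * Complex.I : ℂ) = ((π * u : ℝ) : ℂ) * Complex.I by push_cast; ring,
        Complex.cos_mul_I, ← Complex.ofReal_cosh]
      exact_mod_cast (Real.cosh_pos _).ne'
    rw [hcos, eq_div_iff hne] at hrefl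
    have hpow : (2 * π : ℂ) ^ (s - 1) * (2 * π : ℂ) ^ ((starRingEnd ℂ) s - 1) = 2 * π := by
      rw [← Complex.cpow_add _ _ two_pi_ne_zero_complex, hc, hs]
      conv_rhs => rw [← Complex.cpow_one (2 * π : ℂ)]
      congr 1; push_cast; ring
    have hcc : 2 * (Complex.cos (π * (1 - s) / 2) * Complex.cos (π * (1 - (starRingEnd ℂ) s) / 2)) =
        Complex.cos (π * u * Complex.I) := by
      rw [hc, hs]
      have e1 : (π * (1 - (((3 / 2 : ℝ) : ℂ) + u * Complex.I)) / 2 : ℂ) =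
          -(π / 4 + π * u * Complex.I / 2) := by push_cast; ring
      have e2 : (π * (1 - (((3 / 2 : ℝ) : ℂ) - u * Complex.I)) / 2 : ℂ) =
          -(π / 4 - π * u * Complex.I / 2) := by push_cast; ring
      rw [e1, e2, Complex.cos_neg, Complex.cos_neg]
      have h := Complex.cos_add_cos (π / 2) (π * u * Complex.I)
      rw [Complex.cos_pi_div_two, zero_add] at h
      rw [h]
      ring_nf
    rw [zetaFactor, zetaFactor]
    rw [show (2 - s) = 1 - (1 / 2 + u * Complex.I) by rw [hs]; push_cast; ring,
      show 2 - (starRingEnd ℂ) s = 1 / 2 + u * Complex.I by rw [hc]; push_cast; ring]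
    calc _ = 2 * ((2 * π : ℂ) ^ (s - 1) * (2 * π : ℂ) ^ ((starRingEnd ℂ) s - 1)) *
          (Complex.Gamma (1 / 2 + u * Complex.I) * Complex.Gamma (1 - (1 / 2 + u * Complex.I)) *
          (2 * (Complex.cos (π * (1 - s) / 2) * Complex.cos (π * (1 - (starRingEnd ℂ) s) / 2))))
          := by ring
      _ = _ := by rw [hpow, hcc, hrefl]; ring
  rw [zetaFactor_conj, Complex.mul_conj'] at key
  have h2 : ‖zetaFactor s‖ ^ 2 = (2 * π) ^ 2 := by exact_mod_cast key
  exact (pow_left_inj₀ (norm_nonneg _) (by positivity) two_ne_zero).1 h2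

lemma exists_norm_zetaFactor_le : ∃ K : ℝ, 0 ≤ K ∧ ∀ s : ℂ, -1 / 2 ≤ s.re → s.re ≤ 3 / 2 →
    ‖zetaFactor s‖ ≤ K * Real.exp (π / 2 * |s.im|) := by
  obtain ⟨G, hG⟩ := (isCompact_Icc (a := (1 / 2 : ℝ)) (b := 5 / 2)).exists_bound_of_continuousOn
    (f := Real.Gamma) (by
      intro x hx
      refine (Real.differentiableAt_Gamma fun m => ?_).continuousAt.continuousWithinAt
      have : (0 : ℝ) ≤ m := by positivity
      have := hx.1
      intro h
      linarith)
  have hG0 : 0 ≤ G := (norm_nonneg _).trans (hG 1 (by norm_num))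
  have hgam : ∀ s : ℂ, 0 < s.re → ‖Complex.Gamma s‖ ≤ Real.Gamma s.re := by
    intro s hs
    rw [Complex.Gamma_eq_integral hs, Complex.GammaIntegral, Real.Gamma_eq_integral hs]
    refine (MeasureTheory.norm_integral_le_integral_norm _).trans_eq ?_
    refine MeasureTheory.setIntegral_congr_fun measurableSet_Ioi fun x hx => ?_
    have hx' : 0 < x := hx
    simp only [norm_mul, Complex.norm_real, Complex.norm_cpow_eq_rpow_re_of_pos hx',
      Complex.sub_re, Complex.one_re, Real.norm_eq_abs, abs_of_pos (Real.exp_pos _)]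
  have hcos : ∀ w : ℂ, ‖Complex.cos w‖ ≤ Real.exp |w.im| := by
    intro w
    rw [Complex.cos, norm_div, Complex.norm_ofNat, div_le_iff₀ (by norm_num), mul_two]
    refine (norm_add_le _ _).trans (add_le_add ?_ ?_) <;> rw [Complex.norm_exp] <;>
      refine Real.exp_le_exp.2 ?_
    · simpa using neg_le_abs w.im
    · simpa using le_abs_self w.im
  refine ⟨2 * (2 * π) * G, by positivity, fun s h1 h2 => ?_⟩
  rw [zetaFactor, norm_mul, norm_mul, norm_mul]
  have e1 : ‖(2 * π : ℂ) ^ (s - 1)‖ ≤ 2 * π := by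
    have : (2 * π : ℂ) = ((2 * π : ℝ) : ℂ) := by push_cast; rfl
    rw [this, Complex.norm_cpow_eq_rpow_re_of_pos (by positivity)]
    conv_rhs => rw [← Real.rpow_one (2 * π)]
    refine Real.rpow_le_rpow_of_exponent_le ?_ ?_
    · linarith [Real.pi_gt_three]
    · simp; linarith
  have e2 : ‖Complex.Gamma (2 - s)‖ ≤ G := by
    refine (hgam _ (by simp; linarith)).trans ((le_abs_self _).trans (hG _ ?_))
    constructor <;> simp <;> linarith
  have e3 : ‖Complex.cos (π * (1 - s) / 2)‖ ≤ Real.exp (π / 2 * |s.im|) := by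
    refine (hcos _).trans_eq ?_
    congr 1
    have : (π * (1 - s) / 2 : ℂ) = ((π / 2 : ℝ) : ℂ) * (1 - s) := by push_cast; ring
    rw [this, Complex.im_ofReal_mul]
    simp only [Complex.sub_im, Complex.one_im, zero_sub, mul_neg, abs_neg, abs_mul]
    rw [abs_of_pos (by positivity)]
  have : ‖(-2 : ℂ)‖ = 2 := by simp
  rw [this]
  gcongr

lemma norm_LSeries_term_sq (f : ℕ → ℂ) (σ : ℝ) {n : ℕ} (hn : n ≠ 0) :
    ‖LSeries.term f σ n‖ ^ 2 = ‖f n‖ ^ 2 * (n : ℝ) ^ (-2 * σ) := by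
  rw [LSeries.norm_term_eq, if_neg hn, Complex.ofReal_re, div_pow, div_eq_mul_inv]
  congr 1
  rw [← rpow_natCast, ← rpow_mul (by positivity), ← rpow_neg (by positivity)]
  congr 1; push_cast; ring

lemma integral_norm_sq_LSeries_le_of_le {ε : ℝ} (hε : 0 < ε) : ∃ C : ℝ, 0 < C ∧
    ∀ (f : ℕ → ℂ) (σ A B X : ℝ), A ≤ B → LSeriesSummable f σ →
    (∀ n : ℕ, n ≠ 0 → (B - A + (n : ℝ) ^ (1 + ε)) * (‖f n‖ ^ 2 * (n : ℝ) ^ (-2 * σ)) ≤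
      X * (n : ℝ) ^ (-(1 + ε))) →
    ∫ t in A..B, ‖LSeries f (σ + t * Complex.I)‖ ^ 2 ≤ C * X := by
  obtain ⟨C, hC0, hC⟩ := integral_norm_sq_LSeries_le hε
  have hs : Summable fun n : ℕ => (n : ℝ) ^ (-(1 + ε)) := Real.summable_nat_rpow.2 (by linarith)
  have hpos : 0 < ∑' n : ℕ, (n : ℝ) ^ (-(1 + ε)) :=
    hs.tsum_pos (fun n => by positivity) 1 (by simp)
  refine ⟨C * ∑' n : ℕ, (n : ℝ) ^ (-(1 + ε)), by positivity, fun f σ A B X hAB hf hX => ?_⟩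
  have hle : ∀ n : ℕ, (B - A + (n : ℝ) ^ (1 + ε)) * ‖LSeries.term f σ n‖ ^ 2 ≤
      X * (n : ℝ) ^ (-(1 + ε)) := by
    intro n
    rcases eq_or_ne n 0 with rfl | hn
    · simp [Real.zero_rpow
        (by linarith : (-ε + -1 : ℝ) ≠ 0)]
    · rw [norm_LSeries_term_sq f σ hn]; exact hX n hn
  have hnn : ∀ n : ℕ, 0 ≤ (B - A + (n : ℝ) ^ (1 + ε)) * ‖LSeries.term f σ n‖ ^ 2 := fun n =>
    mul_nonneg (add_nonneg (sub_nonneg.2 hAB) (by positivity)) (by positivity)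
  have hsum := Summable.of_nonneg_of_le hnn hle (hs.mul_left X)
  refine (hC f σ A B hAB hf hsum).trans ?_
  rw [mul_assoc]
  gcongr
  calc _ ≤ ∑' n : ℕ, X * (n : ℝ) ^ (-(1 + ε)) := hsum.tsum_le_tsum hle (hs.mul_left X)
    _ = _ := by rw [tsum_mul_left, mul_comm]

/-- The divisor function truncated at `N`. -/
noncomputable def dTrunc (N n : ℕ) : ℂ := if n ≤ N then (dk 2 n : ℂ) else 0

/-- The tail of the divisor function beyond `N`. -/
noncomputable def dTail (N n : ℕ) : ℂ := if n ≤ N then 0 else (dk 2 n : ℂ)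

lemma LSeriesHasSum_dTrunc (N : ℕ) (s : ℂ) : LSeriesHasSum (dTrunc N) s
    (∑ n ∈ Finset.range (N + 1), LSeries.term (dTrunc N) s n) := by
  refine hasSum_sum_of_ne_finset_zero fun n hn => ?_
  have : ¬ n ≤ N := by simpa [Nat.lt_succ_iff] using hn
  rcases eq_or_ne n 0 with rfl | h0
  · simp
  · rw [LSeries.term_of_ne_zero h0, dTrunc, if_neg this, zero_div]

lemma differentiable_LSeries_dTrunc (N : ℕ) : Differentiable ℂ (LSeries (dTrunc N)) := by
  have : LSeries (dTrunc N) =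
      fun s => ∑ n ∈ Finset.range (N + 1), LSeries.term (dTrunc N) s n := by
    funext s; exact (LSeriesHasSum_dTrunc N s).LSeries_eq
  rw [this]
  refine Differentiable.fun_sum fun n _ s => ?_
  exact (LSeries.hasDerivAt_term _ _ _).differentiableAt

lemma LSeriesHasSum_dTail (N : ℕ) {s : ℂ} (hs : 1 < s.re) : LSeriesHasSum (dTail N) s
    (riemannZeta s ^ 2 - LSeries (dTrunc N) s) := by
  have h1 := LSeriesHasSum_dk 2 hs
  have h2 : LSeriesHasSum (dTrunc N) s (LSeries (dTrunc N) s) :=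
    (LSeriesHasSum_dTrunc N s).LSeriesSummable.LSeriesHasSum
  have e : dTail N = (fun n => (dk 2 n : ℂ)) - dTrunc N := by
    funext n
    simp only [dTail, dTrunc, Pi.sub_apply]
    split_ifs <;> simp
  rw [e]
  exact h1.sub h2

lemma exists_dk_two_sq_le {η : ℝ} (hη : 0 < η) : ∃ C : ℝ, 1 ≤ C ∧
    ∀ n : ℕ, n ≠ 0 → (dk 2 n : ℝ) ^ 2 ≤ C * (n : ℝ) ^ (2 * η) := by
  obtain ⟨C, hC1, hC⟩ := exists_dk_le 2 hη
  refine ⟨C ^ 2, one_le_pow₀ hC1, fun n hn => ?_⟩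
  calc (dk 2 n : ℝ) ^ 2 ≤ (C * (n : ℝ) ^ η) ^ 2 := by gcongr; exact hC n hn
    _ = _ := by rw [mul_pow, ← rpow_natCast ((n : ℝ) ^ η), ← rpow_mul (by positivity)]
                push_cast; ring_nf

lemma integral_norm_sq_dTrunc_le {σ ε : ℝ} (hσ : σ ≤ 1 / 2) (hε : 0 < ε) : ∃ C : ℝ, 0 < C ∧
    ∀ N : ℕ, 1 ≤ N → ∀ A : ℝ, ∫ t in A..A + N, ‖LSeries (dTrunc N) (σ + t * Complex.I)‖ ^ 2 ≤
      C * (N : ℝ) ^ (2 - 2 * σ + ε) := by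
  have hη : 0 < ε / 4 := by positivity
  obtain ⟨C₁, hC₁, h₁⟩ := integral_norm_sq_LSeries_le_of_le hη
  obtain ⟨C₂, hC₂, h₂⟩ := exists_dk_two_sq_le hη
  refine ⟨C₁ * (2 * C₂), by positivity, fun N hN A => ?_⟩
  rw [mul_assoc]
  refine h₁ _ _ _ _ _ (by simp) (LSeriesHasSum_dTrunc N σ).LSeriesSummable fun n hn => ?_
  have hn1 : (1 : ℝ) ≤ n := by exact_mod_cast Nat.one_le_iff_ne_zero.2 hn
  have hN1 : (1 : ℝ) ≤ N := by exact_mod_cast hN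
  rw [dTrunc]
  split_ifs with h
  · have hnN : (n : ℝ) ≤ N := by exact_mod_cast h
    have e0 : (N : ℝ) ≤ (N : ℝ) ^ (1 + ε / 4) := by
      conv_lhs => rw [← rpow_one (N : ℝ)]
      exact rpow_le_rpow_of_exponent_le hN1 (by linarith)
    calc _ ≤ ((N : ℝ) ^ (1 + ε / 4) + (N : ℝ) ^ (1 + ε / 4)) *
          ((C₂ * (n : ℝ) ^ (2 * (ε / 4))) * (n : ℝ) ^ (-2 * σ)) := by
          gcongr
          · simpa using e0
          · simpa using h₂ n hn
      _ = 2 * C₂ * (N : ℝ) ^ (1 + ε / 4) * ((n : ℝ) ^ (1 - 2 * σ + 3 * (ε / 4)) *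
          (n : ℝ) ^ (-(1 + ε / 4))) := by
          have : (n : ℝ) ^ (1 - 2 * σ + 3 * (ε / 4)) * (n : ℝ) ^ (-(1 + ε / 4)) =
              (n : ℝ) ^ (2 * (ε / 4)) * (n : ℝ) ^ (-2 * σ) := by
            rw [← rpow_add (by linarith), ← rpow_add (by linarith)]; congr 1; ring
          rw [this]; ring
      _ ≤ 2 * C₂ * (N : ℝ) ^ (1 + ε / 4) * ((N : ℝ) ^ (1 - 2 * σ + 3 * (ε / 4)) *
          (n : ℝ) ^ (-(1 + ε / 4))) := by
          gcongr
          linarith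
      _ = _ := by
          have : (N : ℝ) ^ (2 - 2 * σ + ε) =
              (N : ℝ) ^ (1 + ε / 4) * (N : ℝ) ^ (1 - 2 * σ + 3 * (ε / 4)) := by
            rw [← rpow_add (by linarith)]; congr 1; ring
          rw [this]; ring
  · simp only [norm_zero]
    rw [zero_pow two_ne_zero, zero_mul, mul_zero]
    positivity

lemma integral_norm_sq_dTail_le {ε : ℝ} (hε : 0 < ε) (hε1 : ε ≤ 1) : ∃ C : ℝ, 0 < C ∧
    ∀ N : ℕ, 1 ≤ N → ∀ A : ℝ,
    ∫ t in A..A + N, ‖LSeries (dTail N) (((3 / 2 : ℝ) : ℂ) + t * Complex.I)‖ ^ 2 ≤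
      C * (N : ℝ) ^ (-1 + ε) := by
  have hη : 0 < ε / 4 := by positivity
  obtain ⟨C₁, hC₁, h₁⟩ := integral_norm_sq_LSeries_le_of_le hη
  obtain ⟨C₂, hC₂, h₂⟩ := exists_dk_two_sq_le hη
  refine ⟨C₁ * (2 * C₂), by positivity, fun N hN A => ?_⟩
  rw [mul_assoc]
  refine h₁ _ _ _ _ _ (by simp) (LSeriesHasSum_dTail N (by
    rw [Complex.ofReal_re]; norm_num)).LSeriesSummable fun n hn => ?_
  have hn1 : (1 : ℝ) ≤ n := by exact_mod_cast Nat.one_le_iff_ne_zero.2 hn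
  have hN1 : (1 : ℝ) ≤ N := by exact_mod_cast hN
  rw [dTail]
  split_ifs with h
  · simp only [norm_zero]
    rw [zero_pow two_ne_zero, zero_mul, mul_zero]
    positivity
  · have hnN : (N : ℝ) ≤ n := by exact_mod_cast (not_le.1 h).le
    have e0 : (n : ℝ) ≤ (n : ℝ) ^ (1 + ε / 4) := by
      conv_lhs => rw [← rpow_one (n : ℝ)]
      exact rpow_le_rpow_of_exponent_le hn1 (by linarith)
    calc _ ≤ ((n : ℝ) ^ (1 + ε / 4) + (n : ℝ) ^ (1 + ε / 4)) *
          ((C₂ * (n : ℝ) ^ (2 * (ε / 4))) * (n : ℝ) ^ (-2 * (3 / 2 : ℝ))) := by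
          gcongr
          · simpa using hnN.trans e0
          · simpa using h₂ n hn
      _ = 2 * C₂ * ((n : ℝ) ^ (-1 + ε) * (n : ℝ) ^ (-(1 + ε / 4))) := by
          have : (n : ℝ) ^ (-1 + ε) * (n : ℝ) ^ (-(1 + ε / 4)) =
              (n : ℝ) ^ (1 + ε / 4) * (n : ℝ) ^ (2 * (ε / 4)) * (n : ℝ) ^ (-2 * (3 / 2 : ℝ)) := by
            rw [← rpow_add (by linarith), ← rpow_add (by linarith), ← rpow_add (by linarith)]
            congr 1; ring
          rw [this]; ring
      _ ≤ 2 * C₂ * ((N : ℝ) ^ (-1 + ε) * (n : ℝ) ^ (-(1 + ε / 4))) := by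
          gcongr 2 * C₂ * (?_ * _)
          exact rpow_le_rpow_of_nonpos (by linarith) hnN (by linarith)
      _ = _ := by ring

/-- `(s - 1)²` times the error in the approximate functional equation for `ζ(s)²`. -/
noncomputable def zetaSqRem (N : ℕ) (s : ℂ) : ℂ :=
  riemannZeta₁ s ^ 2 - (s - 1) ^ 2 * LSeries (dTrunc N) s -
    zetaFactor s ^ 2 * LSeries (dTrunc N) (1 - s)

lemma differentiableOn_zetaSqRem (N : ℕ) : DifferentiableOn ℂ (zetaSqRem N) {s | s.re < 2} := by
  have h1 := differentiable_riemannZeta₁.differentiableOn (s := {s : ℂ | s.re < 2})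
  have h2 := (differentiable_LSeries_dTrunc N).differentiableOn (s := {s : ℂ | s.re < 2})
  have h3 : DifferentiableOn ℂ (fun s => LSeries (dTrunc N) (1 - s)) {s : ℂ | s.re < 2} :=
    ((differentiable_LSeries_dTrunc N).comp (by fun_prop)).differentiableOn
  have h4 : DifferentiableOn ℂ (fun s : ℂ => (s - 1) ^ 2) {s : ℂ | s.re < 2} := by fun_prop
  exact ((h1.pow 2).sub (h4.mul h2)).sub ((differentiableOn_zetaFactor.pow 2).mul h3)

lemma sq_mul_zetaSqRem (N : ℕ) {s : ℂ} (h1 : -1 < s.re) (h2 : s.re < 1) :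
    s ^ 2 * zetaSqRem N s = zetaFactor s ^ 2 * zetaSqRem N (1 - s) := by
  have e1 := mul_riemannZeta₁_eq h2
  have e2 := zetaFactor_mul_one_sub h1 (by linarith : s.re < 2)
  rw [zetaSqRem, zetaSqRem, sub_sub_cancel]
  have e3 : s ^ 2 * riemannZeta₁ s ^ 2 = zetaFactor s ^ 2 * riemannZeta₁ (1 - s) ^ 2 := by
    rw [← mul_pow, e1]; ring
  have e4 : zetaFactor s ^ 2 * zetaFactor (1 - s) ^ 2 = s ^ 2 * (s - 1) ^ 2 := by
    rw [← mul_pow, e2]; ring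
  linear_combination e3 + LSeries (dTrunc N) s * e4

lemma exists_norm_LSeries_dTrunc_le (N : ℕ) : ∃ B : ℝ, 0 ≤ B ∧ ∀ s : ℂ, -1 / 2 ≤ s.re →
    ‖LSeries (dTrunc N) s‖ ≤ B := by
  refine ⟨∑ n ∈ Finset.range (N + 1), ‖LSeries.term (dTrunc N) (-1 / 2 : ℂ) n‖,
    Finset.sum_nonneg fun _ _ => norm_nonneg _, fun s hs => ?_⟩
  rw [(LSeriesHasSum_dTrunc N s).LSeries_eq]
  refine (norm_sum_le _ _).trans (Finset.sum_le_sum fun n _ => ?_)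
  exact LSeries.norm_term_le_of_re_le_re _ (by norm_num; linarith) n

lemma exists_norm_zetaSqRem_le (N : ℕ) : ∃ K : ℝ, ∀ s : ℂ, -1 / 2 ≤ s.re → s.re ≤ 3 / 2 →
    ‖s ^ 2 * zetaSqRem N s‖ ≤ K * Real.exp (8 * |s.im|) := by
  obtain ⟨K, hK0, hK⟩ := exists_norm_zetaFactor_le
  obtain ⟨B, hB0, hB⟩ := exists_norm_LSeries_dTrunc_le N
  have hE : ∀ s : ℂ, -1 / 2 ≤ s.re → s.re ≤ 3 / 2 → ‖s‖ ≤ 2 * Real.exp |s.im| := by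
    intro s h1 h2
    have := Complex.norm_le_abs_re_add_abs_im s
    have h3 : |s.re| ≤ 3 / 2 := abs_le.2 ⟨by linarith, h2⟩
    have h4 := Real.add_one_le_exp |s.im|
    have := abs_nonneg s.im
    linarith
  have hF : ∀ s : ℂ, -1 / 2 ≤ s.re → s.re ≤ 3 / 2 →
      ‖zetaFactor s‖ ≤ K * Real.exp |s.im| ^ 2 := by
    intro s h1 h2
    refine (hK s h1 h2).trans ?_
    rw [← Real.exp_nat_mul]
    gcongr
    push_cast
    linarith [Real.pi_le_four]
  set M := 289 + 4 * B + K ^ 2 * B with hM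
  have hM0 : 0 ≤ M := by positivity
  have hr : ∀ s : ℂ, 1 / 2 ≤ s.re → s.re ≤ 3 / 2 →
      ‖zetaSqRem N s‖ ≤ M * Real.exp |s.im| ^ 4 := by
    intro s h1 h2
    have a1 := hE s (by linarith) h2
    have a2 : ‖s - 1‖ ≤ 2 * Real.exp |s.im| := by
      have := hE (1 - s) (by simp; linarith) (by simp; linarith)
      rw [norm_sub_rev]
      simpa using this
    have a3 := hF s (by linarith) h2
    have a4 := hB s (by linarith)
    have a5 := hB (1 - s) (by simp; linarith)
    have a6 : ‖riemannZeta₁ s‖ ≤ 17 * Real.exp |s.im| ^ 2 := by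
      have := norm_riemannZeta₁_sub_le h1 0
      simp at this
      have h3 : ‖riemannZeta₁ s‖ ≤ ‖riemannZeta₁ s - 1‖ + 1 := by
        have := norm_add_le (riemannZeta₁ s - 1) 1
        simpa using this
      have h4 : ‖s - 1‖ * ‖s‖ ≤ (2 * Real.exp |s.im|) * (2 * Real.exp |s.im|) := by gcongr
      have h5 : 1 ≤ Real.exp |s.im| := Real.one_le_exp (abs_nonneg _)
      nlinarith
    set E := Real.exp |s.im|
    have hE1 : 1 ≤ E := Real.one_le_exp (abs_nonneg _)
    rw [zetaSqRem]
    calc _ ≤ ‖riemannZeta₁ s‖ ^ 2 + ‖s - 1‖ ^ 2 * ‖LSeries (dTrunc N) s‖ +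
          ‖zetaFactor s‖ ^ 2 * ‖LSeries (dTrunc N) (1 - s)‖ := by
          refine (norm_sub_le _ _).trans (add_le_add ((norm_sub_le _ _).trans ?_) ?_) <;>
            simp only [norm_mul, norm_pow, le_refl]
      _ ≤ (17 * E ^ 2) ^ 2 + (2 * E) ^ 2 * B + (K * E ^ 2) ^ 2 * B := by gcongr
      _ ≤ (17 * E ^ 2) ^ 2 + 4 * B * E ^ 4 + (K * E ^ 2) ^ 2 * B := by
          have : E ^ 2 ≤ E ^ 4 := pow_le_pow_right₀ hE1 (by norm_num)
          nlinarith
      _ = _ := by rw [hM]; ring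
  refine ⟨(4 + K ^ 2) * M, fun s h1 h2 => ?_⟩
  have hE1 : 1 ≤ Real.exp |s.im| := Real.one_le_exp (abs_nonneg _)
  have e8 : Real.exp (8 * |s.im|) = Real.exp |s.im| ^ 8 := by
    rw [← Real.exp_nat_mul]; norm_num
  rw [e8]
  rcases le_total (1 / 2) s.re with h | h
  · rw [norm_mul, norm_pow]
    calc _ ≤ (2 * Real.exp |s.im|) ^ 2 * (M * Real.exp |s.im| ^ 4) := by
          gcongr
          · exact hE s h1 h2
          · exact hr s h h2
      _ = 4 * M * Real.exp |s.im| ^ 6 := by ring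
      _ ≤ (4 + K ^ 2) * M * Real.exp |s.im| ^ 8 := by
          gcongr
          · nlinarith [sq_nonneg K]
          · norm_num
  · rw [sq_mul_zetaSqRem N (by linarith) (by linarith), norm_mul, norm_pow]
    have := hr (1 - s) (by simp; linarith) (by simp; linarith)
    simp only [Complex.sub_im, Complex.one_im, zero_sub, abs_neg] at this
    calc _ ≤ (K * Real.exp |s.im| ^ 2) ^ 2 * (M * Real.exp |s.im| ^ 4) := by
          gcongr
          exact hF s h1 h2
      _ = K ^ 2 * M * Real.exp |s.im| ^ 8 := by ring
      _ ≤ (4 + K ^ 2) * M * Real.exp |s.im| ^ 8 := by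
          gcongr
          linarith

lemma continuous_comp_line {F : ℂ → ℂ} (hF : DifferentiableOn ℂ F {s | s.re < 2}) {σ : ℝ}
    (hσ : σ < 2) : Continuous fun t : ℝ => F (σ + t * Complex.I) :=
  hF.continuousOn.comp_continuous (by fun_prop) (fun t => by simpa using hσ)

lemma integral_norm_sq_zetaSqRem_le {ε : ℝ} (hε : 0 < ε) (hε1 : ε ≤ 1) : ∃ C : ℝ, 0 < C ∧
    ∀ N : ℕ, 1 ≤ N → ∀ A : ℝ,
    ∫ t in A..A + N, ‖zetaSqRem N (((3 / 2 : ℝ) : ℂ) + t * Complex.I)‖ ^ 2 ≤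
      C * ((|A| + N) ^ 4 * (N : ℝ) ^ (-1 + ε)) := by
  obtain ⟨C₁, hC₁, h₁⟩ := integral_norm_sq_dTail_le hε hε1
  obtain ⟨C₂, hC₂, h₂⟩ := integral_norm_sq_dTrunc_le (σ := -1 / 2) (by norm_num) hε
  refine ⟨8 * C₁ + 32 * π ^ 4 * C₂, by positivity, fun N hN A => ?_⟩
  have hN1 : (1 : ℝ) ≤ N := by exact_mod_cast hN
  set R := |A| + N with hR
  have hR1 : 1 ≤ R := by have := abs_nonneg A; linarith
  set f : ℝ → ℂ := fun t => LSeries (dTail N) (((3 / 2 : ℝ) : ℂ) + t * Complex.I) with hf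
  set g : ℝ → ℂ := fun t => LSeries (dTrunc N) (((-1 / 2 : ℝ) : ℂ) + t * Complex.I) with hg
  have hgc : Continuous g :=
    (differentiable_LSeries_dTrunc N).continuous.comp (by fun_prop)
  have hf_eq : ∀ t : ℝ, f t = riemannZeta (((3 / 2 : ℝ) : ℂ) + t * Complex.I) ^ 2 -
      LSeries (dTrunc N) (((3 / 2 : ℝ) : ℂ) + t * Complex.I) := fun t =>
    (LSeriesHasSum_dTail N (by simp; norm_num)).LSeries_eq
  have hne : ∀ t : ℝ, ((3 / 2 : ℝ) : ℂ) + t * Complex.I ≠ 1 := by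
    intro t h
    have := congrArg Complex.re h
    norm_num at this
  have hfc : Continuous f := by
    have e : f = fun t : ℝ => riemannZeta (((3 / 2 : ℝ) : ℂ) + t * Complex.I) ^ 2 -
      LSeries (dTrunc N) (((3 / 2 : ℝ) : ℂ) + t * Complex.I) := funext hf_eq
    rw [e]
    refine Continuous.sub (Continuous.pow (continuous_iff_continuousAt.2 fun t => ?_) 2)
      ((differentiable_LSeries_dTrunc N).continuous.comp (by fun_prop))
    exact (differentiableAt_riemannZeta (hne t)).continuousAt.comp
      (f := fun t : ℝ => ((3 / 2 : ℝ) : ℂ) + t * Complex.I) (by fun_prop)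
  have hpt : ∀ t ∈ Set.Icc A (A + N),
      ‖zetaSqRem N (((3 / 2 : ℝ) : ℂ) + t * Complex.I)‖ ^ 2 ≤
      8 * R ^ 4 * ‖f t‖ ^ 2 + 32 * π ^ 4 * ‖g (-t)‖ ^ 2 := by
    intro t ht
    set s : ℂ := ((3 / 2 : ℝ) : ℂ) + t * Complex.I with hs
    have e1 : zetaSqRem N s = (s - 1) ^ 2 * f t - zetaFactor s ^ 2 * g (-t) := by
      have a1 : g (-t) = LSeries (dTrunc N) (1 - s) := by
        simp only [hg, hs]; congr 1; push_cast; ring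
      have a2 : riemannZeta₁ s = (s - 1) * riemannZeta s := by
        rw [riemannZeta_eq_inv_sub_mul (s := s) (hne t), mul_inv_cancel_left₀ (sub_ne_zero.2 (hne t))]
      have a3 : f t = riemannZeta s ^ 2 - LSeries (dTrunc N) s := hf_eq t
      rw [a1, a3, zetaSqRem, a2]
      ring
    have e2 : ‖s - 1‖ ^ 2 ≤ 2 * R ^ 2 := by
      have a1 : ‖s - 1‖ ^ 2 = 1 / 4 + t ^ 2 := by
        rw [← Complex.normSq_eq_norm_sq, Complex.normSq_apply]
        simp [hs]; ring
      have a2 : |t| ≤ R := abs_le.2 ⟨by have := neg_abs_le A; linarith [ht.1],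
        by have := le_abs_self A; linarith [ht.2]⟩
      have a3 : t ^ 2 ≤ R ^ 2 := by rw [← sq_abs]; gcongr
      nlinarith
    have e3 : ‖zetaFactor s‖ = 2 * π := norm_zetaFactor_three_halves t
    rw [e1]
    calc _ ≤ (‖(s - 1) ^ 2 * f t‖ + ‖zetaFactor s ^ 2 * g (-t)‖) ^ 2 := by
          gcongr; exact norm_sub_le _ _
      _ ≤ 2 * (‖(s - 1) ^ 2 * f t‖ ^ 2 + ‖zetaFactor s ^ 2 * g (-t)‖ ^ 2) := by
          nlinarith [sq_nonneg (‖(s - 1) ^ 2 * f t‖ - ‖zetaFactor s ^ 2 * g (-t)‖)]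
      _ = 2 * ((‖s - 1‖ ^ 2) ^ 2 * ‖f t‖ ^ 2 + (2 * π) ^ 4 * ‖g (-t)‖ ^ 2) := by
          rw [norm_mul, norm_mul, norm_pow, norm_pow, e3]; ring
      _ ≤ 2 * ((2 * R ^ 2) ^ 2 * ‖f t‖ ^ 2 + (2 * π) ^ 4 * ‖g (-t)‖ ^ 2) := by gcongr
      _ = _ := by ring
  have hle : A ≤ A + N := by linarith
  calc ∫ t in A..A + N, ‖zetaSqRem N (((3 / 2 : ℝ) : ℂ) + t * Complex.I)‖ ^ 2
      ≤ ∫ t in A..A + N, (8 * R ^ 4 * ‖f t‖ ^ 2 + 32 * π ^ 4 * ‖g (-t)‖ ^ 2) := by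
        refine intervalIntegral.integral_mono_on hle ?_ ?_ hpt
        · exact ((continuous_comp_line (differentiableOn_zetaSqRem N)
            (by norm_num)).norm.pow 2).intervalIntegrable _ _
        · apply Continuous.intervalIntegrable; fun_prop
    _ = 8 * R ^ 4 * (∫ t in A..A + N, ‖f t‖ ^ 2) +
        32 * π ^ 4 * ∫ t in A..A + N, ‖g (-t)‖ ^ 2 := by
        rw [intervalIntegral.integral_add, intervalIntegral.integral_const_mul,
          intervalIntegral.integral_const_mul] <;>
        · apply Continuous.intervalIntegrable; fun_prop
    _ ≤ 8 * R ^ 4 * (C₁ * (N : ℝ) ^ (-1 + ε)) + 32 * π ^ 4 * (C₂ * (N : ℝ) ^ (3 + ε)) := by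
        gcongr
        · exact h₁ N hN A
        · rw [intervalIntegral.integral_comp_neg (fun t => ‖g t‖ ^ 2)]
          have := h₂ N hN (-(A + N))
          rw [show -(A + N) + N = -A by ring] at this
          refine this.trans_eq ?_
          congr 2; ring
    _ ≤ 8 * R ^ 4 * (C₁ * (N : ℝ) ^ (-1 + ε)) + 32 * π ^ 4 *
        (C₂ * (R ^ 4 * (N : ℝ) ^ (-1 + ε))) := by
        have : (N : ℝ) ^ (3 + ε) = (N : ℝ) ^ 4 * (N : ℝ) ^ (-1 + ε) := by
          rw [← rpow_natCast, ← rpow_add (by linarith)]; congr 1; push_cast; ring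
        rw [this]
        gcongr
        have := abs_nonneg A; linarith
    _ = _ := by ring

lemma exp_mul_pow_le (v : ℝ) : Real.exp (2 * (1 - v ^ 2)) * (1 + |v|) ^ 12 ≤ Real.exp 20 := by
  have h1 : (1 + |v|) ^ 12 ≤ Real.exp (12 * |v|) := by
    have : Real.exp (12 * |v|) = Real.exp |v| ^ 12 := by rw [← Real.exp_nat_mul]; norm_num
    rw [this]
    gcongr
    have := Real.add_one_le_exp |v|
    linarith
  calc _ ≤ Real.exp (2 * (1 - v ^ 2)) * Real.exp (12 * |v|) := by gcongr
    _ ≤ _ := by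
      rw [← Real.exp_add]
      refine Real.exp_le_exp.2 ?_
      nlinarith [sq_nonneg (|v| - 3), sq_abs v]

lemma integral_norm_sq_zetaSqRem_half_le {ε : ℝ} (hε : 0 < ε) (hε1 : ε ≤ 1) : ∃ C : ℝ, 0 < C ∧
    ∀ N : ℕ, 1 ≤ N →
    ∫ t in (N : ℝ)..N + N, ‖(((1 / 2 : ℝ) : ℂ) + t * Complex.I) ^ 2 *
      zetaSqRem N (((1 / 2 : ℝ) : ℂ) + t * Complex.I)‖ ^ 2 ≤ C * (N : ℝ) ^ (9 + ε) := by
  obtain ⟨C, hC0, hC⟩ := integral_norm_sq_zetaSqRem_le hε hε1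
  set D := C * 2 ^ 26 * Real.exp 20 with hD
  have hD0 : 0 < D := by positivity
  refine ⟨D, hD0, fun N hN => ?_⟩
  have hN1 : (1 : ℝ) ≤ N := by exact_mod_cast hN
  have hN0 : (0 : ℝ) < N := by linarith
  obtain ⟨K, hK⟩ := exists_norm_zetaSqRem_le N
  set F : ℂ → ℂ := fun s => s ^ 2 * zetaSqRem N s with hF
  have hFd : DifferentiableOn ℂ F {s | s.re < 2} :=
    (differentiableOn_id.pow 2).mul (differentiableOn_zetaSqRem N)
  have hsc := continuous_comp_line (differentiableOn_zetaSqRem N) (σ := 3 / 2) (by norm_num)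
  have hR : ∀ v : ℝ, |N + v| + N ≤ 2 * N * (1 + |v|) := by
    intro v
    have := abs_add_le (N : ℝ) v
    rw [abs_of_pos hN0] at this
    nlinarith [abs_nonneg v]
  have habs : ∀ v : ℝ, ∀ t ∈ Set.Icc ((N : ℝ) + v) (N + v + N), |t| ≤ |N + v| + N := by
    intro v t ht
    exact abs_le.2 ⟨by have := neg_abs_le ((N : ℝ) + v); linarith [ht.1],
        by have := le_abs_self ((N : ℝ) + v); linarith [ht.2]⟩
  have hR1 : ∀ v : ℝ, 1 ≤ |N + v| + N := fun v => by
    have := abs_nonneg ((N : ℝ) + v); linarith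
  have hsq : ∀ (σ u : ℝ), ‖(σ : ℂ) + u * Complex.I‖ ^ 2 = σ ^ 2 + u ^ 2 := by
    intro σ u
    rw [← Complex.normSq_eq_norm_sq, Complex.normSq_apply]
    simp; ring
  have hshift : ∀ (σ v : ℝ), ∫ t in (N : ℝ)..N + N,
      ‖F ((σ : ℂ) + ((v + t : ℝ) : ℂ) * Complex.I)‖ ^ 2 =
      ∫ t in (N + v : ℝ)..N + v + N, ‖F ((σ : ℂ) + (t : ℂ) * Complex.I)‖ ^ 2 := by
    intro σ v
    rw [intervalIntegral.integral_comp_add_left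
      (fun t : ℝ => ‖F ((σ : ℂ) + (t : ℂ) * Complex.I)‖ ^ 2)]
    congr 1 <;> ring
  have hr : ∀ v : ℝ, Real.exp (2 * (1 - v ^ 2)) *
      ∫ t in (N : ℝ)..N + N, ‖F (((3 / 2 : ℝ) : ℂ) + ((v + t : ℝ) : ℂ) * Complex.I)‖ ^ 2 ≤
      (√(D * (N : ℝ) ^ (7 + ε))) ^ 2 := by
    intro v
    rw [Real.sq_sqrt (by positivity), hshift]
    set R := |N + v| + N with hRdef
    have h1 : ∫ t in (N + v : ℝ)..N + v + N, ‖F (((3 / 2 : ℝ) : ℂ) + (t : ℂ) * Complex.I)‖ ^ 2 ≤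
        ∫ t in (N + v : ℝ)..N + v + N, 16 * R ^ 4 *
          ‖zetaSqRem N (((3 / 2 : ℝ) : ℂ) + t * Complex.I)‖ ^ 2 := by
      refine intervalIntegral.integral_mono_on (by linarith) ?_ ?_ fun t ht => ?_
      · exact ((continuous_comp_line hFd (by norm_num)).norm.pow 2).intervalIntegrable _ _
      · exact (continuous_const.mul (hsc.norm.pow 2)).intervalIntegrable _ _
      · simp only [hF, norm_mul, norm_pow]
        rw [mul_pow, hsq]
        have a1 : t ^ 2 ≤ R ^ 2 := by rw [← sq_abs]; gcongr; exact habs v t ht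
        have a2 : (3 / 2 : ℝ) ^ 2 + t ^ 2 ≤ 4 * R ^ 2 := by nlinarith [hR1 v]
        calc _ ≤ (4 * R ^ 2) ^ 2 * ‖zetaSqRem N (((3 / 2 : ℝ) : ℂ) + t * Complex.I)‖ ^ 2 := by
              gcongr
          _ = _ := by ring
    rw [intervalIntegral.integral_const_mul] at h1
    have h2 := hC N hN (N + v)
    rw [← hRdef] at h2
    have hv := abs_nonneg v
    have hR0 : 0 ≤ R := by linarith [hR1 v]
    calc _ ≤ Real.exp (2 * (1 - v ^ 2)) * (16 * R ^ 4 * (C * (R ^ 4 * (N : ℝ) ^ (-1 + ε)))) := by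
          refine mul_le_mul_of_nonneg_left (h1.trans ?_) (by positivity)
          gcongr
      _ = 16 * C * Real.exp (2 * (1 - v ^ 2)) * R ^ 8 * (N : ℝ) ^ (-1 + ε) := by ring
      _ ≤ 16 * C * Real.exp (2 * (1 - v ^ 2)) * (2 * N * (1 + |v|)) ^ 8 * (N : ℝ) ^ (-1 + ε) := by
          gcongr; exact hR v
      _ = C * 2 ^ 12 * (Real.exp (2 * (1 - v ^ 2)) * (1 + |v|) ^ 8) *
          ((N : ℝ) ^ 8 * (N : ℝ) ^ (-1 + ε)) := by ring
      _ ≤ C * 2 ^ 26 * Real.exp 20 * (N : ℝ) ^ (7 + ε) := by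
          have e1 : (N : ℝ) ^ 8 * (N : ℝ) ^ (-1 + ε) = (N : ℝ) ^ (7 + ε) := by
            rw [← rpow_natCast, ← rpow_add hN0]; congr 1; push_cast; ring
          have e2 : Real.exp (2 * (1 - v ^ 2)) * (1 + |v|) ^ 8 ≤ Real.exp 20 := by
            refine le_trans ?_ (exp_mul_pow_le v)
            gcongr
            · linarith
            · norm_num
          rw [e1]
          gcongr
          · norm_num
          · norm_num
      _ = _ := by rw [hD]
  have hl : ∀ v : ℝ, Real.exp (2 * (1 - v ^ 2)) *
      ∫ t in (N : ℝ)..N + N, ‖F (((-1 / 2 : ℝ) : ℂ) + ((v + t : ℝ) : ℂ) * Complex.I)‖ ^ 2 ≤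
      (√(D * (N : ℝ) ^ (11 + ε))) ^ 2 := by
    intro v
    rw [Real.sq_sqrt (by positivity), hshift]
    set R := |N + v| + N with hRdef
    have hR0 : 0 ≤ R := by linarith [hR1 v]
    have h1 : ∫ t in (N + v : ℝ)..N + v + N, ‖F (((-1 / 2 : ℝ) : ℂ) + (t : ℂ) * Complex.I)‖ ^ 2 ≤
        ∫ t in (N + v : ℝ)..N + v + N, 64 * R ^ 8 *
          ‖zetaSqRem N (((3 / 2 : ℝ) : ℂ) + ((-t : ℝ) : ℂ) * Complex.I)‖ ^ 2 := by
      refine intervalIntegral.integral_mono_on (by linarith) ?_ ?_ fun t ht => ?_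
      · exact ((continuous_comp_line hFd (by norm_num)).norm.pow 2).intervalIntegrable _ _
      · exact (continuous_const.mul
          ((hsc.comp continuous_neg).norm.pow 2)).intervalIntegrable _ _
      · set s : ℂ := ((-1 / 2 : ℝ) : ℂ) + t * Complex.I with hs
        have a0 : 1 - s = ((3 / 2 : ℝ) : ℂ) + ((-t : ℝ) : ℂ) * Complex.I := by
          rw [hs]; push_cast; ring
        have a1 : F s = zetaFactor s ^ 2 * zetaSqRem N (1 - s) :=
          sq_mul_zetaSqRem N (by simp [hs]; norm_num) (by simp [hs]; norm_num)
        have a2 : ‖zetaFactor s‖ ^ 2 * (2 * π) ^ 2 = ‖s‖ ^ 2 * ‖s - 1‖ ^ 2 := by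
          have := zetaFactor_mul_one_sub (s := s) (by simp [hs]; norm_num)
            (by simp [hs]; norm_num)
          have h3 := norm_zetaFactor_three_halves (-t)
          rw [← a0] at h3
          rw [← h3, ← mul_pow, ← norm_mul, this, norm_neg, norm_mul, mul_pow]
        have a3 : ‖s‖ ^ 2 = 1 / 4 + t ^ 2 := by rw [hs, hsq]; ring
        have a4 : ‖s - 1‖ ^ 2 = 9 / 4 + t ^ 2 := by
          rw [norm_sub_rev, a0, hsq]; ring
        have a5 : t ^ 2 ≤ R ^ 2 := by rw [← sq_abs]; gcongr; exact habs v t ht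
        have a6 : ‖zetaFactor s‖ ^ 2 ≤ 8 * R ^ 4 := by
          have b1 : (1 : ℝ) ≤ (2 * π) ^ 2 := by nlinarith [Real.pi_gt_three]
          have b2 : 1 ≤ R ^ 2 := one_le_pow₀ (hR1 v)
          calc ‖zetaFactor s‖ ^ 2 ≤ ‖zetaFactor s‖ ^ 2 * (2 * π) ^ 2 :=
                le_mul_of_one_le_right (by positivity) b1
            _ = (1 / 4 + t ^ 2) * (9 / 4 + t ^ 2) := by rw [a2, a3, a4]
            _ ≤ (2 * R ^ 2) * (4 * R ^ 2) := by gcongr <;> linarith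
            _ = _ := by ring
        rw [a1, ← a0, norm_mul, norm_pow, mul_pow]
        calc _ ≤ (8 * R ^ 4) ^ 2 * ‖zetaSqRem N (1 - s)‖ ^ 2 := by gcongr
          _ = _ := by ring
    rw [intervalIntegral.integral_const_mul, intervalIntegral.integral_comp_neg
      (fun t : ℝ => ‖zetaSqRem N (((3 / 2 : ℝ) : ℂ) + (t : ℂ) * Complex.I)‖ ^ 2)] at h1
    have h2 := hC N hN (-(N + v + N))
    rw [show -((N : ℝ) + v + N) + N = -(N + v) by ring] at h2
    have h3 : |-((N : ℝ) + v + N)| + N ≤ 2 * R := by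
      rw [abs_neg]
      have := abs_add_le ((N : ℝ) + v) N
      rw [abs_of_pos hN0] at this
      rw [hRdef]; have := abs_nonneg ((N : ℝ) + v); linarith
    have hv := abs_nonneg v
    calc _ ≤ Real.exp (2 * (1 - v ^ 2)) *
          (64 * R ^ 8 * (C * ((2 * R) ^ 4 * (N : ℝ) ^ (-1 + ε)))) := by
          refine mul_le_mul_of_nonneg_left (h1.trans ?_) (by positivity)
          gcongr
          refine h2.trans ?_
          gcongr
      _ = 2 ^ 10 * C * Real.exp (2 * (1 - v ^ 2)) * R ^ 12 * (N : ℝ) ^ (-1 + ε) := by ring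
      _ ≤ 2 ^ 10 * C * Real.exp (2 * (1 - v ^ 2)) * (2 * N * (1 + |v|)) ^ 12 *
          (N : ℝ) ^ (-1 + ε) := by
          gcongr; exact hR v
      _ = C * 2 ^ 22 * (Real.exp (2 * (1 - v ^ 2)) * (1 + |v|) ^ 12) *
          ((N : ℝ) ^ 12 * (N : ℝ) ^ (-1 + ε)) := by ring
      _ ≤ C * 2 ^ 26 * Real.exp 20 * (N : ℝ) ^ (11 + ε) := by
          have e1 : (N : ℝ) ^ 12 * (N : ℝ) ^ (-1 + ε) = (N : ℝ) ^ (11 + ε) := by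
            rw [← rpow_natCast, ← rpow_add hN0]; congr 1; push_cast; ring
          rw [e1]
          gcongr
          · norm_num
          · norm_num
          · exact exp_mul_pow_le v
      _ = _ := by rw [hD]
  have key := integral_norm_sq_le_of_strip hFd hK (by linarith : (N : ℝ) ≤ N + N)
    (Real.sqrt_nonneg _) (Real.sqrt_nonneg _) hl hr
  refine key.trans_eq ?_
  rw [← Real.sqrt_mul (by positivity)]
  have : D * (N : ℝ) ^ (11 + ε) * (D * (N : ℝ) ^ (7 + ε)) = (D * (N : ℝ) ^ (9 + ε)) ^ 2 := by
    have : (N : ℝ) ^ (11 + ε) * (N : ℝ) ^ (7 + ε) = (N : ℝ) ^ (9 + ε) * (N : ℝ) ^ (9 + ε) := by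
      rw [← rpow_add hN0, ← rpow_add hN0]; congr 1; ring
    linear_combination D ^ 2 * this
  rw [this, Real.sqrt_sq (by positivity)]

lemma differentiableAt_riemannZeta_line {σ : ℝ} (hσ : σ ≠ 1) (t : ℝ) :
    DifferentiableAt ℂ riemannZeta (σ + t * Complex.I) := by
  refine differentiableAt_riemannZeta fun h => hσ ?_
  simpa using congrArg Complex.re h

lemma continuous_riemannZeta_line {σ : ℝ} (hσ : σ ≠ 1) :
    Continuous fun t : ℝ => riemannZeta (σ + t * Complex.I) :=
  continuous_iff_continuousAt.2 fun t =>
    (differentiableAt_riemannZeta_line hσ t).continuousAt.comp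
      (f := fun t : ℝ => (σ : ℂ) + t * Complex.I) (by fun_prop)

lemma norm_riemannZeta_half_pow_four_le (N : ℕ) {t : ℝ} (hN : 1 ≤ N) (ht : (N : ℝ) ≤ t) :
    ‖riemannZeta (((1 / 2 : ℝ) : ℂ) + t * Complex.I)‖ ^ 4 ≤
      3 * (((N : ℝ) ^ 8)⁻¹ * ‖(((1 / 2 : ℝ) : ℂ) + t * Complex.I) ^ 2 *
        zetaSqRem N (((1 / 2 : ℝ) : ℂ) + t * Complex.I)‖ ^ 2 +
        ‖LSeries (dTrunc N) (((1 / 2 : ℝ) : ℂ) + t * Complex.I)‖ ^ 2 +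
        ‖LSeries (dTrunc N) (((1 / 2 : ℝ) : ℂ) + (-t : ℝ) * Complex.I)‖ ^ 2) := by
  have hN1 : (1 : ℝ) ≤ N := by exact_mod_cast hN
  set s : ℂ := ((1 / 2 : ℝ) : ℂ) + t * Complex.I with hs
  have e0 : ((1 / 2 : ℝ) : ℂ) + (-t : ℝ) * Complex.I = 1 - s := by
    simp only [hs]; push_cast; ring
  have hne : s ≠ 1 := by
    intro h
    have := congrArg Complex.re h
    norm_num [hs] at this
  rw [e0]
  set r := 1 / 4 + t ^ 2 with hr
  have hr1 : (N : ℝ) ^ 2 ≤ r := by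
    have : (N : ℝ) ^ 2 ≤ t ^ 2 := by gcongr
    linarith
  have hr0 : 0 < r := by positivity
  have n1 : ‖s‖ ^ 2 = r := by
    rw [← Complex.normSq_eq_norm_sq, Complex.normSq_apply]; simp [hs, hr]; ring
  have n2 : ‖s - 1‖ ^ 2 = r := by
    rw [← Complex.normSq_eq_norm_sq, Complex.normSq_apply]; simp [hs, hr]; ring
  have n3 : ‖zetaFactor s‖ ^ 2 = r := norm_zetaFactor_half t
  have a2 : riemannZeta₁ s = (s - 1) * riemannZeta s := by
    rw [riemannZeta_eq_inv_sub_mul (s := s) hne, mul_inv_cancel_left₀ (sub_ne_zero.2 hne)]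
  have a3 : (s - 1) ^ 2 * riemannZeta s ^ 2 = zetaSqRem N s + (s - 1) ^ 2 * LSeries (dTrunc N) s +
      zetaFactor s ^ 2 * LSeries (dTrunc N) (1 - s) := by
    rw [zetaSqRem, a2]; ring
  set p := ‖zetaSqRem N s‖
  set d := ‖LSeries (dTrunc N) s‖
  set e := ‖LSeries (dTrunc N) (1 - s)‖
  have a4 : r * ‖riemannZeta s‖ ^ 2 ≤ p + r * d + r * e := by
    have := congrArg norm a3
    rw [norm_mul, norm_pow, norm_pow, n2] at this
    rw [this]
    refine (norm_add₃_le).trans_eq ?_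
    rw [norm_mul, norm_mul, norm_pow, norm_pow, n2, n3]
  have a5 : ‖riemannZeta s‖ ^ 2 ≤ r⁻¹ * p + d + e := by
    rw [← mul_le_mul_iff_right₀ hr0]
    refine a4.trans_eq ?_
    field_simp
  have a6 : (r⁻¹ * p) ^ 2 ≤ ((N : ℝ) ^ 8)⁻¹ * ‖s ^ 2 * zetaSqRem N s‖ ^ 2 := by
    rw [norm_mul, norm_pow, n1]
    have : (r⁻¹ * p) ^ 2 = ((r ^ 4)⁻¹) * (r * p) ^ 2 := by field_simp
    rw [this]
    gcongr
    calc (N : ℝ) ^ 8 = ((N : ℝ) ^ 2) ^ 4 := by ring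
      _ ≤ r ^ 4 := by gcongr
  calc ‖riemannZeta s‖ ^ 4 = (‖riemannZeta s‖ ^ 2) ^ 2 := by ring
    _ ≤ (r⁻¹ * p + d + e) ^ 2 := by gcongr
    _ ≤ 3 * ((r⁻¹ * p) ^ 2 + d ^ 2 + e ^ 2) := by
        nlinarith [sq_nonneg (r⁻¹ * p - d), sq_nonneg (d - e), sq_nonneg (r⁻¹ * p - e)]
    _ ≤ _ := by gcongr

/-- Fourth moment of the zeta-function on the critical line. -/
theorem integral_norm_riemannZeta_half_pow_four_le {ε : ℝ} (hε : 0 < ε) (hε1 : ε ≤ 1) :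
    ∃ C : ℝ, 0 < C ∧ ∀ N : ℕ, 1 ≤ N →
    ∫ t in (N : ℝ)..N + N, ‖riemannZeta (((1 / 2 : ℝ) : ℂ) + t * Complex.I)‖ ^ 4 ≤
      C * (N : ℝ) ^ (1 + ε) := by
  obtain ⟨C₁, hC₁, h₁⟩ := integral_norm_sq_zetaSqRem_half_le hε hε1
  obtain ⟨C₂, hC₂, h₂⟩ := integral_norm_sq_dTrunc_le (σ := 1 / 2) le_rfl hε
  refine ⟨3 * (C₁ + C₂ + C₂), by positivity, fun N hN => ?_⟩
  have hN1 : (1 : ℝ) ≤ N := by exact_mod_cast hN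
  set f : ℝ → ℝ := fun t => ‖(((1 / 2 : ℝ) : ℂ) + t * Complex.I) ^ 2 *
        zetaSqRem N (((1 / 2 : ℝ) : ℂ) + t * Complex.I)‖ ^ 2 with hf
  set g : ℝ → ℝ := fun t => ‖LSeries (dTrunc N) (((1 / 2 : ℝ) : ℂ) + t * Complex.I)‖ ^ 2 with hg
  have hfc : Continuous f := by
    refine ((Continuous.mul (by fun_prop) ?_).norm.pow 2)
    exact continuous_comp_line (differentiableOn_zetaSqRem N) (by norm_num)
  have hgc : Continuous g :=
    ((differentiable_LSeries_dTrunc N).continuous.comp (by fun_prop)).norm.pow 2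
  calc _ ≤ ∫ t in (N : ℝ)..N + N, 3 * (((N : ℝ) ^ 8)⁻¹ * f t + g t + g (-t)) := by
        refine intervalIntegral.integral_mono_on (by linarith) ?_ ?_ fun t ht =>
          norm_riemannZeta_half_pow_four_le N hN ht.1
        · exact ((continuous_riemannZeta_line (by norm_num)).norm.pow 4).intervalIntegrable _ _
        · apply Continuous.intervalIntegrable; fun_prop
    _ = 3 * (((N : ℝ) ^ 8)⁻¹ * (∫ t in (N : ℝ)..N + N, f t) + (∫ t in (N : ℝ)..N + N, g t) +
          ∫ t in (-(2 * N : ℝ))..-(2 * N) + N, g t) := by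
        rw [intervalIntegral.integral_const_mul, intervalIntegral.integral_add,
          intervalIntegral.integral_add, intervalIntegral.integral_const_mul,
          intervalIntegral.integral_comp_neg]
        · congr 4 <;> ring
        all_goals apply Continuous.intervalIntegrable; fun_prop
    _ ≤ 3 * (((N : ℝ) ^ 8)⁻¹ * (C₁ * (N : ℝ) ^ (9 + ε)) +
          C₂ * (N : ℝ) ^ (2 - 2 * (1 / 2) + ε) + C₂ * (N : ℝ) ^ (2 - 2 * (1 / 2) + ε)) := by
        gcongr
        · exact h₁ N hN
        · exact h₂ N hN N
        · exact h₂ N hN _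
    _ = _ := by
        have e1 : (N : ℝ) ^ (9 + ε) = (N : ℝ) ^ 8 * (N : ℝ) ^ (1 + ε) := by
          rw [← rpow_natCast, ← rpow_add (by linarith)]; congr 1; push_cast; ring
        have e2 : (2 - 2 * (1 / 2) + ε : ℝ) = 1 + ε := by ring
        have e3 : (N : ℝ) ^ 8 ≠ 0 := by positivity
        rw [e1, e2]
        field_simp

/-- The indicator function of the dyadic interval starting at `2 ^ j`. -/
noncomputable def dyadInd (j : ℕ) : ArithmeticFunction ℂ where
  toFun n := if n ∈ Finset.Ico (2 ^ j) (2 ^ j + 2 ^ j) then 1 else 0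
  map_zero' := by simp

lemma dyadInd_apply (j n : ℕ) :
    dyadInd j n = if n ∈ Finset.Ico (2 ^ j) (2 ^ j + 2 ^ j) then 1 else 0 := rfl

lemma LSeriesHasSum_dyadInd (j : ℕ) (s : ℂ) : LSeriesHasSum (dyadInd j) s (dyad j s) := by
  have h := hasSum_sum_of_ne_finset_zero (L := SummationFilter.unconditional ℕ) (f := LSeries.term (dyadInd j) s)
    (s := Finset.Ico (2 ^ j) (2 ^ j + 2 ^ j)) (fun n hn => by
      rw [LSeries.term_def, dyadInd_apply, if_neg hn]; simp)
  have e : ∑ n ∈ Finset.Ico (2 ^ j) (2 ^ j + 2 ^ j), LSeries.term (dyadInd j) s n = dyad j s := by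
    rw [Finset.sum_Ico_eq_sum_range, add_tsub_cancel_left, dyad]
    refine Finset.sum_congr rfl fun n hn => ?_
    have hn' := Finset.mem_range.1 hn
    have h0 : 2 ^ j + n ≠ 0 := by positivity
    rw [LSeries.term_of_ne_zero h0, dyadInd_apply, if_pos (by simp; omega), Complex.cpow_neg,
      one_div]
  rwa [e] at h

lemma integral_norm_dyad_pow_le {σ : ℝ} (hσ : 0.959085 ≤ σ) (hσ1 : σ < 1) (k : ℕ) :
    ∃ C : ℝ, 0 < C ∧ ∀ N j : ℕ, 1 ≤ N → (N : ℝ) ≤ ((2 : ℝ) ^ j) ^ k →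
      ((2 : ℝ) ^ j) ^ k ≤ 16 * (N : ℝ) ^ 4 →
      ∫ t in (N : ℝ)..N + N, ‖dyad j (σ + t * Complex.I)‖ ^ (2 * k) ≤ C * (N : ℝ) ^ (0.33 : ℝ) := by
  obtain ⟨C₁, hC₁, h₁⟩ := integral_norm_sq_LSeries_le_of_le (ε := 1 / 10000) (by norm_num)
  obtain ⟨C₂, hC₂, h₂⟩ := exists_dk_le k (ε := 1 / 10000) (by norm_num)
  refine ⟨C₁ * (2 * C₂ ^ 2 * (2 ^ k * 16) ^ (2 - 2 * σ + 4 / 10000 : ℝ)), by positivity,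
    fun N j hN hl hu => ?_⟩
  have hN1 : (1 : ℝ) ≤ N := by exact_mod_cast hN
  have hsum : ∀ s, LSeriesHasSum (dyadInd j ^ k : ArithmeticFunction ℂ) s (dyad j s ^ k) := by
    intro s
    have := LSeriesHasSum_pow (LSeriesHasSum_dyadInd j s).LSeriesSummable k
    rwa [(LSeriesHasSum_dyadInd j s).LSeries_eq] at this
  have hb : ∀ n, ‖dyadInd j n‖ ≤ 1 := by
    intro n; rw [dyadInd_apply]; split_ifs <;> simp
  have hm : ∀ n, dyadInd j n ≠ 0 → 2 ^ j ≤ n ∧ n ≤ 2 * 2 ^ j := by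
    intro n hn
    rw [dyadInd_apply] at hn
    have : n ∈ Finset.Ico (2 ^ j) (2 ^ j + 2 ^ j) := by by_contra h; simp [h] at hn
    have := Finset.mem_Ico.1 this
    omega
  have key := h₁ (dyadInd j ^ k : ArithmeticFunction ℂ) σ N (N + N)
    (2 * C₂ ^ 2 * (2 ^ k * 16 * (N : ℝ) ^ 4) ^ (2 - 2 * σ + 4 / 10000 : ℝ)) (by linarith)
    (hsum σ).LSeriesSummable (by
      intro n hn
      have hn1 : (1 : ℝ) ≤ n := by exact_mod_cast Nat.one_le_iff_ne_zero.2 hn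
      have hn0 : (0 : ℝ) < n := by linarith
      by_cases h0 : (dyadInd j ^ k : ArithmeticFunction ℂ) n = 0
      · rw [h0]
        simp only [norm_zero, ne_eq, OfNat.ofNat_ne_zero, not_false_eq_true, zero_pow, zero_mul,
          mul_zero]
        positivity
      obtain ⟨i1, i2⟩ := mem_Icc_of_arithmeticFunction_pow_ne_zero hm k n h0
      have i1' : ((2 : ℝ) ^ j) ^ k ≤ n := by exact_mod_cast i1
      have i2' : (n : ℝ) ≤ (2 * (2 : ℝ) ^ j) ^ k := by exact_mod_cast i2
      have i3 : (n : ℝ) ≤ 2 ^ k * 16 * (N : ℝ) ^ 4 := by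
        refine i2'.trans ?_
        rw [mul_pow, mul_assoc]
        gcongr
      have c1 : ‖(dyadInd j ^ k : ArithmeticFunction ℂ) n‖ ≤ C₂ * (n : ℝ) ^ (1 / 10000 : ℝ) :=
        (norm_arithmeticFunction_pow_le hb k n).trans (h₂ n hn)
      have c2 : (N + N - N : ℝ) ≤ (n : ℝ) ^ (1 + 1 / 10000 : ℝ) := by
        calc (N + N - N : ℝ) = N := by ring
          _ ≤ (n : ℝ) ^ (1 : ℝ) := by rw [rpow_one]; linarith
          _ ≤ _ := rpow_le_rpow_of_exponent_le hn1 (by norm_num)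
      calc _ ≤ ((n : ℝ) ^ (1 + 1 / 10000 : ℝ) + (n : ℝ) ^ (1 + 1 / 10000 : ℝ)) *
            ((C₂ * (n : ℝ) ^ (1 / 10000 : ℝ)) ^ 2 * (n : ℝ) ^ (-2 * σ)) := by gcongr
        _ = 2 * C₂ ^ 2 * (n : ℝ) ^ (2 - 2 * σ + 4 / 10000 : ℝ) *
            (n : ℝ) ^ (-(1 + 1 / 10000) : ℝ) := by
          have e : (n : ℝ) ^ (2 - 2 * σ + 4 / 10000 : ℝ) * (n : ℝ) ^ (-(1 + 1 / 10000) : ℝ) =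
              (n : ℝ) ^ (1 + 1 / 10000 : ℝ) * (((n : ℝ) ^ (1 / 10000 : ℝ)) ^ 2 *
                (n : ℝ) ^ (-2 * σ)) := by
            rw [← rpow_natCast, ← rpow_mul hn0.le, ← rpow_add hn0, ← rpow_add hn0, ← rpow_add hn0]
            congr 1; push_cast; ring
          rw [mul_assoc (2 * C₂ ^ 2), e]; ring
        _ ≤ _ := by
          gcongr
          linarith)
  calc ∫ t in (N : ℝ)..N + N, ‖dyad j (σ + t * Complex.I)‖ ^ (2 * k)
      = ∫ t in (N : ℝ)..N + N,
          ‖LSeries (dyadInd j ^ k : ArithmeticFunction ℂ) (σ + t * Complex.I)‖ ^ 2 := by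
        congr 1; ext t
        rw [(hsum _).LSeries_eq, norm_pow, ← pow_mul, mul_comm 2 k]
    _ ≤ _ := key
    _ ≤ C₁ * (2 * C₂ ^ 2 * ((2 ^ k * 16) ^ (2 - 2 * σ + 4 / 10000 : ℝ) *
          (N : ℝ) ^ (0.33 : ℝ))) := by
        rw [mul_rpow (by positivity) (by positivity)]
        gcongr
        rw [← rpow_natCast, ← rpow_mul (by linarith)]
        refine rpow_le_rpow_of_exponent_le hN1 ?_
        push_cast
        norm_num at hσ ⊢
        linarith
    _ = _ := by ring

lemma continuous_dyad_line (j : ℕ) (σ : ℝ) : Continuous fun t : ℝ => dyad j (σ + t * Complex.I) := by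
  unfold dyad
  refine continuous_finsetSum _ fun n _ => ?_
  refine Continuous.const_cpow (by fun_prop) (Or.inl ?_)
  exact_mod_cast (by positivity : 2 ^ j + n ≠ 0)

lemma exists_norm_riemannZeta_half_le : ∃ C : ℝ, 0 < C ∧ ∀ t : ℝ, 1 ≤ t →
    ‖riemannZeta (((1 / 2 : ℝ) : ℂ) + t * Complex.I)‖ ≤ C * t ^ (1 / 6 + 1 / 10000 : ℝ) := by
  obtain ⟨C, hC, h⟩ := exists_log_mul_rpow_le (p := 1 / 6) (q := 1 / 6 + 1 / 10000) (A := 200)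
    (B := 1200) (by norm_num) (by norm_num) (by norm_num) (by norm_num)
  refine ⟨C, hC, fun t ht => le_trans ?_ (h t ht)⟩
  simpa using norm_riemannZeta_le_weyl (s := ((1 / 2 : ℝ) : ℂ) + t * Complex.I)
    (by simp) (by norm_num) (by simpa using ht)

lemma exists_pow_mem_Icc {η M : ℝ} {N : ℕ} (hη : 0 < η) (hN : 1 ≤ N) (hM : (N : ℝ) ^ η < M)
    (hM2 : M ≤ 2 * N) : ∃ k : ℕ, 4 ≤ k ∧ k ≤ 4 + ⌈1 / η⌉₊ ∧ (N : ℝ) ≤ M ^ k ∧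
      M ^ k ≤ 16 * (N : ℝ) ^ 4 := by
  classical
  have hN1 : (1 : ℝ) ≤ N := by exact_mod_cast hN
  have hM1 : 1 < M := (one_le_rpow hN1 hη.le).trans_lt hM
  have hP : ∃ k : ℕ, 4 ≤ k ∧ (N : ℝ) ≤ M ^ k := by
    obtain ⟨n, hn⟩ := pow_unbounded_of_one_lt (N : ℝ) hM1
    exact ⟨n + 4, by omega, hn.le.trans (pow_le_pow_right₀ hM1.le (by omega))⟩
  have hK : 4 ≤ 4 + ⌈1 / η⌉₊ ∧ (N : ℝ) ≤ M ^ (4 + ⌈1 / η⌉₊) := by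
    refine ⟨by omega, ?_⟩
    have e : (1 : ℝ) ≤ η * ⌈1 / η⌉₊ := by
      have := Nat.le_ceil (1 / η)
      rw [div_le_iff₀ hη] at this
      linarith
    calc (N : ℝ) = (N : ℝ) ^ (1 : ℝ) := (rpow_one _).symm
      _ ≤ (N : ℝ) ^ (η * ⌈1 / η⌉₊) := rpow_le_rpow_of_exponent_le hN1 e
      _ = ((N : ℝ) ^ η) ^ ⌈1 / η⌉₊ := by rw [rpow_mul (by linarith), rpow_natCast]
      _ ≤ M ^ ⌈1 / η⌉₊ := by gcongr
      _ ≤ _ := pow_le_pow_right₀ hM1.le (by omega)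
  obtain ⟨k1, k2⟩ := Nat.find_spec hP
  refine ⟨Nat.find hP, k1, Nat.find_min' hP hK, k2, ?_⟩
  rcases k1.eq_or_lt with h | h
  · rw [← h]
    calc M ^ 4 ≤ (2 * N) ^ 4 := by gcongr
      _ = _ := by ring
  · have h3 := Nat.find_min hP (m := Nat.find hP - 1) (by omega)
    have h4 : M ^ (Nat.find hP - 1) < N := by
      by_contra h5
      exact h3 ⟨by omega, not_lt.1 h5⟩
    calc M ^ (Nat.find hP) = M ^ (Nat.find hP - 1) * M := by
          rw [← pow_succ]; congr 1; omega
      _ ≤ N * (2 * N) := by gcongr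
      _ = 2 * (N : ℝ) ^ 2 := by ring
      _ ≤ 16 * (N : ℝ) ^ 4 := by
          have : (N : ℝ) ^ 2 ≤ (N : ℝ) ^ 4 := pow_le_pow_right₀ hN1 (by norm_num)
          have : 0 ≤ (N : ℝ) ^ 2 := by positivity
          linarith

lemma integral_zeta_pow_four_mul_dyad_le {σ ε : ℝ} (hσ : 0.959085 ≤ σ) (hσ1 : σ < 1) (hε : 0 < ε)
    (hε1 : ε ≤ 1) : ∃ C : ℝ, 0 < C ∧ ∀ N j : ℕ, 1 ≤ N → (2 : ℝ) ^ j ≤ 2 * N →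
      ∫ t in (N : ℝ)..N + N, ‖riemannZeta (((1 / 2 : ℝ) : ℂ) + t * Complex.I)‖ ^ 4 *
        ‖dyad j (σ + t * Complex.I)‖ ^ 8 ≤ C * (N : ℝ) ^ (1 + ε) := by
  obtain ⟨C₁, hC₁, h₁⟩ := integral_norm_riemannZeta_half_pow_four_le (ε := ε / 2) (by positivity)
    (by linarith)
  obtain ⟨C₂, hC₂, h₂⟩ := exists_norm_riemannZeta_half_le
  choose D hD h₃ using integral_norm_dyad_pow_le hσ hσ1
  set K := 4 + ⌈1 / (ε / 16)⌉₊ with hK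
  set S := ∑ k ∈ Finset.range (K + 1), D k with hS
  have hS0 : 0 ≤ S := Finset.sum_nonneg fun k _ => (hD k).le
  refine ⟨C₁ + 2 * C₂ ^ 4 * S, by positivity, fun N j hN hj => ?_⟩
  have hN1 : (1 : ℝ) ≤ N := by exact_mod_cast hN
  have hN0 : (0 : ℝ) < N := by linarith
  have hle : (N : ℝ) ≤ N + N := by linarith
  have hσ0 : 0 ≤ σ := by norm_num at hσ; linarith
  set z : ℝ → ℝ := fun t => ‖riemannZeta (((1 / 2 : ℝ) : ℂ) + t * Complex.I)‖ ^ 4 with hz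
  have hzc : Continuous z := (continuous_riemannZeta_line (by norm_num)).norm.pow 4
  have hAc := (continuous_dyad_line j σ).norm
  have hz0 : ∀ t, 0 ≤ z t := fun t => by positivity
  by_cases hM : (2 : ℝ) ^ j ≤ (N : ℝ) ^ (ε / 16)
  · have hA : ∀ t : ℝ, ‖dyad j (σ + t * Complex.I)‖ ^ 8 ≤ (N : ℝ) ^ (ε / 2) := by
      intro t
      have h1 : ‖dyad j (σ + t * Complex.I)‖ ≤ (2 : ℝ) ^ j := by
        have := norm_dyad_le_trivial j (s := σ + t * Complex.I) (by simpa using hσ0)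
        refine this.trans ?_
        calc _ ≤ ((2 : ℝ) ^ j) ^ (1 : ℝ) :=
              rpow_le_rpow_of_exponent_le (one_le_pow₀ (by norm_num)) (by simpa using hσ0)
          _ = _ := rpow_one _
      calc _ ≤ ((N : ℝ) ^ (ε / 16)) ^ 8 := by gcongr; exact h1.trans hM
        _ = _ := by rw [← rpow_natCast, ← rpow_mul hN0.le]; congr 1; push_cast; ring
    calc _ ≤ ∫ t in (N : ℝ)..N + N, z t * (N : ℝ) ^ (ε / 2) := by
          refine intervalIntegral.integral_mono_on hle ?_ ?_ fun t _ => ?_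
          · exact (hzc.mul (hAc.pow 8)).intervalIntegrable _ _
          · exact (hzc.mul continuous_const).intervalIntegrable _ _
          · exact mul_le_mul_of_nonneg_left (hA t) (hz0 t)
      _ ≤ (C₁ * (N : ℝ) ^ (1 + ε / 2)) * (N : ℝ) ^ (ε / 2) := by
          rw [intervalIntegral.integral_mul_const]
          gcongr
          exact h₁ N hN
      _ = C₁ * (N : ℝ) ^ (1 + ε) := by
          rw [mul_assoc, ← rpow_add hN0]; congr 2; ring
      _ ≤ _ := by
          gcongr
          have : 0 ≤ 2 * C₂ ^ 4 * S := by positivity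
          linarith
  · obtain ⟨k, k1, k2, k3, k4⟩ := exists_pow_mem_Icc (by positivity) hN (not_le.1 hM) hj
    have hzs : ∀ t ∈ Set.Icc (N : ℝ) (N + N), z t ≤ 2 * C₂ ^ 4 * (N : ℝ) ^ (0.67 : ℝ) := by
      intro t ht
      have ht1 : 1 ≤ t := hN1.trans ht.1
      calc z t ≤ (C₂ * t ^ (1 / 6 + 1 / 10000 : ℝ)) ^ 4 := by
            simp only [hz]; gcongr; exact h₂ t ht1
        _ = C₂ ^ 4 * t ^ ((1 / 6 + 1 / 10000) * 4 : ℝ) := by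
            rw [mul_pow, ← rpow_natCast (t ^ _), ← rpow_mul (by linarith)]; norm_cast
        _ ≤ C₂ ^ 4 * t ^ (0.67 : ℝ) := by
            gcongr
            norm_num
        _ ≤ C₂ ^ 4 * (2 * N) ^ (0.67 : ℝ) := by
            gcongr
            linarith [ht.2]
        _ ≤ C₂ ^ 4 * (2 * (N : ℝ) ^ (0.67 : ℝ)) := by
            rw [mul_rpow (by norm_num) hN0.le]
            gcongr
            calc (2 : ℝ) ^ (0.67 : ℝ) ≤ 2 ^ (1 : ℝ) :=
                  rpow_le_rpow_of_exponent_le (by norm_num) (by norm_num)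
              _ = 2 := rpow_one _
        _ = _ := by ring
    have hb : ∀ x : ℝ, 0 ≤ x → x ^ 8 ≤ 1 + x ^ (2 * k) := by
      intro x hx
      rcases le_total x 1 with h | h
      · have := pow_le_one₀ (n := 8) hx h
        have : 0 ≤ x ^ (2 * k) := by positivity
        linarith
      · have := pow_le_pow_right₀ h (by omega : 8 ≤ 2 * k)
        linarith
    have hDk : D k ≤ S := Finset.single_le_sum (f := D) (fun i _ => (hD i).le)
      (Finset.mem_range.2 (by omega))
    calc _ ≤ ∫ t in (N : ℝ)..N + N, (z t + 2 * C₂ ^ 4 * (N : ℝ) ^ (0.67 : ℝ) *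
            ‖dyad j (σ + t * Complex.I)‖ ^ (2 * k)) := by
          refine intervalIntegral.integral_mono_on hle ?_ ?_ fun t ht => ?_
          · exact (hzc.mul (hAc.pow 8)).intervalIntegrable _ _
          · exact (hzc.add (continuous_const.mul (hAc.pow _))).intervalIntegrable _ _
          · calc _ ≤ z t * (1 + ‖dyad j (σ + t * Complex.I)‖ ^ (2 * k)) :=
                  mul_le_mul_of_nonneg_left (hb _ (norm_nonneg _)) (hz0 t)
              _ = z t + z t * ‖dyad j (σ + t * Complex.I)‖ ^ (2 * k) := by ring
              _ ≤ _ := by gcongr; exact hzs t ht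
      _ ≤ C₁ * (N : ℝ) ^ (1 + ε / 2) + 2 * C₂ ^ 4 * (N : ℝ) ^ (0.67 : ℝ) *
            (S * (N : ℝ) ^ (0.33 : ℝ)) := by
          rw [intervalIntegral.integral_add (hzc.intervalIntegrable _ _)
            (by apply Continuous.intervalIntegrable; fun_prop),
            intervalIntegral.integral_const_mul]
          gcongr
          · exact h₁ N hN
          · refine (h₃ k N j hN k3 k4).trans ?_
            gcongr
      _ = C₁ * (N : ℝ) ^ (1 + ε / 2) + 2 * C₂ ^ 4 * S * (N : ℝ) ^ (1 : ℝ) := by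
          have : (N : ℝ) ^ (1 : ℝ) = (N : ℝ) ^ (0.67 : ℝ) * (N : ℝ) ^ (0.33 : ℝ) := by
            rw [← rpow_add hN0]; norm_num
          rw [this]; ring
      _ ≤ C₁ * (N : ℝ) ^ (1 + ε) + 2 * C₂ ^ 4 * S * (N : ℝ) ^ (1 + ε) := by
          gcongr
          · linarith
          · linarith
      _ = _ := by ring

lemma exists_add_two_le_rpow {δ : ℝ} (hδ : 0 < δ) : ∃ C : ℝ, 0 < C ∧ ∀ n N : ℕ, 1 ≤ N →
    (2 : ℝ) ^ n ≤ 2 * N → (n : ℝ) + 2 ≤ C * (N : ℝ) ^ δ := by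
  have hl : 0 < δ * Real.log 2 := by have := Real.log_pos one_lt_two; positivity
  refine ⟨2 ^ δ / (δ * Real.log 2) + 2, by positivity, fun n N hN h => ?_⟩
  have hN1 : (1 : ℝ) ≤ N := by exact_mod_cast hN
  have h1 : (1 : ℝ) ≤ (N : ℝ) ^ δ := one_le_rpow hN1 hδ.le
  have h2 : (n : ℝ) * (δ * Real.log 2) ≤ 2 ^ δ * (N : ℝ) ^ δ := by
    calc (n : ℝ) * (δ * Real.log 2) ≤ Real.exp ((n : ℝ) * (δ * Real.log 2)) := by
          have := Real.add_one_le_exp ((n : ℝ) * (δ * Real.log 2)); linarith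
      _ = ((2 : ℝ) ^ n) ^ δ := by
          rw [← rpow_natCast, ← rpow_mul (by norm_num), rpow_def_of_pos (by norm_num)]
          congr 1; ring
      _ ≤ (2 * N) ^ δ := by gcongr
      _ = _ := mul_rpow (by norm_num) (by linarith)
  have h3 : (n : ℝ) ≤ 2 ^ δ / (δ * Real.log 2) * (N : ℝ) ^ δ := by
    rw [div_mul_eq_mul_div, le_div_iff₀ hl]; exact h2
  linarith

theorem integral_zeta_pow_four_mul_zeta_pow_eight_le {σ ε : ℝ} (hσ : 0.959085 ≤ σ) (hσ1 : σ < 1)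
    (hε : 0 < ε) (hε1 : ε ≤ 1) : ∃ C : ℝ, 0 < C ∧ ∀ N : ℕ, 1 ≤ N →
      ∫ t in (N : ℝ)..N + N, ‖riemannZeta (((1 / 2 : ℝ) : ℂ) + t * Complex.I)‖ ^ 4 *
        ‖riemannZeta (σ + t * Complex.I)‖ ^ 8 ≤ C * (N : ℝ) ^ (1 + ε) := by
  obtain ⟨C₁, hC₁, h₁⟩ := integral_norm_riemannZeta_half_pow_four_le hε hε1
  obtain ⟨C₂, hC₂, h₂⟩ := integral_zeta_pow_four_mul_dyad_le (ε := ε / 2) hσ hσ1 (by positivity)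
    (by linarith)
  obtain ⟨C₃, hC₃, h₃⟩ := exists_add_two_le_rpow (δ := ε / 16) (by positivity)
  refine ⟨2 ^ 7 * (200 ^ 8 * C₁ + C₃ ^ 8 * C₂), by positivity, fun N hN => ?_⟩
  have hN1 : (1 : ℝ) ≤ N := by exact_mod_cast hN
  have hN0 : (0 : ℝ) < N := by linarith
  have hle : (N : ℝ) ≤ N + N := by linarith
  obtain ⟨n, hn1, hn2⟩ := exists_nat_pow_near (x := (2 * N : ℝ)) (by linarith) (one_lt_two (α := ℝ))
  set z : ℝ → ℝ := fun t => ‖riemannZeta (((1 / 2 : ℝ) : ℂ) + t * Complex.I)‖ ^ 4 with hz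
  have hzc : Continuous z := (continuous_riemannZeta_line (by norm_num)).norm.pow 4
  have hAc := fun j => (continuous_dyad_line j σ).norm
  have hz0 : ∀ t, 0 ≤ z t := fun t => by positivity
  have hpt : ∀ t ∈ Set.Icc (N : ℝ) (N + N), ‖riemannZeta (σ + t * Complex.I)‖ ^ 8 ≤
      2 ^ 7 * (200 ^ 8 + (n + 1) ^ 7 * ∑ j ∈ Finset.range (n + 1),
        ‖dyad j (σ + t * Complex.I)‖ ^ 8) := by
    intro t ht
    set s : ℂ := σ + t * Complex.I with hs
    have hre : s.re = σ := by simp [hs]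
    have him : s.im = t := by simp [hs]
    have a1 := norm_riemannZeta_sub_sum_dyad_le (s := s) (by rw [hre]; norm_num at hσ; linarith)
      (by rw [hre]; linarith) (by rw [him]; exact hN1.trans ht.1) (n + 1)
      (by rw [him]; linarith [ht.2]) (by rw [him, pow_succ]; linarith [ht.1])
    have a2 : ‖riemannZeta s‖ ≤ 200 + ∑ j ∈ Finset.range (n + 1), ‖dyad j s‖ := by
      have := norm_le_norm_add_norm_sub (∑ j ∈ Finset.range (n + 1), dyad j s) (riemannZeta s)
      rw [norm_sub_rev] at this
      have := norm_sum_le (Finset.range (n + 1)) (fun j => dyad j s)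
      linarith
    have a3 := pow_sum_div_card_le_sum_pow (s := Finset.range (n + 1)) (f := fun j => ‖dyad j s‖)
      (fun _ _ => norm_nonneg _) 7
    rw [Finset.card_range, div_le_iff₀ (by positivity)] at a3
    calc _ ≤ (200 + ∑ j ∈ Finset.range (n + 1), ‖dyad j s‖) ^ 8 := by gcongr
      _ ≤ 2 ^ 7 * (200 ^ 8 + (∑ j ∈ Finset.range (n + 1), ‖dyad j s‖) ^ 8) :=
          add_pow_le (by norm_num) (by positivity) 8
      _ ≤ _ := by
          gcongr
          refine a3.trans_eq ?_
          push_cast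
          ring
  have hsum : ∫ t in (N : ℝ)..N + N, ∑ j ∈ Finset.range (n + 1),
      z t * ‖dyad j (σ + t * Complex.I)‖ ^ 8 ≤ (n + 1) * (C₂ * (N : ℝ) ^ (1 + ε / 2)) := by
    rw [intervalIntegral.integral_finsetSum]
    · refine (Finset.sum_le_card_nsmul _ _ _ fun j hj => h₂ N j hN ?_).trans_eq ?_
      · refine le_trans ?_ hn1
        exact pow_le_pow_right₀ (by norm_num) (by have := Finset.mem_range.1 hj; omega)
      · rw [Finset.card_range, nsmul_eq_mul]; push_cast; ring
    · intro j _
      exact (hzc.mul ((hAc j).pow 8)).intervalIntegrable _ _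
  have hcs : Continuous fun t : ℝ => ∑ j ∈ Finset.range (n + 1),
      z t * ‖dyad j (σ + t * Complex.I)‖ ^ 8 :=
    continuous_finsetSum _ fun j _ => hzc.mul ((hAc j).pow 8)
  calc _ ≤ ∫ t in (N : ℝ)..N + N, 2 ^ 7 * (200 ^ 8 * z t + ((n : ℝ) + 1) ^ 7 *
          ∑ j ∈ Finset.range (n + 1), z t * ‖dyad j (σ + t * Complex.I)‖ ^ 8) := by
        refine intervalIntegral.integral_mono_on hle ?_ ?_ fun t ht => ?_
        · exact (hzc.mul ((continuous_riemannZeta_line hσ1.ne).norm.pow 8)).intervalIntegrable _ _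
        · apply Continuous.intervalIntegrable; fun_prop
        · refine (mul_le_mul_of_nonneg_left (hpt t ht) (hz0 t)).trans_eq ?_
          rw [← Finset.mul_sum]; ring
    _ ≤ 2 ^ 7 * (200 ^ 8 * (C₁ * (N : ℝ) ^ (1 + ε)) + ((n : ℝ) + 1) ^ 7 *
          ((n + 1) * (C₂ * (N : ℝ) ^ (1 + ε / 2)))) := by
        rw [intervalIntegral.integral_const_mul, intervalIntegral.integral_add
          (by apply Continuous.intervalIntegrable; fun_prop)
          (by apply Continuous.intervalIntegrable; fun_prop), intervalIntegral.integral_const_mul,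
          intervalIntegral.integral_const_mul]
        gcongr
        exact h₁ N hN
    _ = 2 ^ 7 * (200 ^ 8 * (C₁ * (N : ℝ) ^ (1 + ε)) + ((n : ℝ) + 1) ^ 8 *
          (C₂ * (N : ℝ) ^ (1 + ε / 2))) := by ring
    _ ≤ 2 ^ 7 * (200 ^ 8 * (C₁ * (N : ℝ) ^ (1 + ε)) + (C₃ * (N : ℝ) ^ (ε / 16)) ^ 8 *
          (C₂ * (N : ℝ) ^ (1 + ε / 2))) := by
        gcongr
        have := h₃ n N hN hn1
        linarith
    _ = _ := by
        have : (N : ℝ) ^ (1 + ε) = ((N : ℝ) ^ (ε / 16)) ^ 8 * (N : ℝ) ^ (1 + ε / 2) := by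
          rw [← rpow_natCast, ← rpow_mul hN0.le, ← rpow_add hN0]; congr 1; push_cast; ring
        rw [mul_pow, this]; ring

lemma integrableOn_Ioi_mul_rpow {g : ℝ → ℝ} (hg : Continuous g) (hg0 : ∀ t, 0 ≤ g t) {C θ : ℝ}
    (hθ : 0 < θ) (hC : 0 ≤ C)
    (h : ∀ N : ℕ, 1 ≤ N → ∫ t in (N : ℝ)..N + N, g t ≤ C * (N : ℝ) ^ (1 + θ / 2)) :
    MeasureTheory.IntegrableOn (fun t => g t * t ^ (-(1 + θ))) (Set.Ioi 1) := by
  have hcont : ∀ x y : ℝ, 0 < x → ContinuousOn (fun t => g t * t ^ (-(1 + θ))) (Set.Icc x y) :=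
    fun x y hx => hg.continuousOn.mul fun t ht =>
      (continuousAt_rpow_const _ _ (Or.inl (hx.trans_le ht.1).ne')).continuousWithinAt
  have hii : ∀ x y : ℝ, 0 < x → x ≤ y → IntervalIntegrable (fun t => g t * t ^ (-(1 + θ)))
      MeasureTheory.volume x y := fun x y hx hxy =>
    (hcont x y hx).intervalIntegrable_of_Icc hxy
  set q : ℝ := 2 ^ (-(θ / 2)) with hq
  have hq0 : 0 < q := by positivity
  have hq1 : q < 1 := rpow_lt_one_of_one_lt_of_neg one_lt_two (by linarith)
  have hblock : ∀ m : ℕ, ∫ t in ((2 : ℝ) ^ m)..2 ^ (m + 1), g t * t ^ (-(1 + θ)) ≤ C * q ^ m := by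
    intro m
    have h2 : (0 : ℝ) < 2 ^ m := by positivity
    have h3 := h (2 ^ m) Nat.one_le_two_pow
    push_cast at h3
    have e : (2 : ℝ) ^ (m + 1) = 2 ^ m + 2 ^ m := by ring
    rw [e]
    calc _ ≤ ∫ t in ((2 : ℝ) ^ m)..2 ^ m + 2 ^ m, g t * ((2 : ℝ) ^ m) ^ (-(1 + θ)) := by
          refine intervalIntegral.integral_mono_on (by linarith) (hii _ _ h2 (by linarith)) ?_
            fun t ht => ?_
          · exact (hg.mul continuous_const).intervalIntegrable _ _
          · exact mul_le_mul_of_nonneg_left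
              (rpow_le_rpow_of_nonpos h2 ht.1 (by linarith)) (hg0 t)
      _ ≤ C * ((2 : ℝ) ^ m) ^ (1 + θ / 2) * ((2 : ℝ) ^ m) ^ (-(1 + θ)) := by
          rw [intervalIntegral.integral_mul_const]
          gcongr
      _ = _ := by
          rw [mul_assoc, ← rpow_add h2, hq, ← rpow_natCast, ← rpow_natCast, ← rpow_mul (by norm_num),
            ← rpow_mul (by norm_num)]
          congr 2; ring
  refine MeasureTheory.integrableOn_Ioi_of_intervalIntegral_norm_bounded (l := Filter.atTop)
    (b := fun m : ℕ => (2 : ℝ) ^ m) (C * (1 - q)⁻¹) 1 (fun m => ?_)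
    (tendsto_pow_atTop_atTop_of_one_lt one_lt_two) (Filter.Eventually.of_forall fun m => ?_)
  · exact (hii 1 _ one_pos (one_le_pow₀ one_le_two)).1
  · have e1 : ∫ t in (1 : ℝ)..2 ^ m, ‖g t * t ^ (-(1 + θ))‖ =
        ∫ t in (1 : ℝ)..2 ^ m, g t * t ^ (-(1 + θ)) := by
      refine intervalIntegral.integral_congr fun t ht => ?_
      rw [Set.uIcc_of_le (one_le_pow₀ one_le_two)] at ht
      have : 0 ≤ t := by linarith [ht.1]
      exact norm_of_nonneg (mul_nonneg (hg0 t) (rpow_nonneg this _))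
    have e2 := intervalIntegral.sum_integral_adjacent_intervals (a := fun m : ℕ => (2 : ℝ) ^ m)
      (f := fun t => g t * t ^ (-(1 + θ))) (n := m) (μ := MeasureTheory.volume)
      (fun k _ => hii _ _ (by positivity) (pow_le_pow_right₀ one_le_two (by omega)))
    rw [pow_zero] at e2
    rw [e1, ← e2]
    calc _ ≤ ∑ k ∈ Finset.range m, C * q ^ k := Finset.sum_le_sum fun k _ => hblock k
      _ = C * ∑ k ∈ Finset.range m, q ^ k := by rw [Finset.mul_sum]
      _ ≤ C * (1 - q)⁻¹ := by
          gcongr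
          rw [← tsum_geometric_of_lt_one hq0.le hq1]
          exact (summable_geometric_of_lt_one hq0.le hq1).sum_le_tsum _ (fun i _ => by positivity)

lemma integrable_of_even_of_integrableOn_Ioi {f : ℝ → ℝ} (hf : Continuous f)
    (he : ∀ t, f (-t) = f t) (h : MeasureTheory.IntegrableOn f (Set.Ioi 1)) :
    MeasureTheory.Integrable f := by
  have h0 : MeasureTheory.IntegrableOn f (Set.Ici 0) := by
    have := (hf.continuousOn (s := Set.Icc 0 1)).integrableOn_Icc.union h
    rwa [Set.Icc_union_Ioi_eq_Ici zero_le_one] at this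
  have h1 : MeasureTheory.IntegrableOn f (Set.Iic 0) := by
    have e := (MeasureTheory.MeasurePreserving.integrableOn_comp_preimage
      (MeasureTheory.Measure.measurePreserving_neg (MeasureTheory.volume : MeasureTheory.Measure ℝ))
      (Homeomorph.neg ℝ).measurableEmbedding (f := f) (s := Set.Ici 0)).2 h0
    have e2 : f ∘ Neg.neg = f := funext he
    rw [e2] at e
    simpa using e
  have := h1.union h0
  rwa [Set.Iic_union_Ici, MeasureTheory.integrableOn_univ] at this

lemma norm_riemannZeta_line_neg (σ t : ℝ) :
    ‖riemannZeta (σ + (-t : ℝ) * Complex.I)‖ = ‖riemannZeta (σ + t * Complex.I)‖ := by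
  rw [← Complex.norm_conj (riemannZeta (σ + t * Complex.I)), ← riemannZeta_conj]
  congr 2
  simp

theorem integrable_zeta_pow_four_mul_zeta_pow {σ θ : ℝ} (hσ : 0.959085 ≤ σ) (hσ1 : σ < 1)
    (hθ : 0 < θ) {l : ℕ} (hl : l ≤ 8) : MeasureTheory.Integrable fun t : ℝ =>
      ‖riemannZeta (((1 / 2 : ℝ) : ℂ) + t * Complex.I)‖ ^ 4 *
        ‖riemannZeta (σ + t * Complex.I)‖ ^ l * (1 + |t|) ^ (-(1 + θ)) := by
  set θ' := min θ 2 with hθ'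
  have hθ0 : 0 < θ' := lt_min hθ two_pos
  have hθ1 : θ' / 2 ≤ 1 := by have := min_le_right θ 2; linarith
  obtain ⟨C₁, hC₁, h₁⟩ := integral_norm_riemannZeta_half_pow_four_le (half_pos hθ0) hθ1
  obtain ⟨C₂, hC₂, h₂⟩ := integral_zeta_pow_four_mul_zeta_pow_eight_le hσ hσ1 (half_pos hθ0) hθ1
  set z : ℝ → ℝ := fun t => ‖riemannZeta (((1 / 2 : ℝ) : ℂ) + t * Complex.I)‖ with hz
  set w : ℝ → ℝ := fun t => ‖riemannZeta (σ + t * Complex.I)‖ with hw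
  have hzc : Continuous z := (continuous_riemannZeta_line (by norm_num)).norm
  have hwc : Continuous w := (continuous_riemannZeta_line hσ1.ne).norm
  have hz0 : ∀ t, 0 ≤ z t := fun t => norm_nonneg _
  have hw0 : ∀ t, 0 ≤ w t := fun t => norm_nonneg _
  set g : ℝ → ℝ := fun t => z t ^ 4 + z t ^ 4 * w t ^ 8 with hg
  have hgc : Continuous g := by fun_prop
  have hg0 : ∀ t, 0 ≤ g t := fun t => by have := hz0 t; have := hw0 t; positivity
  have hI := integrableOn_Ioi_mul_rpow hgc hg0 (C := C₁ + C₂) hθ0 (by positivity) (fun N hN => by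
    simp only [hg]
    rw [intervalIntegral.integral_add (by apply Continuous.intervalIntegrable; fun_prop)
      (by apply Continuous.intervalIntegrable; fun_prop), add_mul]
    exact add_le_add (h₁ N hN) (h₂ N hN))
  have hc : Continuous fun t : ℝ => z t ^ 4 * w t ^ l * (1 + |t|) ^ (-(1 + θ)) := by
    refine Continuous.mul (by fun_prop) ?_
    refine Continuous.rpow_const (by fun_prop) fun t => Or.inl ?_
    positivity
  refine integrable_of_even_of_integrableOn_Ioi hc (fun t => ?_) ?_
  · rw [norm_riemannZeta_line_neg, norm_riemannZeta_line_neg, abs_neg]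
  · refine MeasureTheory.Integrable.mono' hI hc.aestronglyMeasurable.restrict ?_
    refine (MeasureTheory.ae_restrict_iff' measurableSet_Ioi).2 (Filter.Eventually.of_forall ?_)
    intro t ht
    have ht1 : 1 < t := ht
    have b1 := hz0 t
    have b2 := hw0 t
    rw [norm_of_nonneg (by positivity)]
    have b3 : w t ^ l ≤ 1 + w t ^ 8 := by
      rcases le_total (w t) 1 with h | h
      · have := pow_le_one₀ (n := l) b2 h
        have : 0 ≤ w t ^ 8 := by positivity
        linarith
      · have := pow_le_pow_right₀ h hl
        linarith
    have b4 : (1 + |t|) ^ (-(1 + θ)) ≤ t ^ (-(1 + θ')) := by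
      calc (1 + |t|) ^ (-(1 + θ)) ≤ t ^ (-(1 + θ)) :=
            rpow_le_rpow_of_nonpos (by linarith) (by have := le_abs_self t; linarith) (by linarith)
        _ ≤ _ := rpow_le_rpow_of_exponent_le ht1.le (by have := min_le_left θ 2; linarith)
    calc _ ≤ z t ^ 4 * (1 + w t ^ 8) * t ^ (-(1 + θ')) := by gcongr
      _ = _ := by simp only [hg]; ring

lemma exists_polar_part (n : ℕ) {U : Set ℂ} (hU : IsOpen U) {c : ℂ} (hc : c ∈ U) {g : ℂ → ℂ}
    (hg : DifferentiableOn ℂ g U) : ∃ A : ℕ → ℂ, ∃ h : ℂ → ℂ, DifferentiableOn ℂ h U ∧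
      ∀ s ∈ U, s ≠ c → g s / (s - c) ^ n = h s + ∑ k ∈ Finset.range n, A k / (s - c) ^ (k + 1) := by
  induction n generalizing g with
  | zero => exact ⟨fun _ => 0, g, hg, fun s _ _ => by simp⟩
  | succ n ih =>
    obtain ⟨A, h, hh, e⟩ := ih ((Complex.differentiableOn_dslope (hU.mem_nhds hc)).2 hg)
    refine ⟨fun k => if k = n then g c else A k, h, hh, fun s hs hsc => ?_⟩
    have h0 : s - c ≠ 0 := sub_ne_zero.2 hsc
    have e1 := sub_smul_dslope g c s
    rw [smul_eq_mul] at e1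
    have e2 : g s / (s - c) ^ (n + 1) = dslope g c s / (s - c) ^ n + g c / (s - c) ^ (n + 1) := by
      have : g s = g c + (s - c) * dslope g c s := by rw [e1]; ring
      rw [this]; field_simp; ring
    rw [e2, e s hs hsc, Finset.sum_range_succ, ← add_assoc]
    simp only [if_true]
    congr 2
    refine Finset.sum_congr rfl fun k hk => ?_
    rw [if_neg (Finset.mem_range.1 hk).ne]

lemma exists_two_polar_parts (m n : ℕ) {U : Set ℂ} (hU : IsOpen U) {c d : ℂ} (hc : c ∈ U)
    (hd : d ∈ U) (hcd : c ≠ d) {f : ℂ → ℂ} (hf : DifferentiableOn ℂ f U) :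
    ∃ A B : ℕ → ℂ, ∃ H : ℂ → ℂ, DifferentiableOn ℂ H U ∧ ∀ s ∈ U, s ≠ c → s ≠ d →
      H s = f s / ((s - c) ^ m * (s - d) ^ n) - ∑ k ∈ Finset.range m, A k / (s - c) ^ (k + 1) -
        ∑ k ∈ Finset.range n, B k / (s - d) ^ (k + 1) := by
  have hUc : IsOpen (U \ {c}) := hU.sdiff isClosed_singleton
  have hUd : IsOpen (U \ {d}) := hU.sdiff isClosed_singleton
  have hne : ∀ (e : ℂ) (j : ℕ), ∀ s ∈ U \ {e}, (s - e) ^ j ≠ 0 := fun e j s hs =>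
    pow_ne_zero _ (sub_ne_zero.2 hs.2)
  have hdp : ∀ (e : ℂ) (j : ℕ) (r : ℂ), DifferentiableOn ℂ (fun s => r / (s - e) ^ j) (U \ {e}) :=
    fun e j r => (differentiableOn_const r).div (by fun_prop) (hne e j)
  obtain ⟨A, h₁, hh₁, e₁⟩ := exists_polar_part m hUd (c := c) ⟨hc, hcd⟩
    (g := fun s => f s / (s - d) ^ n) ((hf.mono Set.sdiff_subset).div (by fun_prop) (hne d n))
  obtain ⟨B, h₂, hh₂, e₂⟩ := exists_polar_part n hUc (c := d) ⟨hd, hcd.symm⟩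
    (g := fun s => f s / (s - c) ^ m) ((hf.mono Set.sdiff_subset).div (by fun_prop) (hne c m))
  set P : ℂ → ℂ := fun s => ∑ k ∈ Finset.range m, A k / (s - c) ^ (k + 1) with hP
  set Q : ℂ → ℂ := fun s => ∑ k ∈ Finset.range n, B k / (s - d) ^ (k + 1) with hQ
  have hPd : DifferentiableOn ℂ P (U \ {c}) := DifferentiableOn.fun_sum fun k _ => hdp c _ _
  have hQd : DifferentiableOn ℂ Q (U \ {d}) := DifferentiableOn.fun_sum fun k _ => hdp d _ _
  set H : ℂ → ℂ := fun s => if s = d then h₂ s - P s else h₁ s - Q s with hH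
  have E₁ : ∀ s ∈ U \ {d}, H s = h₁ s - Q s := fun s hs => if_neg hs.2
  have E₂ : ∀ s ∈ U \ {c}, H s = h₂ s - P s := by
    intro s hs
    by_cases hsd : s = d
    · exact if_pos hsd
    · rw [E₁ s ⟨hs.1, hsd⟩]
      have a1 := e₁ s ⟨hs.1, hsd⟩ hs.2
      have a2 := e₂ s hs hsd
      rw [div_div] at a1 a2
      rw [mul_comm, a1] at a2
      simp only [hP, hQ]
      linear_combination a2
  refine ⟨A, B, H, fun s hs => ?_, fun s hs hsc hsd => ?_⟩
  · by_cases hsd : s = d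
    · have hsc : s ≠ c := fun h => hcd (h.symm.trans hsd)
      have : DifferentiableOn ℂ H (U \ {c}) := (hh₂.sub hPd).congr E₂
      exact ((this s ⟨hs, hsc⟩).differentiableAt (hUc.mem_nhds ⟨hs, hsc⟩)).differentiableWithinAt
    · have : DifferentiableOn ℂ H (U \ {d}) := (hh₁.sub hQd).congr E₁
      exact ((this s ⟨hs, hsd⟩).differentiableAt (hUd.mem_nhds ⟨hs, hsd⟩)).differentiableWithinAt
  · have a1 := e₁ s ⟨hs, hsd⟩ hsc
    rw [div_div, mul_comm] at a1
    rw [E₁ s ⟨hs, hsd⟩, a1]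
    simp only [hQ]
    ring

lemma isOpen_re_pos : IsOpen {s : ℂ | 0 < s.re} :=
  isOpen_lt continuous_const Complex.continuous_re

lemma exists_zeta_polar_parts (l : ℕ) {a : ℝ} (ha0 : 0 < a) (ha1 : a < 1) :
    ∃ A B : ℕ → ℂ, ∃ H : ℂ → ℂ, DifferentiableOn ℂ H {s | 0 < s.re} ∧
      ∀ s : ℂ, 0 < s.re → s ≠ 1 → s ≠ ((1 - a : ℝ) : ℂ) →
      H s = riemannZeta s ^ 4 * riemannZeta (s + a) ^ l / s -
        ∑ k ∈ Finset.range 4, A k / (s - 1) ^ (k + 1) -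
        ∑ k ∈ Finset.range l, B k / (s - ((1 - a : ℝ) : ℂ)) ^ (k + 1) := by
  have hz := differentiable_riemannZeta₁
  obtain ⟨A, B, H, hH, e⟩ := exists_two_polar_parts 4 l isOpen_re_pos (c := 1)
    (d := ((1 - a : ℝ) : ℂ)) (by simp) (by simpa using ha1) (by
      intro h
      have : (1 : ℝ) = 1 - a := by exact_mod_cast h
      linarith) (f := fun s => riemannZeta₁ s ^ 4 * riemannZeta₁ (s + a) ^ l / s) (by
      refine DifferentiableOn.div ?_ differentiableOn_id fun s hs h => ?_
      · exact Differentiable.differentiableOn (by fun_prop)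
      · have : s = 0 := h
        simp [this] at hs)
  refine ⟨A, B, H, hH, fun s hs h1 h2 => ?_⟩
  rw [e s hs h1 h2]
  congr 2
  have h3 : s + a ≠ 1 := by
    intro h
    apply h2
    push_cast
    linear_combination h
  have h4 : s - 1 ≠ 0 := sub_ne_zero.2 h1
  have h5 : s - ((1 - a : ℝ) : ℂ) ≠ 0 := sub_ne_zero.2 h2
  have h6 : s + a - 1 = s - ((1 - a : ℝ) : ℂ) := by push_cast; ring
  have h7 : s ≠ 0 := by rintro rfl; simp at hs
  rw [riemannZeta_eq_inv_sub_mul h1, riemannZeta_eq_inv_sub_mul h3, h6, mul_pow, mul_pow, inv_pow, inv_pow]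
  have h8 := pow_ne_zero l h5
  generalize (s - ((1 - a : ℝ) : ℂ)) ^ l = w at h8 ⊢
  field_simp

lemma dWeighted_nonneg (l : ℕ) (a : ℝ) (n : ℕ) : 0 ≤ dWeighted l a n :=
  Finset.sum_nonneg fun p _ => by positivity

lemma dWeighted_le (l : ℕ) {a : ℝ} (ha : 0 ≤ a) (n : ℕ) : dWeighted l a n ≤ dk (4 + l) n := by
  have e : (dk (4 + l) n : ℝ) = ∑ p ∈ n.divisorsAntidiagonal, (dk 4 p.1 : ℝ) * (dk l p.2 : ℝ) := by
    rw [dk, pow_add, ArithmeticFunction.mul_apply]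
    push_cast
    rfl
  rw [e, dWeighted]
  refine Finset.sum_le_sum fun p hp => mul_le_of_le_one_right (by positivity) ?_
  have h : 1 ≤ p.2 := Nat.one_le_iff_ne_zero.2 fun h0 => by
    have := Nat.mem_divisorsAntidiagonal.1 hp
    rw [h0, mul_zero] at this
    exact this.2 this.1.symm
  exact rpow_le_one_of_one_le_of_nonpos (by exact_mod_cast h) (by linarith)

lemma LSeriesHasSum_dWeighted (l : ℕ) {a : ℝ} (ha : 0 ≤ a) {s : ℂ} (hs : 1 < s.re) :
    LSeriesHasSum (fun n => (dWeighted l a n : ℂ)) s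
      (riemannZeta s ^ 4 * riemannZeta (s + a) ^ l) := by
  have h1 := LSeriesHasSum_dk 4 hs
  have h2 := LSeriesHasSum_dk l (s := s + a) (by simp; linarith)
  have h3 : LSeriesHasSum (fun n => (dk l n : ℂ) * ((n : ℝ) ^ (-a) : ℝ)) s
      (riemannZeta (s + a) ^ l) := by
    have e : LSeries.term (fun n => (dk l n : ℂ) * ((n : ℝ) ^ (-a) : ℝ)) s =
        LSeries.term (fun n => (dk l n : ℂ)) (s + a) := funext fun n => ?_
    · rwa [LSeriesHasSum, e]
    rcases eq_or_ne n 0 with rfl | hn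
    · simp
    · have hn' : (n : ℂ) ≠ 0 := by exact_mod_cast hn
      rw [LSeries.term_of_ne_zero hn, LSeries.term_of_ne_zero hn, Complex.ofReal_cpow (by positivity),
        Complex.cpow_add _ _ hn', Complex.ofReal_neg, Complex.cpow_neg, Complex.ofReal_natCast]
      field_simp
  have h4 := h1.convolution h3
  have e : LSeries.convolution (fun n => (dk 4 n : ℂ))
      (fun n => (dk l n : ℂ) * ((n : ℝ) ^ (-a) : ℝ)) = fun n => (dWeighted l a n : ℂ) := by
    rw [LSeries.convolution_def]
    funext n
    rw [dWeighted]
    push_cast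
    exact Finset.sum_congr rfl fun p _ => by ring
  rwa [e] at h4

lemma exists_sum_dWeighted_le (l : ℕ) {a : ℝ} (ha : 0 ≤ a) : ∃ C : ℝ, 0 < C ∧ ∀ x : ℝ, 1 ≤ x →
    ∑ n ∈ Finset.Icc 1 ⌊x⌋₊, dWeighted l a n ≤ C * x ^ (3 / 2 : ℝ) := by
  obtain ⟨C, hC1, hC⟩ := exists_dk_le (4 + l) (ε := 1 / 2) (by norm_num)
  refine ⟨C, by linarith, fun x hx => ?_⟩
  have hx0 : 0 ≤ x := by linarith
  calc _ ≤ ∑ n ∈ Finset.Icc 1 ⌊x⌋₊, C * x ^ (1 / 2 : ℝ) := by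
        refine Finset.sum_le_sum fun n hn => ?_
        obtain ⟨n1, n2⟩ := Finset.mem_Icc.1 hn
        refine (dWeighted_le l ha n).trans ((hC n (by omega)).trans ?_)
        have : (n : ℝ) ≤ x := (Nat.le_floor_iff hx0).1 n2
        gcongr
    _ = ⌊x⌋₊ * (C * x ^ (1 / 2 : ℝ)) := by
        rw [Finset.sum_const, Nat.card_Icc, nsmul_eq_mul, Nat.add_sub_cancel]
    _ ≤ x * (C * x ^ (1 / 2 : ℝ)) := by
        gcongr
        exact Nat.floor_le hx0
    _ = _ := by
        have : x ^ (3 / 2 : ℝ) = x * x ^ (1 / 2 : ℝ) := by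
          nth_rewrite 2 [← rpow_one x]
          rw [← rpow_add (by linarith)]; norm_num
        rw [this]; ring

lemma integral_sum_dWeighted (l : ℕ) {a : ℝ} (ha : 0 ≤ a) {s : ℂ} (hs : 3 / 2 < s.re) :
    ∫ t in Set.Ioi (1 : ℝ), ((∑ n ∈ Finset.Icc 1 ⌊t⌋₊, dWeighted l a n : ℝ) : ℂ) *
      (t : ℂ) ^ (-(s + 1)) = riemannZeta s ^ 4 * riemannZeta (s + a) ^ l / s := by
  have hs0 : s ≠ 0 := by rintro rfl; norm_num at hs
  obtain ⟨C, hC, h⟩ := exists_sum_dWeighted_le l ha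
  have hO : (fun n : ℕ => ∑ k ∈ Finset.Icc 1 n, dWeighted l a k) =O[Filter.atTop]
      fun n : ℕ => (n : ℝ) ^ (3 / 2 : ℝ) := by
    refine Asymptotics.IsBigO.of_bound C ?_
    filter_upwards [Filter.eventually_ge_atTop 1] with n hn
    have := h n (by exact_mod_cast hn)
    rw [Nat.floor_natCast] at this
    rwa [norm_of_nonneg (Finset.sum_nonneg fun k _ => dWeighted_nonneg l a k),
      norm_of_nonneg (by positivity)]
  have key := LSeries_eq_mul_integral_of_nonneg (dWeighted l a) (by norm_num) hs hO
    (dWeighted_nonneg l a)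
  rw [(LSeriesHasSum_dWeighted l ha (by linarith)).LSeries_eq] at key
  rw [key, mul_div_cancel_left₀ _ hs0]
  push_cast
  rfl

lemma exists_log_pow_le (k : ℕ) {η : ℝ} (hη : 0 < η) : ∃ C : ℝ, 0 < C ∧ ∀ x : ℝ, 1 ≤ x →
    Real.log x ^ k ≤ C * x ^ η := by
  have hk : (0 : ℝ) < k + 1 := by positivity
  refine ⟨((k + 1) / η) ^ k, by positivity, fun x hx => ?_⟩
  have hx0 : 0 ≤ x := by linarith
  have h1 := Real.log_le_rpow_div hx0 (ε := η / (k + 1)) (by positivity)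
  have h2 := Real.log_nonneg hx
  calc Real.log x ^ k ≤ (x ^ (η / (k + 1)) / (η / (k + 1))) ^ k := by gcongr
    _ = ((k + 1) / η) ^ k * x ^ (η / (k + 1) * k) := by
        rw [rpow_mul hx0, rpow_natCast, ← mul_pow]
        congr 1
        field_simp
    _ ≤ _ := by
        gcongr
        rw [div_mul_eq_mul_div, div_le_iff₀ hk]
        nlinarith

lemma integrableOn_log_pow_mul_cpow (k : ℕ) {w : ℂ} (hw : 0 < w.re) :
    MeasureTheory.IntegrableOn (fun x : ℝ => (Real.log x : ℂ) ^ k * (x : ℂ) ^ (-(w + 1)))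
      (Set.Ioi 1) := by
  obtain ⟨C, hC, h⟩ := exists_log_pow_le k (half_pos hw)
  have hI : MeasureTheory.IntegrableOn (fun x : ℝ => C * x ^ (-(w.re / 2) - 1)) (Set.Ioi 1) :=
    (integrableOn_Ioi_rpow_of_lt (by linarith) one_pos).const_mul C
  refine MeasureTheory.Integrable.mono' hI ?_ ?_
  · refine ContinuousOn.aestronglyMeasurable (fun x hx => ?_) measurableSet_Ioi
    have hx0 : 0 < x := one_pos.trans hx
    refine ContinuousAt.continuousWithinAt (ContinuousAt.mul ?_ ?_)
    · exact (Complex.continuous_ofReal.continuousAt.comp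
        (Real.continuousAt_log hx0.ne')).pow k
    · exact (hasDerivAt_ofReal_cpow hx0 _).continuousAt
  · refine (MeasureTheory.ae_restrict_iff' measurableSet_Ioi).2 (Filter.Eventually.of_forall ?_)
    intro x hx
    have hx1 : 1 < x := hx
    have hx0 : 0 < x := one_pos.trans hx
    rw [norm_mul, norm_pow, Complex.norm_real, norm_of_nonneg (Real.log_nonneg hx1.le),
      Complex.norm_cpow_eq_rpow_re_of_pos hx0]
    calc _ ≤ C * x ^ (w.re / 2) * x ^ (-(w + 1)).re := by gcongr; exact h x hx1.le
      _ = _ := by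
        rw [mul_assoc, ← rpow_add hx0]
        congr 2
        simp
        ring

lemma tendsto_log_pow_mul_cpow (k : ℕ) {w : ℂ} (hw : 0 < w.re) :
    Filter.Tendsto (fun x : ℝ => (Real.log x : ℂ) ^ k * (x : ℂ) ^ (-w)) Filter.atTop (nhds 0) := by
  obtain ⟨C, hC, h⟩ := exists_log_pow_le k (half_pos hw)
  refine squeeze_zero_norm' (a := fun x : ℝ => C * x ^ (-(w.re / 2))) ?_ ?_
  · filter_upwards [Filter.eventually_ge_atTop 1] with x hx1
    have hx0 : 0 < x := by linarith
    rw [norm_mul, norm_pow, Complex.norm_real, norm_of_nonneg (Real.log_nonneg hx1),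
      Complex.norm_cpow_eq_rpow_re_of_pos hx0]
    calc _ ≤ C * x ^ (w.re / 2) * x ^ (-w).re := by gcongr; exact h x hx1
      _ = _ := by
        rw [mul_assoc, ← rpow_add hx0]
        congr 2
        simp
        ring
  · simpa using (tendsto_rpow_neg_atTop (half_pos hw)).const_mul C

lemma integral_log_pow_mul_cpow (k : ℕ) {w : ℂ} (hw : 0 < w.re) :
    ∫ x in Set.Ioi (1 : ℝ), (Real.log x : ℂ) ^ k * (x : ℂ) ^ (-(w + 1)) =
      (k.factorial : ℂ) / w ^ (k + 1) := by
  have hw0 : w ≠ 0 := by rintro rfl; simp at hw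
  induction k with
  | zero =>
    simp only [pow_zero, one_mul, Nat.factorial_zero, Nat.cast_one, zero_add, pow_one]
    rw [integral_Ioi_cpow_of_lt (by simpa using hw) one_pos]
    simp
  | succ k ih =>
    have hd : ∀ x ∈ Set.Ioi (1 : ℝ), HasDerivAt
        (fun x : ℝ => (Real.log x : ℂ) ^ (k + 1) * (x : ℂ) ^ (-w))
        (((k : ℂ) + 1) * ((Real.log x : ℂ) ^ k * (x : ℂ) ^ (-(w + 1))) -
          w * ((Real.log x : ℂ) ^ (k + 1) * (x : ℂ) ^ (-(w + 1)))) x := by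
      intro x hx
      have hx0 : 0 < x := one_pos.trans hx
      have h1 := ((Real.hasDerivAt_log hx0.ne').ofReal_comp).pow (k + 1)
      have h2 := hasDerivAt_ofReal_cpow hx0 (-w)
      have hxc : (x : ℂ) ≠ 0 := by exact_mod_cast hx0.ne'
      have e : (x : ℂ) ^ (-w) = x * (x : ℂ) ^ (-(w + 1)) := by
        rw [show -w = -(w + 1) + 1 by ring, Complex.cpow_add _ _ hxc, Complex.cpow_one]; ring
      have e2 : (x : ℂ) ^ (-w - 1) = (x : ℂ) ^ (-(w + 1)) := by congr 1; ring
      refine (h1.mul h2).congr_deriv ?_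
      rw [e2, e]
      push_cast
      simp only [Pi.pow_apply]
      field_simp
      ring
    have hI := ((integrableOn_log_pow_mul_cpow k hw).const_mul ((k : ℂ) + 1)).sub
      ((integrableOn_log_pow_mul_cpow (k + 1) hw).const_mul w)
    have hc : ContinuousWithinAt (fun x : ℝ => (Real.log x : ℂ) ^ (k + 1) * (x : ℂ) ^ (-w))
        (Set.Ici 1) 1 := by
      refine ContinuousAt.continuousWithinAt (ContinuousAt.mul ?_ ?_)
      · exact (Complex.continuous_ofReal.continuousAt.comp
          (Real.continuousAt_log one_ne_zero)).pow _
      · exact (hasDerivAt_ofReal_cpow one_pos _).continuousAt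
    have key := MeasureTheory.integral_Ioi_of_hasDerivAt_of_tendsto hc hd hI
      (tendsto_log_pow_mul_cpow (k + 1) hw)
    rw [MeasureTheory.integral_sub ((integrableOn_log_pow_mul_cpow k hw).const_mul _)
      ((integrableOn_log_pow_mul_cpow (k + 1) hw).const_mul _),
      MeasureTheory.integral_const_mul, MeasureTheory.integral_const_mul, ih] at key
    simp only [Real.log_one, Complex.ofReal_zero, ne_eq, Nat.succ_ne_zero, not_false_eq_true,
      zero_pow, zero_mul, sub_zero] at key
    have h3 := (sub_eq_zero.1 key).symm
    rw [← mul_right_inj' hw0, h3, Nat.factorial_succ]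
    push_cast
    field_simp
    ring

lemma cpow_mul_log_pow_mul_cpow {x : ℝ} (hx : 0 < x) (β : ℝ) (k : ℕ) (s : ℂ) :
    ((x ^ β * Real.log x ^ k : ℝ) : ℂ) * (x : ℂ) ^ (-(s + 1)) =
      (Real.log x : ℂ) ^ k * (x : ℂ) ^ (-((s - β) + 1)) := by
  have hxc : (x : ℂ) ≠ 0 := by exact_mod_cast hx.ne'
  rw [show -((s - β) + 1) = -(s + 1) + (β : ℂ) by ring, Complex.cpow_add _ _ hxc, Complex.ofReal_mul,
    Complex.ofReal_cpow hx.le, Complex.ofReal_pow]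
  ring

lemma integrableOn_rpow_mul_log_pow {β : ℝ} (k : ℕ) {s : ℂ} (hs : β < s.re) :
    MeasureTheory.IntegrableOn (fun x : ℝ => ((x ^ β * Real.log x ^ k : ℝ) : ℂ) *
      (x : ℂ) ^ (-(s + 1))) (Set.Ioi 1) := by
  refine (integrableOn_log_pow_mul_cpow k (w := s - β) (by simpa using hs)).congr_fun
    (fun x hx => ?_) measurableSet_Ioi
  exact (cpow_mul_log_pow_mul_cpow (one_pos.trans hx) β k s).symm

lemma integral_rpow_mul_log_pow {β : ℝ} (k : ℕ) {s : ℂ} (hs : β < s.re) :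
    ∫ x in Set.Ioi (1 : ℝ), ((x ^ β * Real.log x ^ k : ℝ) : ℂ) * (x : ℂ) ^ (-(s + 1)) =
      (k.factorial : ℂ) / (s - β) ^ (k + 1) := by
  rw [← integral_log_pow_mul_cpow k (w := s - β) (by simpa using hs)]
  exact MeasureTheory.setIntegral_congr_fun measurableSet_Ioi fun x hx =>
    cpow_mul_log_pow_mul_cpow (one_pos.trans hx) β k s

lemma integral_indicator_cpow {u : ℝ} (hu : 1 < u) {s : ℂ} (hs : 0 < s.re) :
    ∫ x in Set.Ioi (1 : ℝ), (Set.Ioi u).indicator (fun x : ℝ => (x : ℂ) ^ (-(s + 2))) x =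
      (u : ℂ) ^ (-(s + 1)) / (s + 1) := by
  rw [MeasureTheory.setIntegral_indicator measurableSet_Ioi,
    Set.inter_eq_self_of_subset_right (Set.Ioi_subset_Ioi hu.le),
    integral_Ioi_cpow_of_lt (by simp; linarith) (one_pos.trans hu)]
  rw [show -(s + 2) + 1 = -(s + 1) by ring, div_neg, neg_div, neg_neg]

lemma integral_indicator_rpow {u : ℝ} (hu : 1 < u) {r : ℝ} (hr : 0 < r) :
    ∫ x in Set.Ioi (1 : ℝ), (Set.Ioi u).indicator (fun x : ℝ => x ^ (-(r + 2))) x =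
      u ^ (-(r + 1)) / (r + 1) := by
  rw [MeasureTheory.setIntegral_indicator measurableSet_Ioi,
    Set.inter_eq_self_of_subset_right (Set.Ioi_subset_Ioi hu.le),
    integral_Ioi_rpow_of_lt (by linarith) (one_pos.trans hu)]
  rw [show -(r + 2) + 1 = -(r + 1) by ring, div_neg, neg_div, neg_neg]

lemma integrable_prod_indicator_mul_cpow {E : ℝ → ℂ} (hE : Measurable E) {s : ℂ} (hs : 0 < s.re)
    (hI : MeasureTheory.IntegrableOn (fun u : ℝ => E u * (u : ℂ) ^ (-(s + 1))) (Set.Ioi 1)) :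
    MeasureTheory.Integrable (fun p : ℝ × ℝ => E p.1 *
      (Set.Ioi p.1).indicator (fun x : ℝ => (x : ℂ) ^ (-(s + 2))) p.2)
      ((MeasureTheory.volume.restrict (Set.Ioi 1)).prod
        (MeasureTheory.volume.restrict (Set.Ioi 1))) := by
  have hm : Measurable (fun p : ℝ × ℝ => E p.1 *
      (Set.Ioi p.1).indicator (fun x : ℝ => (x : ℂ) ^ (-(s + 2))) p.2) := by
    refine (hE.comp measurable_fst).mul ?_
    have h : (fun p : ℝ × ℝ => (Set.Ioi p.1).indicator (fun x : ℝ => (x : ℂ) ^ (-(s + 2))) p.2) =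
        {p : ℝ × ℝ | p.1 < p.2}.indicator (fun p => (p.2 : ℂ) ^ (-(s + 2))) := by
      ext p; simp [Set.indicator]
    rw [h]
    refine Measurable.indicator ?_ (measurableSet_lt measurable_fst measurable_snd)
    exact (Complex.measurable_ofReal.comp measurable_snd).pow_const _
  rw [MeasureTheory.integrable_prod_iff hm.aestronglyMeasurable]
  constructor
  · refine (MeasureTheory.ae_restrict_iff' measurableSet_Ioi).2 (Filter.Eventually.of_forall ?_)
    intro u hu
    have h : MeasureTheory.IntegrableOn (fun x : ℝ => (x : ℂ) ^ (-(s + 2))) (Set.Ioi 1) :=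
      integrableOn_Ioi_cpow_of_lt (by simp; linarith) one_pos
    exact (MeasureTheory.Integrable.indicator h measurableSet_Ioi).const_mul (E u)
  · refine MeasureTheory.IntegrableOn.congr_fun (hI.norm.mul_const ((s.re + 1)⁻¹)) ?_
      measurableSet_Ioi
    intro u hu
    have hu0 : 0 < u := one_pos.trans hu
    simp only [norm_mul, MeasureTheory.integral_const_mul]
    rw [Complex.norm_cpow_eq_rpow_re_of_pos hu0, mul_assoc, ← div_eq_mul_inv]
    rw [show (-(s + 1)).re = -(s.re + 1) by simp, ← integral_indicator_rpow hu hs]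
    congr 1
    refine MeasureTheory.setIntegral_congr_fun measurableSet_Ioi fun x hx => ?_
    simp only [norm_indicator_eq_indicator_norm]
    by_cases hxu : x ∈ Set.Ioi u
    · simp only [Set.indicator_of_mem hxu]
      rw [Complex.norm_cpow_eq_rpow_re_of_pos (one_pos.trans hx)]
      simp
    · simp only [Set.indicator_of_notMem hxu]

lemma integral_primitive_mul_cpow {E : ℝ → ℂ} (hE : Measurable E) {s : ℂ} (hs : 0 < s.re)
    (hI : MeasureTheory.IntegrableOn (fun u : ℝ => E u * (u : ℂ) ^ (-(s + 1))) (Set.Ioi 1)) :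
    MeasureTheory.IntegrableOn (fun x : ℝ => (∫ u in (1 : ℝ)..x, E u) * (x : ℂ) ^ (-(s + 2)))
      (Set.Ioi 1) ∧
    ∫ x in Set.Ioi (1 : ℝ), (∫ u in (1 : ℝ)..x, E u) * (x : ℂ) ^ (-(s + 2)) =
      (∫ u in Set.Ioi (1 : ℝ), E u * (u : ℂ) ^ (-(s + 1))) / (s + 1) := by
  have hP := integrable_prod_indicator_mul_cpow hE hs hI
  have hx : ∀ x ∈ Set.Ioi (1 : ℝ), ∫ u in Set.Ioi (1 : ℝ), E u *
      (Set.Ioi u).indicator (fun x : ℝ => (x : ℂ) ^ (-(s + 2))) x =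
      (∫ u in (1 : ℝ)..x, E u) * (x : ℂ) ^ (-(s + 2)) := by
    intro x hx
    have hx1 : (1 : ℝ) < x := hx
    have h : ∀ u : ℝ, E u * (Set.Ioi u).indicator (fun x : ℝ => (x : ℂ) ^ (-(s + 2))) x =
        (Set.Iio x).indicator (fun u => E u * (x : ℂ) ^ (-(s + 2))) u := by
      intro u; simp [Set.indicator]
    simp only [h]
    rw [MeasureTheory.setIntegral_indicator measurableSet_Iio, Set.Ioi_inter_Iio,
      MeasureTheory.integral_mul_const, intervalIntegral.integral_of_le hx1.le,
      MeasureTheory.integral_Ioc_eq_integral_Ioo]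
  constructor
  · exact MeasureTheory.IntegrableOn.congr_fun hP.integral_prod_right hx measurableSet_Ioi
  · rw [← MeasureTheory.setIntegral_congr_fun measurableSet_Ioi hx,
      ← MeasureTheory.integral_integral_swap hP, ← MeasureTheory.integral_div]
    refine MeasureTheory.setIntegral_congr_fun measurableSet_Ioi fun u hu => ?_
    simp only [MeasureTheory.integral_const_mul]
    rw [integral_indicator_cpow hu hs, mul_div_assoc]

lemma perron_primitive {E : ℝ → ℂ} (hE : Measurable E)
    (hloc : ∀ x : ℝ, 1 ≤ x → IntervalIntegrable E MeasureTheory.volume 1 x) {σ : ℝ} (hσ : 0 < σ)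
    (hI : ∀ t : ℝ, MeasureTheory.IntegrableOn
      (fun u : ℝ => E u * (u : ℂ) ^ (-((σ + t * Complex.I) + 1))) (Set.Ioi 1))
    {Φ : ℂ → ℂ} (hΦ : ∀ t : ℝ, ∫ u in Set.Ioi (1 : ℝ), E u *
      (u : ℂ) ^ (-((σ + t * Complex.I) + 1)) = Φ (σ + t * Complex.I))
    (hΦI : MeasureTheory.Integrable fun t : ℝ =>
      Φ (σ + t * Complex.I) / (σ + t * Complex.I + 1)) {x : ℝ} (hx : 1 < x) :
    ∫ u in (1 : ℝ)..x, E u = (1 / (2 * π) : ℝ) • ∫ t : ℝ, (x : ℂ) ^ (σ + t * Complex.I + 1) *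
      (Φ (σ + t * Complex.I) / (σ + t * Complex.I + 1)) := by
  set f : ℝ → ℂ := (Set.Ioi (1 : ℝ)).indicator (fun x => ∫ u in (1 : ℝ)..x, E u) with hf
  have hz : ∀ t : ℝ, (((-(σ + 1) : ℝ) : ℂ) + ((-t : ℝ) : ℂ) * Complex.I) - 1 =
      -((σ + t * Complex.I) + 2) := by
    intro t; push_cast; ring
  have hind : ∀ t : ℝ, (fun u : ℝ =>
      (u : ℂ) ^ ((((-(σ + 1) : ℝ) : ℂ) + ((-t : ℝ) : ℂ) * Complex.I) - 1) • f u) =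
      (Set.Ioi (1 : ℝ)).indicator (fun x => (∫ u in (1 : ℝ)..x, E u) *
        (x : ℂ) ^ (-((σ + t * Complex.I) + 2))) := by
    intro t
    ext u
    rw [hz t, hf]
    by_cases hu : u ∈ Set.Ioi (1 : ℝ)
    · simp only [Set.indicator_of_mem hu, smul_eq_mul, mul_comm]
    · simp only [Set.indicator_of_notMem hu, smul_zero]
  have hpr := fun t : ℝ => integral_primitive_mul_cpow hE (s := σ + t * Complex.I)
    (by simpa using hσ) (hI t)
  have hmel : ∀ t : ℝ, mellin f (((-(σ + 1) : ℝ) : ℂ) + ((-t : ℝ) : ℂ) * Complex.I) =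
      Φ (σ + t * Complex.I) / (σ + t * Complex.I + 1) := by
    intro t
    rw [mellin, hind t, MeasureTheory.setIntegral_indicator measurableSet_Ioi,
      Set.inter_eq_self_of_subset_right (Set.Ioi_subset_Ioi zero_le_one), (hpr t).2, hΦ t]
  have hconv : MellinConvergent f ((-(σ + 1) : ℝ) : ℂ) := by
    have h := hind 0
    simp only [neg_zero, Complex.ofReal_zero, zero_mul, add_zero] at h
    rw [MellinConvergent, h]
    have h2 := (hpr 0).1
    simp only [Complex.ofReal_zero, zero_mul, add_zero] at h2
    exact ((MeasureTheory.integrable_indicator_iff measurableSet_Ioi).2 h2).integrableOn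
  have hvert : Complex.VerticalIntegrable (mellin f) (-(σ + 1)) := by
    have h := hΦI.comp_neg
    refine h.congr (Filter.Eventually.of_forall fun t => ?_)
    have := hmel (-t)
    rw [neg_neg] at this
    exact this.symm
  have hcont : ContinuousAt f x := by
    have h1 := (intervalIntegral.continuousOn_primitive_interval'
      (hloc (x + 1) (by linarith)) Set.left_mem_uIcc).continuousAt (x := x) (by
        rw [Set.uIcc_of_le (by linarith)]
        exact Icc_mem_nhds hx (by linarith))
    refine h1.congr ?_
    filter_upwards [Ioi_mem_nhds hx] with u hu
    rw [hf, Set.indicator_of_mem hu]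
  have key := mellinInv_mellin_eq (-(σ + 1)) f (by linarith : 0 < x) hconv hvert hcont
  have hx2 : f x = ∫ u in (1 : ℝ)..x, E u := by
    rw [hf, Set.indicator_of_mem (show x ∈ Set.Ioi (1 : ℝ) from hx)]
  rw [← hx2, ← key, mellinInv, ← MeasureTheory.integral_neg_eq_self]
  congr 1
  refine MeasureTheory.integral_congr_ae (Filter.Eventually.of_forall fun t => ?_)
  simp only
  rw [hmel t, smul_eq_mul]
  congr 2
  push_cast
  ring

lemma integral_vertical_line_eq {Q : ℂ → ℂ} {α β : ℝ} (hαβ : α ≤ β)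
    (hQ : ∀ s : ℂ, α ≤ s.re → DifferentiableAt ℂ Q s)
    (hα : MeasureTheory.Integrable fun t : ℝ => Q (α + t * Complex.I))
    (hβ : MeasureTheory.Integrable fun t : ℝ => Q (β + t * Complex.I))
    {g : ℝ → ℝ} (hg : Filter.Tendsto g Filter.atTop (nhds 0))
    (hQg : ∀ σ ∈ Set.Icc α β, ∀ t : ℝ, 1 ≤ |t| → ‖Q (σ + t * Complex.I)‖ ≤ g |t|) :
    ∫ t : ℝ, Q (α + t * Complex.I) = ∫ t : ℝ, Q (β + t * Complex.I) := by
  have h1 : ∀ {r : ℝ}, (MeasureTheory.Integrable fun t : ℝ => Q (r + t * Complex.I)) →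
      Filter.Tendsto (fun T : ℝ => ∫ t in (-T)..T, Q (r + t * Complex.I)) Filter.atTop
        (nhds (∫ t : ℝ, Q (r + t * Complex.I))) := fun h =>
    MeasureTheory.intervalIntegral_tendsto_integral h Filter.tendsto_neg_atTop_atBot
      Filter.tendsto_id
  have h2 : ∀ t : ℝ, 1 ≤ |t| → ‖∫ x : ℝ in α..β, Q (x + t * Complex.I)‖ ≤ g |t| * |β - α| := by
    intro t ht
    refine intervalIntegral.norm_integral_le_of_norm_le_const fun x hx => ?_
    rw [Set.uIoc_of_le hαβ] at hx
    exact hQg x ⟨hx.1.le, hx.2⟩ t ht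
  have h3 : ∀ T : ℝ, 1 ≤ T → ‖(∫ t in (-T)..T, Q (β + t * Complex.I)) -
      ∫ t in (-T)..T, Q (α + t * Complex.I)‖ ≤ 2 * (g T * |β - α|) := by
    intro T hT
    have hT0 : |T| = T := abs_of_nonneg (by linarith)
    have hr := Complex.integral_boundary_rect_eq_zero_of_differentiableOn Q
      (α + ((-T : ℝ) : ℂ) * Complex.I) (β + (T : ℂ) * Complex.I) (by
        intro s hs
        refine (hQ s ?_).differentiableWithinAt
        have h := (Complex.mem_reProdIm.1 hs).1
        simp only [Complex.add_re, Complex.ofReal_re, Complex.mul_re, Complex.I_re, mul_zero,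
          Complex.ofReal_im, Complex.I_im, mul_one, sub_self, add_zero,
          Set.uIcc_of_le hαβ] at h
        exact h.1)
    simp only [Complex.add_re, Complex.ofReal_re, Complex.mul_re, Complex.I_re, mul_zero,
      Complex.ofReal_im, Complex.I_im, mul_one, sub_self, add_zero, Complex.add_im,
      Complex.mul_im, zero_add] at hr
    have ha := h2 T (by rwa [hT0])
    have hb := h2 (-T) (by rwa [abs_neg, hT0])
    rw [abs_neg] at hb
    rw [hT0] at ha hb
    have he : Complex.I * ((∫ t in (-T)..T, Q (β + t * Complex.I)) -
      ∫ t in (-T)..T, Q (α + t * Complex.I)) =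
      (∫ x : ℝ in α..β, Q (x + T * Complex.I)) -
        ∫ x : ℝ in α..β, Q (x + ((-T : ℝ) : ℂ) * Complex.I) := by
      simp only [smul_eq_mul] at hr
      linear_combination hr
    have hn := congrArg norm he
    rw [norm_mul, Complex.norm_I, one_mul] at hn
    rw [hn]
    exact (norm_sub_le _ _).trans (by linarith)
  have h4 : Filter.Tendsto (fun T : ℝ => (∫ t in (-T)..T, Q (β + t * Complex.I)) -
      ∫ t in (-T)..T, Q (α + t * Complex.I)) Filter.atTop (nhds 0) := by
    refine squeeze_zero_norm' (a := fun T => 2 * (g T * |β - α|)) ?_ ?_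
    · filter_upwards [Filter.eventually_ge_atTop 1] with T hT using h3 T hT
    · simpa using (hg.mul_const |β - α|).const_mul 2
  exact (sub_eq_zero.1 (tendsto_nhds_unique ((h1 hβ).sub (h1 hα)) h4)).symm

lemma exists_one_add_abs_le {r : ℝ} (hr : r ≠ 0) :
    ∃ κ : ℝ, 0 < κ ∧ ∀ t : ℝ, κ * (1 + |t|) ≤ ‖(r : ℂ) + t * Complex.I‖ := by
  refine ⟨min |r| 1 / 2, by positivity, fun t => ?_⟩
  have h1 : |r| ≤ ‖(r : ℂ) + t * Complex.I‖ := by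
    simpa using Complex.abs_re_le_norm ((r : ℂ) + t * Complex.I)
  have h2 : |t| ≤ ‖(r : ℂ) + t * Complex.I‖ := by
    simpa using Complex.abs_im_le_norm ((r : ℂ) + t * Complex.I)
  have h3 : min |r| 1 ≤ |r| := min_le_left _ _
  have h4 : min |r| 1 * |t| ≤ 1 * |t| := by gcongr; exact min_le_right _ _
  linarith

lemma exists_norm_inv_pow_le {r : ℝ} (hr : r ≠ 0) (k : ℕ) : ∃ K : ℝ, 0 ≤ K ∧ ∀ t : ℝ,
    ‖((r : ℂ) + t * Complex.I) ^ (k + 1)‖⁻¹ ≤ K * (1 + |t|)⁻¹ := by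
  obtain ⟨κ, hκ, h⟩ := exists_one_add_abs_le hr
  refine ⟨(κ ^ (k + 1))⁻¹, by positivity, fun t => ?_⟩
  rw [← mul_inv, norm_pow]
  have h1 : (1 : ℝ) ≤ 1 + |t| := by linarith [abs_nonneg t]
  refine inv_anti₀ (by positivity) ?_
  calc κ ^ (k + 1) * (1 + |t|) ≤ κ ^ (k + 1) * (1 + |t|) ^ (k + 1) := by
        gcongr; exact le_self_pow₀ h1 (Nat.succ_ne_zero k)
    _ = (κ * (1 + |t|)) ^ (k + 1) := (mul_pow _ _ _).symm
    _ ≤ _ := by gcongr; exact h t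

lemma exists_norm_polar_sum_le (n : ℕ) (A : ℕ → ℂ) {σ p : ℝ} (h : σ ≠ p) :
    ∃ K : ℝ, 0 ≤ K ∧ ∀ t : ℝ, ‖∑ k ∈ Finset.range n, A k / ((σ + t * Complex.I) - p) ^ (k + 1)‖ ≤
      K * (1 + |t|)⁻¹ := by
  choose K hK0 hK using fun k => exists_norm_inv_pow_le (sub_ne_zero.2 h) k
  refine ⟨∑ k ∈ Finset.range n, ‖A k‖ * K k, Finset.sum_nonneg fun k _ =>
    mul_nonneg (norm_nonneg _) (hK0 k), fun t => ?_⟩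
  rw [Finset.sum_mul]
  refine norm_sum_le_of_le _ fun k _ => ?_
  rw [norm_div, div_eq_mul_inv, mul_assoc]
  gcongr
  have := hK k t
  rwa [show ((σ - p : ℝ) : ℂ) + t * Complex.I = (σ + t * Complex.I) - p by push_cast; ring] at this

lemma norm_polar_sum_le (n : ℕ) (A : ℕ → ℂ) (σ p : ℝ) {t : ℝ} (ht : 1 ≤ |t|) :
    ‖∑ k ∈ Finset.range n, A k / ((σ + t * Complex.I) - p) ^ (k + 1)‖ ≤
      ∑ k ∈ Finset.range n, ‖A k‖ := by
  refine norm_sum_le_of_le _ fun k _ => ?_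
  rw [norm_div, norm_pow]
  refine div_le_self (norm_nonneg _) (one_le_pow₀ ?_)
  refine ht.trans ?_
  simpa using Complex.abs_im_le_norm ((σ + t * Complex.I) - p : ℂ)

lemma integrable_norm_div_add_polar {σ θ : ℝ} (hθ : 0 < θ) {F P H : ℝ → ℂ} (hσ : σ ≠ 0)
    (hH : ∀ t, H t = F t / (σ + t * Complex.I) - P t) (hc : Continuous H)
    {K : ℝ} (hP : ∀ t, ‖P t‖ ≤ K * (1 + |t|)⁻¹)
    (hI : MeasureTheory.Integrable fun t => ‖F t‖ * (1 + |t|) ^ (-(1 + θ))) :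
    MeasureTheory.Integrable fun t => ‖H t‖ * (1 + |t|) ^ (-θ) := by
  obtain ⟨κ, hκ, h⟩ := exists_one_add_abs_le hσ
  have h0 : MeasureTheory.Integrable fun t : ℝ => (1 + |t|) ^ (-(1 + θ)) := by
    simpa using integrable_one_add_norm (E := ℝ) (r := 1 + θ) (by simpa using hθ)
  refine MeasureTheory.Integrable.mono' ((hI.const_mul κ⁻¹).add (h0.const_mul K)) ?_ ?_
  · refine (hc.norm.mul ?_).aestronglyMeasurable
    refine Continuous.rpow_const (by fun_prop) fun t => Or.inl ?_
    positivity
  · refine Filter.Eventually.of_forall fun t => ?_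
    have ht : 0 < 1 + |t| := by positivity
    rw [norm_of_nonneg (by positivity)]
    have e : (1 + |t|)⁻¹ * (1 + |t|) ^ (-θ) = (1 + |t|) ^ (-(1 + θ)) := by
      rw [← rpow_neg_one, ← rpow_add ht]; congr 1; ring
    calc ‖H t‖ * (1 + |t|) ^ (-θ)
        ≤ (κ⁻¹ * ‖F t‖ * (1 + |t|)⁻¹ + K * (1 + |t|)⁻¹) * (1 + |t|) ^ (-θ) := by
          gcongr
          rw [hH]
          refine (norm_sub_le _ _).trans (add_le_add ?_ (hP t))
          rw [norm_div, div_le_iff₀ ((by positivity : 0 < κ * (1 + |t|)).trans_le (h t))]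
          calc ‖F t‖ = κ⁻¹ * ‖F t‖ * (1 + |t|)⁻¹ * (κ * (1 + |t|)) := by field_simp
            _ ≤ _ := by gcongr; exact h t
      _ = _ := by
          simp only [Pi.add_apply]
          rw [← e]; ring

lemma exists_norm_riemannZeta_le_of_one_lt {σ : ℝ} (hσ : 1 < σ) :
    ∃ K : ℝ, 0 ≤ K ∧ ∀ t : ℝ, ‖riemannZeta (σ + t * Complex.I)‖ ≤ K := by
  refine ⟨∑' n : ℕ, 1 / ((n : ℝ) + 1) ^ σ, tsum_nonneg fun n => by positivity, fun t => ?_⟩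
  rw [zeta_eq_tsum_one_div_nat_add_one_cpow (by simpa using hσ)]
  have hn : ∀ n : ℕ, ‖1 / ((n : ℂ) + 1) ^ ((σ : ℂ) + t * Complex.I)‖ = 1 / ((n : ℝ) + 1) ^ σ := by
    intro n
    rw [norm_div, norm_one]
    have : ((n : ℂ) + 1) = ((n + 1 : ℝ) : ℂ) := by push_cast; ring
    rw [this, Complex.norm_cpow_eq_rpow_re_of_pos (by positivity)]
    simp
  have hs : Summable fun n : ℕ => 1 / ((n : ℝ) + 1) ^ σ := by
    have := (summable_nat_add_iff 1).2 (Real.summable_one_div_nat_rpow.2 hσ)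
    simpa using this
  refine tsum_of_norm_bounded hs.hasSum fun n => (hn n).le

lemma exists_norm_zeta_pow_mul_le {a : ℝ} (ha : 0.459085 ≤ a) (ha1 : a < 1 / 2) {l : ℕ}
    (hl : l ≤ 8) : ∃ K : ℝ, 0 ≤ K ∧ ∀ σ ∈ Set.Icc (1 / 2 : ℝ) 2, ∀ t : ℝ, 1 ≤ |t| →
      ‖riemannZeta (σ + t * Complex.I) ^ 4 * riemannZeta (σ + t * Complex.I + a) ^ l‖ ≤
        K * |t| := by
  obtain ⟨C₁, hC₁, h₁⟩ := exists_log_mul_rpow_le (p := 1 / 6) (q := 0.167) (A := 200) (B := 1200)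
    (by norm_num) (by norm_num) (by norm_num) (by norm_num)
  obtain ⟨C₂, hC₂, h₂⟩ := exists_log_mul_rpow_le (p := 1 - 0.959085) (q := 0.041) (A := 200) (B := 1)
    (by norm_num) (by norm_num) (by norm_num) (by norm_num)
  refine ⟨C₁ ^ 4 * C₂ ^ l, by positivity, fun σ hσ t ht => ?_⟩
  have e₁ : ‖riemannZeta (σ + t * Complex.I)‖ = ‖riemannZeta (σ + (|t| : ℝ) * Complex.I)‖ := by
    rcases abs_choice t with h | h
    · rw [h]
    · rw [h, norm_riemannZeta_line_neg]
  have e₂ : ‖riemannZeta (σ + t * Complex.I + a)‖ =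
      ‖riemannZeta ((σ + a : ℝ) + (|t| : ℝ) * Complex.I)‖ := by
    rw [show (σ : ℂ) + t * Complex.I + a = (σ + a : ℝ) + t * Complex.I by push_cast; ring]
    rcases abs_choice t with h | h
    · rw [h]
    · rw [h, norm_riemannZeta_line_neg]
  have hσ1 := hσ.1
  have hσ2 := hσ.2
  have b₁ : ‖riemannZeta (σ + t * Complex.I)‖ ≤ C₁ * |t| ^ (0.167 : ℝ) := by
    rw [e₁]
    refine le_trans ?_ (h₁ |t| ht)
    simpa using norm_riemannZeta_le_weyl (s := σ + (|t| : ℝ) * Complex.I) (by simpa using hσ1)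
      (by simp; linarith) (by simpa using ht)
  have b₂ : ‖riemannZeta (σ + t * Complex.I + a)‖ ≤ C₂ * |t| ^ (0.041 : ℝ) := by
    rw [e₂]
    refine le_trans ?_ (h₂ |t| ht)
    have := norm_riemannZeta_le_trivial (s := (σ + a : ℝ) + (|t| : ℝ) * Complex.I)
      (σ := 0.959085) (by norm_num) (by norm_num) (by simp; linarith) (by simp; linarith)
      (by simpa using ht)
    simpa only [Complex.add_im, Complex.ofReal_im, Complex.mul_im, Complex.ofReal_re,
      Complex.I_im, mul_one, Complex.I_re, mul_zero, add_zero, zero_add, one_mul] using this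
  have ht0 : 0 ≤ |t| := abs_nonneg t
  rw [norm_mul, norm_pow, norm_pow]
  calc _ ≤ (C₁ * |t| ^ (0.167 : ℝ)) ^ 4 * (C₂ * |t| ^ (0.041 : ℝ)) ^ l := by gcongr
    _ = C₁ ^ 4 * C₂ ^ l * |t| ^ ((0.167 : ℝ) * (4 : ℕ) + 0.041 * l) := by
        rw [mul_pow, mul_pow, rpow_add (by linarith), rpow_mul ht0, rpow_mul ht0, rpow_natCast,
          rpow_natCast]
        ring
    _ ≤ C₁ ^ 4 * C₂ ^ l * |t| ^ (1 : ℝ) := by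
        have : (l : ℝ) ≤ 8 := by exact_mod_cast hl
        gcongr
        push_cast
        linarith
    _ = _ := by rw [rpow_one]

lemma exists_zeta_regular_part {a : ℝ} (ha : 0.459085 ≤ a) (ha1 : a < 1 / 2) {l : ℕ}
    (hl : l ≤ 8) : ∃ A B : ℕ → ℂ, ∃ H : ℂ → ℂ, DifferentiableOn ℂ H {s : ℂ | 0 < s.re} ∧
      (∀ s : ℂ, 0 < s.re → s ≠ 1 → s ≠ ((1 - a : ℝ) : ℂ) →
        H s = riemannZeta s ^ 4 * riemannZeta (s + a) ^ l / s -
          ∑ k ∈ Finset.range 4, A k / (s - 1) ^ (k + 1) -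
          ∑ k ∈ Finset.range l, B k / (s - ((1 - a : ℝ) : ℂ)) ^ (k + 1)) ∧
      (∃ K : ℝ, ∀ σ ∈ Set.Icc (1 / 2 : ℝ) 2, ∀ t : ℝ, 1 ≤ |t| →
        ‖H (σ + t * Complex.I)‖ ≤ K) ∧
      (∀ θ : ℝ, 0 < θ → MeasureTheory.Integrable fun t : ℝ =>
        ‖H (((2 : ℝ) : ℂ) + t * Complex.I)‖ * (1 + |t|) ^ (-θ)) ∧
      (∀ θ : ℝ, 0 < θ → MeasureTheory.Integrable fun t : ℝ =>
        ‖H (((1 / 2 : ℝ) : ℂ) + t * Complex.I)‖ * (1 + |t|) ^ (-θ)) := by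
  obtain ⟨A, B, H, hd, hH⟩ := exists_zeta_polar_parts l (a := a) (by linarith) (by linarith)
  have hline : ∀ σ : ℝ, 0 < σ → σ ≠ 1 → σ ≠ 1 - a → ∀ t : ℝ,
      H (σ + t * Complex.I) = riemannZeta (σ + t * Complex.I) ^ 4 *
        riemannZeta (σ + t * Complex.I + a) ^ l / (σ + t * Complex.I) -
          (∑ k ∈ Finset.range 4, A k / ((σ + t * Complex.I) - (1 : ℝ)) ^ (k + 1) +
          ∑ k ∈ Finset.range l, B k / ((σ + t * Complex.I) - ((1 - a : ℝ) : ℂ)) ^ (k + 1)) := by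
    intro σ h0 h1 h2 t
    rw [hH _ (by simpa using h0) (fun h => h1 (by simpa using congrArg Complex.re h))
      (fun h => h2 (by simpa using congrArg Complex.re h)), Complex.ofReal_one]
    ring
  have hInt : ∀ σ : ℝ, 0 < σ → σ ≠ 1 → σ ≠ 1 - a → (∀ θ : ℝ, 0 < θ → MeasureTheory.Integrable
      fun t : ℝ => ‖riemannZeta (σ + t * Complex.I) ^ 4 *
        riemannZeta (σ + t * Complex.I + a) ^ l‖ * (1 + |t|) ^ (-(1 + θ))) →
      ∀ θ : ℝ, 0 < θ → MeasureTheory.Integrable fun t : ℝ =>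
        ‖H ((σ : ℂ) + t * Complex.I)‖ * (1 + |t|) ^ (-θ) := by
    intro σ h0 h1 h2 hI θ hθ
    obtain ⟨K₁, -, hK₁⟩ := exists_norm_polar_sum_le 4 A h1
    obtain ⟨K₂, -, hK₂⟩ := exists_norm_polar_sum_le l B h2
    refine integrable_norm_div_add_polar hθ h0.ne' (hline σ h0 h1 h2) ?_ (K := K₁ + K₂) ?_ (hI θ hθ)
    · rw [continuous_iff_continuousAt]
      intro t
      have := (hd.differentiableAt (isOpen_re_pos.mem_nhds
        (show (σ + t * Complex.I : ℂ) ∈ {s : ℂ | 0 < s.re} by simpa using h0))).continuousAt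
      exact ContinuousAt.comp (f := fun t : ℝ => (σ : ℂ) + t * Complex.I) this (by fun_prop)
    · intro t
      rw [add_mul]
      exact (norm_add_le _ _).trans (add_le_add (hK₁ t) (hK₂ t))
  refine ⟨A, B, H, hd, hH, ?_, hInt 2 (by norm_num) (by norm_num) (by linarith) ?_,
    hInt (1 / 2) (by norm_num) (by norm_num) (by linarith) ?_⟩
  · obtain ⟨K, hK0, hK⟩ := exists_norm_zeta_pow_mul_le ha ha1 hl
    refine ⟨K + (∑ k ∈ Finset.range 4, ‖A k‖ + ∑ k ∈ Finset.range l, ‖B k‖), fun σ hσ t ht => ?_⟩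
    have him : |t| ≤ ‖(σ : ℂ) + t * Complex.I‖ := by
      simpa using Complex.abs_im_le_norm ((σ : ℂ) + t * Complex.I)
    have ht0 : t ≠ 0 := by rintro rfl; norm_num at ht
    have hσ0 : 0 < σ := lt_of_lt_of_le (by norm_num) hσ.1
    rw [hH _ (by simpa using hσ0) (fun h => ht0 (by simpa using congrArg Complex.im h))
      (fun h => ht0 (by simpa using congrArg Complex.im h)), sub_sub]
    refine (norm_sub_le _ _).trans (add_le_add ?_ ((norm_add_le _ _).trans (add_le_add ?_ ?_)))
    · rw [norm_div, div_le_iff₀ (by linarith)]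
      exact (hK σ hσ t ht).trans (by gcongr)
    · simpa using norm_polar_sum_le 4 A σ 1 ht
    · exact norm_polar_sum_le l B σ (1 - a) ht
  · intro θ hθ
    obtain ⟨K₁, hK₁0, hK₁⟩ := exists_norm_riemannZeta_le_of_one_lt (σ := 2) (by norm_num)
    obtain ⟨K₂, hK₂0, hK₂⟩ := exists_norm_riemannZeta_le_of_one_lt (σ := 2 + a) (by linarith)
    have h0 : MeasureTheory.Integrable fun t : ℝ => (1 + |t|) ^ (-(1 + θ)) := by
      simpa using integrable_one_add_norm (E := ℝ) (r := 1 + θ) (by simpa using hθ)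
    have e : ∀ t : ℝ, (((2 : ℝ) : ℂ) + t * Complex.I + a) = (2 + a : ℝ) + t * Complex.I := by
      intro t; push_cast; ring
    simp only [e]
    refine (h0.const_mul (K₁ ^ 4 * K₂ ^ l)).mono' ?_ (Filter.Eventually.of_forall fun t => ?_)
    · have c1 := continuous_riemannZeta_line (σ := 2) (by norm_num)
      have c2 := continuous_riemannZeta_line (σ := 2 + a) (by linarith)
      refine (((c1.pow 4).mul (c2.pow l)).norm.mul ?_).aestronglyMeasurable
      exact Continuous.rpow_const (by fun_prop) fun t => Or.inl (by positivity)
    · rw [norm_of_nonneg (by positivity), norm_mul, norm_pow, norm_pow]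
      gcongr
      · exact hK₁ t
      · exact hK₂ t
  · intro θ hθ
    have := integrable_zeta_pow_four_mul_zeta_pow (σ := 1 / 2 + a) (by linarith) (by linarith)
      hθ hl
    refine this.congr (Filter.Eventually.of_forall fun t => ?_)
    have e : (((1 / 2 : ℝ) : ℂ) + t * Complex.I + a) = (1 / 2 + a : ℝ) + t * Complex.I := by
      push_cast; ring
    simp only [norm_mul, norm_pow, e]

lemma monotone_sum_dWeighted (l : ℕ) (a : ℝ) :
    Monotone fun x : ℝ => ∑ n ∈ Finset.Icc 1 ⌊x⌋₊, dWeighted l a n := fun _ _ hxy =>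
  Finset.sum_le_sum_of_subset_of_nonneg
    (Finset.Icc_subset_Icc_right (Nat.floor_le_floor hxy)) fun n _ _ => dWeighted_nonneg l a n

lemma integrableOn_sum_dWeighted (l : ℕ) {a : ℝ} (ha : 0 ≤ a) {s : ℂ} (hs : 3 / 2 < s.re) :
    MeasureTheory.IntegrableOn (fun t : ℝ =>
      ((∑ n ∈ Finset.Icc 1 ⌊t⌋₊, dWeighted l a n : ℝ) : ℂ) * (t : ℂ) ^ (-(s + 1)))
      (Set.Ioi 1) := by
  obtain ⟨C, hC, h⟩ := exists_sum_dWeighted_le l ha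
  have hI : MeasureTheory.IntegrableOn (fun x : ℝ => C * x ^ (1 / 2 - s.re)) (Set.Ioi 1) :=
    (integrableOn_Ioi_rpow_of_lt (by linarith) one_pos).const_mul C
  refine MeasureTheory.Integrable.mono' hI ?_ ?_
  · refine Measurable.aestronglyMeasurable (Measurable.mul ?_ ?_)
    · exact Complex.measurable_ofReal.comp (monotone_sum_dWeighted l a).measurable
    · exact Complex.measurable_ofReal.pow_const _
  · refine (MeasureTheory.ae_restrict_iff' measurableSet_Ioi).2 (Filter.Eventually.of_forall ?_)
    intro x hx
    have hx1 : 1 < x := hx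
    have hx0 : 0 < x := one_pos.trans hx
    rw [norm_mul, Complex.norm_real, norm_of_nonneg (Finset.sum_nonneg fun n _ =>
      dWeighted_nonneg l a n), Complex.norm_cpow_eq_rpow_re_of_pos hx0]
    calc _ ≤ C * x ^ (3 / 2 : ℝ) * x ^ (-(s + 1)).re := by gcongr; exact h x hx1.le
      _ = _ := by
        rw [mul_assoc, ← rpow_add hx0]
        congr 2
        simp
        ring

noncomputable def mainTerm (n : ℕ) (β : ℝ) (A : ℕ → ℂ) (x : ℝ) : ℂ :=
  ∑ k ∈ Finset.range n, A k / (k.factorial : ℂ) * ((x ^ β * Real.log x ^ k : ℝ) : ℂ)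

lemma measurable_mainTerm (n : ℕ) (β : ℝ) (A : ℕ → ℂ) : Measurable (mainTerm n β A) := by
  unfold mainTerm
  fun_prop

lemma intervalIntegrable_mainTerm (n : ℕ) (β : ℝ) (A : ℕ → ℂ) {x : ℝ} (hx : 1 ≤ x) :
    IntervalIntegrable (mainTerm n β A) MeasureTheory.volume 1 x := by
  refine ContinuousOn.intervalIntegrable fun u hu => ContinuousAt.continuousWithinAt ?_
  rw [Set.uIcc_of_le hx] at hu
  have hu0 : u ≠ 0 := by linarith [hu.1]
  refine tendsto_finsetSum _ fun k _ => ContinuousAt.mul continuousAt_const ?_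
  refine Complex.continuous_ofReal.continuousAt.comp (ContinuousAt.mul ?_ ?_)
  · exact Real.continuousAt_rpow_const _ _ (Or.inl hu0)
  · exact (Real.continuousAt_log hu0).pow k

lemma mainTerm_mul_cpow (n : ℕ) (β : ℝ) (A : ℕ → ℂ) (s : ℂ) : (fun x : ℝ =>
    mainTerm n β A x * (x : ℂ) ^ (-(s + 1))) = fun x : ℝ => ∑ k ∈ Finset.range n,
      A k / (k.factorial : ℂ) * (((x ^ β * Real.log x ^ k : ℝ) : ℂ) * (x : ℂ) ^ (-(s + 1))) := by
  ext x
  simp only [mainTerm, Finset.sum_mul, mul_assoc]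

lemma integrableOn_mainTerm (n : ℕ) {β : ℝ} (A : ℕ → ℂ) {s : ℂ} (hs : β < s.re) :
    MeasureTheory.IntegrableOn (fun x : ℝ => mainTerm n β A x * (x : ℂ) ^ (-(s + 1)))
      (Set.Ioi 1) := by
  rw [mainTerm_mul_cpow]
  exact MeasureTheory.integrable_finsetSum _ fun k _ =>
    (integrableOn_rpow_mul_log_pow k hs).const_mul _

lemma integral_mainTerm (n : ℕ) {β : ℝ} (A : ℕ → ℂ) {s : ℂ} (hs : β < s.re) :
    ∫ x in Set.Ioi (1 : ℝ), mainTerm n β A x * (x : ℂ) ^ (-(s + 1)) =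
      ∑ k ∈ Finset.range n, A k / (s - β) ^ (k + 1) := by
  rw [mainTerm_mul_cpow, MeasureTheory.integral_finsetSum _ fun k _ =>
    (integrableOn_rpow_mul_log_pow k hs).const_mul _]
  refine Finset.sum_congr rfl fun k _ => ?_
  rw [MeasureTheory.integral_const_mul, integral_rpow_mul_log_pow k hs]
  have : (k.factorial : ℂ) ≠ 0 := by exact_mod_cast k.factorial_ne_zero
  field_simp

lemma continuous_line_of_differentiableOn {Q : ℂ → ℂ} (hQ : DifferentiableOn ℂ Q {s | 0 < s.re})
    {σ : ℝ} (hσ : 0 < σ) : Continuous fun t : ℝ => Q (σ + t * Complex.I) := by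
  rw [continuous_iff_continuousAt]
  intro t
  have := (hQ.differentiableAt (isOpen_re_pos.mem_nhds
    (show (σ + t * Complex.I : ℂ) ∈ {s : ℂ | 0 < s.re} by simpa using hσ))).continuousAt
  exact ContinuousAt.comp (f := fun t : ℝ => (σ : ℂ) + t * Complex.I) this (by fun_prop)

lemma integrable_line_div_add_one {H : ℂ → ℂ} (hH : DifferentiableOn ℂ H {s | 0 < s.re})
    {σ : ℝ} (hσ : 0 < σ) (hI : MeasureTheory.Integrable fun t : ℝ =>
      ‖H (σ + t * Complex.I)‖ * (1 + |t|) ^ (-1 : ℝ)) :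
    MeasureTheory.Integrable fun t : ℝ => H (σ + t * Complex.I) / (σ + t * Complex.I + 1) := by
  obtain ⟨κ, hκ, h⟩ := exists_one_add_abs_le (r := σ + 1) (by linarith)
  have e : ∀ t : ℝ, ((σ + 1 : ℝ) : ℂ) + t * Complex.I = σ + t * Complex.I + 1 := by
    intro t; push_cast; ring
  simp only [e] at h
  refine (hI.const_mul κ⁻¹).mono' ?_ (Filter.Eventually.of_forall fun t => ?_)
  · refine ((continuous_line_of_differentiableOn hH hσ).div (by fun_prop)
      fun t h0 => ?_).aestronglyMeasurable
    have := h t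
    rw [h0, norm_zero] at this
    have h2 : 0 < κ * (1 + |t|) := by positivity
    linarith
  · have h2 : 0 < κ * (1 + |t|) := by positivity
    rw [norm_div, div_le_iff₀ (h2.trans_le (h t)), rpow_neg_one]
    calc ‖H (σ + t * Complex.I)‖ =
        κ⁻¹ * (‖H (σ + t * Complex.I)‖ * (1 + |t|)⁻¹) * (κ * (1 + |t|)) := by field_simp
      _ ≤ _ := by gcongr; exact h t

noncomputable def errorTerm (l : ℕ) (a : ℝ) (A B : ℕ → ℂ) (x : ℝ) : ℂ :=
  ((∑ n ∈ Finset.Icc 1 ⌊x⌋₊, dWeighted l a n : ℝ) : ℂ) - mainTerm 4 1 A x - mainTerm l (1 - a) B x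

lemma measurable_errorTerm (l : ℕ) (a : ℝ) (A B : ℕ → ℂ) : Measurable (errorTerm l a A B) :=
  ((Complex.measurable_ofReal.comp (monotone_sum_dWeighted l a).measurable).sub
    (measurable_mainTerm _ _ _)).sub (measurable_mainTerm _ _ _)

lemma intervalIntegrable_errorTerm (l : ℕ) (a : ℝ) (A B : ℕ → ℂ) {x : ℝ} (hx : 1 ≤ x) :
    IntervalIntegrable (errorTerm l a A B) MeasureTheory.volume 1 x := by
  have h := (monotone_sum_dWeighted l a).intervalIntegrable (μ := MeasureTheory.volume)
    (a := 1) (b := x)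
  have h' : IntervalIntegrable (fun x : ℝ =>
      ((∑ n ∈ Finset.Icc 1 ⌊x⌋₊, dWeighted l a n : ℝ) : ℂ)) MeasureTheory.volume 1 x :=
    ⟨h.1.ofReal, h.2.ofReal⟩
  exact (h'.sub (intervalIntegrable_mainTerm _ _ _ hx)).sub
    (intervalIntegrable_mainTerm _ _ _ hx)

lemma integral_errorTerm {l : ℕ} {a : ℝ} (ha : 0 ≤ a) (A B : ℕ → ℂ) {s : ℂ} (hs : 3 / 2 < s.re) :
    MeasureTheory.IntegrableOn (fun u : ℝ => errorTerm l a A B u * (u : ℂ) ^ (-(s + 1)))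
      (Set.Ioi 1) ∧
    ∫ u in Set.Ioi (1 : ℝ), errorTerm l a A B u * (u : ℂ) ^ (-(s + 1)) =
      riemannZeta s ^ 4 * riemannZeta (s + a) ^ l / s -
          ∑ k ∈ Finset.range 4, A k / (s - 1) ^ (k + 1) -
          ∑ k ∈ Finset.range l, B k / (s - ((1 - a : ℝ) : ℂ)) ^ (k + 1) := by
  have h1 := integrableOn_sum_dWeighted l ha hs
  have h2 := integrableOn_mainTerm 4 (β := 1) A (s := s) (by linarith)
  have h3 := integrableOn_mainTerm l (β := 1 - a) B (s := s) (by linarith)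
  have e : (fun u : ℝ => errorTerm l a A B u * (u : ℂ) ^ (-(s + 1))) = fun u : ℝ =>
      ((∑ n ∈ Finset.Icc 1 ⌊u⌋₊, dWeighted l a n : ℝ) : ℂ) * (u : ℂ) ^ (-(s + 1)) -
      mainTerm 4 1 A u * (u : ℂ) ^ (-(s + 1)) -
      mainTerm l (1 - a) B u * (u : ℂ) ^ (-(s + 1)) := by
    ext u; rw [errorTerm]; ring
  rw [e]
  refine ⟨(h1.sub h2).sub h3, ?_⟩
  refine (MeasureTheory.integral_sub (h1.sub h2) h3).trans ?_
  refine (congrArg₂ (· - ·) (MeasureTheory.integral_sub h1 h2) rfl).trans ?_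
  rw [integral_sum_dWeighted l ha hs, integral_mainTerm 4 A (by linarith),
    integral_mainTerm l B (by linarith), Complex.ofReal_one]

lemma norm_ofReal_cpow_line {x : ℝ} (hx : 0 < x) (σ t : ℝ) :
    ‖(x : ℂ) ^ ((σ : ℂ) + t * Complex.I + 1)‖ = x ^ (σ + 1) := by
  rw [Complex.norm_cpow_eq_rpow_re_of_pos hx]
  simp

lemma continuous_ofReal_cpow_line {x : ℝ} (hx : 0 < x) (σ : ℝ) :
    Continuous fun t : ℝ => (x : ℂ) ^ ((σ : ℂ) + t * Complex.I + 1) := by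
  have : (x : ℂ) ≠ 0 := by exact_mod_cast hx.ne'
  exact Continuous.const_cpow (by fun_prop) (Or.inl this)

lemma integrable_cpow_mul_line {x : ℝ} (hx : 0 < x) {σ : ℝ} {f : ℝ → ℂ}
    (hf : MeasureTheory.Integrable f) : MeasureTheory.Integrable fun t : ℝ =>
      (x : ℂ) ^ ((σ : ℂ) + t * Complex.I + 1) * f t :=
  hf.bdd_mul (c := x ^ (σ + 1)) (continuous_ofReal_cpow_line hx σ).aestronglyMeasurable
    (Filter.Eventually.of_forall fun t => (norm_ofReal_cpow_line hx σ t).le)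

lemma exists_integral_errorTerm_eq {a : ℝ} (ha : 0.459085 ≤ a) (ha1 : a < 1 / 2) {l : ℕ}
    (hl : l ≤ 8) : ∃ A B : ℕ → ℂ, ∃ h : ℝ → ℂ, Continuous h ∧
      (∀ θ : ℝ, 0 < θ → MeasureTheory.Integrable fun t : ℝ => ‖h t‖ * (1 + |t|) ^ (-θ)) ∧
      ∀ x : ℝ, 1 < x → ((MeasureTheory.Integrable fun t : ℝ =>
          (x : ℂ) ^ (((1 / 2 : ℝ) : ℂ) + t * Complex.I + 1) *
          (h t / (((1 / 2 : ℝ) : ℂ) + t * Complex.I + 1))) ∧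
        ∫ u in (1 : ℝ)..x, errorTerm l a A B u = (1 / (2 * π) : ℝ) • ∫ t : ℝ,
          (x : ℂ) ^ (((1 / 2 : ℝ) : ℂ) + t * Complex.I + 1) *
          (h t / (((1 / 2 : ℝ) : ℂ) + t * Complex.I + 1))) := by
  obtain ⟨A, B, H, hd, hH, ⟨K, hK⟩, hI₂, hI₁⟩ := exists_zeta_regular_part ha ha1 hl
  have hJ₂ := integrable_line_div_add_one hd (by norm_num : (0 : ℝ) < 2) (hI₂ 1 one_pos)
  have hJ₁ := integrable_line_div_add_one hd (by norm_num : (0 : ℝ) < 1 / 2) (hI₁ 1 one_pos)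
  refine ⟨A, B, fun t => H (((1 / 2 : ℝ) : ℂ) + t * Complex.I),
    continuous_line_of_differentiableOn hd (by norm_num), hI₁, fun x hx => ?_⟩
  have hx0 : 0 < x := one_pos.trans hx
  have hxc : (x : ℂ) ≠ 0 := by exact_mod_cast hx0.ne'
  refine ⟨integrable_cpow_mul_line hx0 hJ₁, ?_⟩
  have hE := fun t : ℝ => integral_errorTerm (l := l) (a := a) (by linarith) A B
    (s := ((2 : ℝ) : ℂ) + t * Complex.I) (by simp; norm_num)
  rw [perron_primitive (measurable_errorTerm l a A B)
    (fun x hx => intervalIntegrable_errorTerm l a A B hx) (by norm_num : (0 : ℝ) < 2)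
    (fun t => (hE t).1) (Φ := H) (fun t => ?_) hJ₂ hx]
  · congr 1
    have hshift := integral_vertical_line_eq (Q := fun s => (x : ℂ) ^ (s + 1) * (H s / (s + 1)))
      (α := 1 / 2) (β := 2) (by norm_num) (fun s hs => ?_) (integrable_cpow_mul_line hx0 hJ₁)
      (integrable_cpow_mul_line hx0 hJ₂) (g := fun T => x ^ (3 : ℝ) * |K| * T⁻¹) ?_ ?_
    · exact hshift.symm
    · have h0 : 0 < s.re := by linarith
      have h1 : s + 1 ≠ 0 := by
        intro h
        have := congrArg Complex.re h
        simp at this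
        linarith
      have h2 := hd.differentiableAt (isOpen_re_pos.mem_nhds h0)
      refine DifferentiableAt.mul ?_ (h2.div (by fun_prop) h1)
      exact DifferentiableAt.const_cpow (by fun_prop) (Or.inl hxc)
    · simpa using tendsto_inv_atTop_zero.const_mul (x ^ (3 : ℝ) * |K|)
    · intro σ hσ t ht
      have him : |t| ≤ ‖(σ : ℂ) + t * Complex.I + 1‖ := by
        simpa using Complex.abs_im_le_norm ((σ : ℂ) + t * Complex.I + 1)
      rw [norm_mul, norm_ofReal_cpow_line hx0, norm_div, mul_assoc]
      refine mul_le_mul (rpow_le_rpow_of_exponent_le hx.le (by linarith [hσ.2])) ?_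
        (by positivity) (by positivity)
      rw [← div_eq_mul_inv]
      exact div_le_div₀ (abs_nonneg K) ((hK σ hσ t ht).trans (le_abs_self K)) (by linarith) him
  · rw [(hE t).2, hH]
    · simp
    · intro h
      have := congrArg Complex.re h
      norm_num at this
    · intro h
      have := congrArg Complex.re h
      simp at this
      linarith

lemma le_mul_div_rpow_of_le {N P Q θ : ℝ} (hP : 0 < P) (hQ : 0 < Q) (hNP : N ≤ P) (hNQ : N ≤ Q)
    (hθ : 0 ≤ θ) (hθ1 : θ ≤ 1) : N ≤ P * (Q / P) ^ θ := by
  have hd : 0 < Q / P := by positivity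
  rcases le_total P Q with h | h
  · have : 1 ≤ Q / P := (one_le_div hP).2 h
    exact hNP.trans (le_mul_of_one_le_right hP.le (one_le_rpow this hθ))
  · have : Q / P ≤ (Q / P) ^ θ := by
      simpa using rpow_le_rpow_of_exponent_ge hd ((div_le_one hP).2 h) hθ1
    calc N ≤ P * (Q / P) := by rwa [mul_div_cancel₀ _ hP.ne']
      _ ≤ _ := by gcongr

lemma norm_cpow_sub_cpow_div_le {x y θ : ℝ} (hx : 0 < x) (hxy : x < y) (hθ : 0 ≤ θ) (hθ1 : θ ≤ 1)
    (t : ℝ) : ‖((y : ℂ) ^ (((1 / 2 : ℝ) : ℂ) + t * Complex.I + 1) -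
      (x : ℂ) ^ (((1 / 2 : ℝ) : ℂ) + t * Complex.I + 1)) /
        (((1 / 2 : ℝ) : ℂ) + t * Complex.I + 1)‖ ≤
      (y - x) * y ^ (1 / 2 : ℝ) * (4 * y / (y - x)) ^ θ * (1 + |t|) ^ (-θ) := by
  have hy : 0 < y := hx.trans hxy
  have hh : 0 < y - x := sub_pos.2 hxy
  set w : ℂ := ((1 / 2 : ℝ) : ℂ) + t * Complex.I + 1 with hw
  have hre : w.re = 3 / 2 := by simp [hw]; norm_num
  have him : w.im = t := by simp [hw]
  have hwn : (1 + |t|) / 2 ≤ ‖w‖ := by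
    have h1 := Complex.abs_im_le_norm w
    have h2 := Complex.re_le_norm w
    rw [him] at h1; rw [hre] at h2
    linarith
  have ht : 0 < 1 + |t| := by positivity
  have hw0 : 0 < ‖w‖ := by linarith
  have b₁ : ‖((y : ℂ) ^ w - (x : ℂ) ^ w) / w‖ ≤ (y - x) * y ^ (1 / 2 : ℝ) := by
    rw [norm_div, div_le_iff₀ hw0]
    have := Convex.norm_image_sub_le_of_norm_hasDerivWithin_le (f := fun u : ℝ => (u : ℂ) ^ w)
      (f' := fun u : ℝ => w * (u : ℂ) ^ (w - 1)) (C := ‖w‖ * y ^ (1 / 2 : ℝ)) (s := Set.Icc x y)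
      (fun u hu => (hasDerivAt_ofReal_cpow (hx.trans_le hu.1) w).hasDerivWithinAt)
      (fun u hu => by
        have hu0 := hx.trans_le hu.1
        rw [norm_mul, Complex.norm_cpow_eq_rpow_re_of_pos hu0, Complex.sub_re, hre, Complex.one_re]
        norm_num
        gcongr
        exact hu.2) (convex_Icc x y) (Set.left_mem_Icc.2 hxy.le) (Set.right_mem_Icc.2 hxy.le)
    rw [norm_of_nonneg hh.le] at this
    linarith
  have b₂ : ‖((y : ℂ) ^ w - (x : ℂ) ^ w) / w‖ ≤ 4 * (y * y ^ (1 / 2 : ℝ)) / (1 + |t|) := by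
    rw [norm_div, div_le_div_iff₀ hw0 ht]
    have e : y * y ^ (1 / 2 : ℝ) = y ^ (3 / 2 : ℝ) := by
      nth_rewrite 1 [← rpow_one y]
      rw [← rpow_add hy]; norm_num
    have h1 : ‖(y : ℂ) ^ w - (x : ℂ) ^ w‖ ≤ 2 * y ^ (3 / 2 : ℝ) := by
      refine (norm_sub_le _ _).trans ?_
      rw [Complex.norm_cpow_eq_rpow_re_of_pos hx, Complex.norm_cpow_eq_rpow_re_of_pos hy, hre]
      have : x ^ (3 / 2 : ℝ) ≤ y ^ (3 / 2 : ℝ) := by gcongr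
      linarith
    rw [e]
    calc _ ≤ 2 * y ^ (3 / 2 : ℝ) * (2 * ‖w‖) := by gcongr; linarith
      _ = _ := by ring
  refine (le_mul_div_rpow_of_le (by positivity) (by positivity) b₁ b₂ hθ hθ1).trans_eq ?_
  have e : 4 * (y * y ^ (1 / 2 : ℝ)) / (1 + |t|) / ((y - x) * y ^ (1 / 2 : ℝ)) =
      4 * y / (y - x) * (1 + |t|)⁻¹ := by field_simp
  rw [e, mul_rpow (by positivity) (by positivity), inv_rpow ht.le, rpow_neg ht.le, mul_assoc,
    mul_assoc, mul_assoc]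

lemma exists_norm_integral_errorTerm_le {a : ℝ} (ha : 0.459085 ≤ a) (ha1 : a < 1 / 2) {l : ℕ}
    (hl : l ≤ 8) : ∃ A B : ℕ → ℂ, ∀ θ : ℝ, 0 < θ → θ ≤ 1 → ∃ J : ℝ, 0 ≤ J ∧ ∀ x y : ℝ, 1 < x →
      x < y → ‖∫ u in x..y, errorTerm l a A B u‖ ≤
        J * ((y - x) * y ^ (1 / 2 : ℝ) * (4 * y / (y - x)) ^ θ) := by
  obtain ⟨A, B, h, -, hI, hE⟩ := exists_integral_errorTerm_eq ha ha1 hl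
  refine ⟨A, B, fun θ hθ hθ1 => ⟨1 / (2 * π) * ∫ t : ℝ, ‖h t‖ * (1 + |t|) ^ (-θ), ?_,
    fun x y hx hxy => ?_⟩⟩
  · exact mul_nonneg (by positivity)
      (MeasureTheory.integral_nonneg fun t => by simp only [Pi.zero_apply]; positivity)
  obtain ⟨hx1, hx2⟩ := hE x hx
  obtain ⟨hy1, hy2⟩ := hE y (hx.trans hxy)
  rw [← intervalIntegral.integral_interval_sub_left
    (intervalIntegrable_errorTerm l a A B (hx.trans hxy).le)
    (intervalIntegrable_errorTerm l a A B hx.le), hx2, hy2, ← smul_sub,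
    ← MeasureTheory.integral_sub hy1 hx1, norm_smul, norm_of_nonneg (by positivity), mul_assoc]
  gcongr
  rw [← MeasureTheory.integral_mul_const]
  refine MeasureTheory.norm_integral_le_of_norm_le ((hI θ hθ).mul_const _)
    (Filter.Eventually.of_forall fun t => ?_)
  rw [← sub_mul, mul_div_left_comm, norm_mul, mul_assoc]
  refine mul_le_mul_of_nonneg_left ?_ (norm_nonneg _)
  rw [mul_comm ((1 + |t|) ^ (-θ))]
  exact norm_cpow_sub_cpow_div_le (one_pos.trans hx) hxy hθ.le hθ1 t

lemma abs_le_of_monotone_sub {S M : ℝ → ℝ} (hS : Monotone S) {X h G D : ℝ} (hh : 0 < h)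
    (hM : ∀ u ∈ Set.Icc (X - h) (X + h), |M u - M X| ≤ D)
    (hI₁ : IntervalIntegrable (fun u => S u - M u) MeasureTheory.volume (X - h) X)
    (hI₂ : IntervalIntegrable (fun u => S u - M u) MeasureTheory.volume X (X + h))
    (h₁ : |∫ u in (X - h)..X, (S u - M u)| ≤ h * G)
    (h₂ : |∫ u in X..(X + h), (S u - M u)| ≤ h * G) : |S X - M X| ≤ G + D := by
  have u₁ : ∫ u in (X - h)..X, (S u - M u) ≤ ∫ u in (X - h)..X, (S X - M X + D) := by
    refine intervalIntegral.integral_mono_on (by linarith) hI₁ (by simp) fun u hu => ?_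
    have := (abs_le.1 (hM u ⟨hu.1, by linarith [hu.2]⟩)).1
    linarith [hS hu.2]
  have u₂ : ∫ u in X..(X + h), (S X - M X - D) ≤ ∫ u in X..(X + h), (S u - M u) := by
    refine intervalIntegral.integral_mono_on (by linarith) (by simp) hI₂ fun u hu => ?_
    have := (abs_le.1 (hM u ⟨by linarith [hu.1], hu.2⟩)).2
    linarith [hS hu.1]
  rw [intervalIntegral.integral_const, smul_eq_mul] at u₁ u₂
  rw [abs_le] at h₁ h₂
  have v₁ : h * (S X - M X + D) ≥ h * (-G) := by linarith [h₁.1]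
  have v₂ : h * (S X - M X - D) ≤ h * G := by linarith [h₂.2]
  have w₁ := le_of_mul_le_mul_left v₁ hh
  have w₂ := le_of_mul_le_mul_left v₂ hh
  rw [abs_le]
  constructor <;> linarith

lemma exists_abs_rpow_mul_log_pow_sub_le {β : ℝ} (hβ : 0 ≤ β) (hβ1 : β ≤ 1) (k : ℕ) {η : ℝ}
    (hη : 0 < η) : ∃ C : ℝ, 0 < C ∧ ∀ X : ℝ, 1 ≤ X → ∀ u ∈ Set.Icc 1 (2 * X),
      |u ^ β * Real.log u ^ k - X ^ β * Real.log X ^ k| ≤ C * X ^ η * |u - X| := by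
  obtain ⟨C₁, hC₁, h₁⟩ := exists_log_pow_le k hη
  obtain ⟨C₂, hC₂, h₂⟩ := exists_log_pow_le (k - 1) hη
  refine ⟨(C₁ + k * C₂) * 2 ^ η, by positivity, fun X hX u hu => ?_⟩
  have hmv := Convex.norm_image_sub_le_of_norm_hasDerivWithin_le
    (f := fun u : ℝ => u ^ β * Real.log u ^ k)
    (f' := fun u : ℝ => β * u ^ (β - 1) * Real.log u ^ k +
      u ^ β * (k * Real.log u ^ (k - 1) * u⁻¹)) (C := (C₁ + k * C₂) * 2 ^ η * X ^ η)
    (s := Set.Icc 1 (2 * X)) (x := X) (y := u)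
    (fun v hv => by
      have hv0 : v ≠ 0 := by linarith [hv.1]
      exact ((Real.hasDerivAt_rpow_const (Or.inl hv0)).mul
        ((Real.hasDerivAt_log hv0).pow k)).hasDerivWithinAt)
    (fun v hv => by
      have hv1 : 1 ≤ v := hv.1
      have hv0 : 0 < v := by linarith
      have hl : 0 ≤ Real.log v := Real.log_nonneg hv1
      have e : v ^ β * (k * Real.log v ^ (k - 1) * v⁻¹) =
          v ^ (β - 1) * (k * Real.log v ^ (k - 1)) := by
        rw [rpow_sub_one hv0.ne']; ring
      have hp : v ^ (β - 1) ≤ 1 := rpow_le_one_of_one_le_of_nonpos hv1 (by linarith)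
      rw [e, norm_of_nonneg (by positivity)]
      calc _ ≤ 1 * 1 * Real.log v ^ k + 1 * (k * Real.log v ^ (k - 1)) := by gcongr
        _ ≤ C₁ * v ^ η + k * (C₂ * v ^ η) := by
            rw [one_mul, one_mul, one_mul]
            gcongr
            · exact h₁ v hv1
            · exact h₂ v hv1
        _ = (C₁ + k * C₂) * v ^ η := by ring
        _ ≤ (C₁ + k * C₂) * (2 * X) ^ η := by gcongr; exact hv.2
        _ = _ := by rw [mul_rpow (by norm_num) (by linarith)]; ring)
    (convex_Icc _ _) ⟨hX, by linarith⟩ hu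
  simpa [Real.norm_eq_abs] using hmv

lemma exists_norm_mainTerm_sub_le (n : ℕ) {β : ℝ} (hβ : 0 ≤ β) (hβ1 : β ≤ 1) (A : ℕ → ℂ) {η : ℝ}
    (hη : 0 < η) : ∃ C : ℝ, 0 ≤ C ∧ ∀ X : ℝ, 1 ≤ X → ∀ u ∈ Set.Icc 1 (2 * X),
      ‖mainTerm n β A u - mainTerm n β A X‖ ≤ C * X ^ η * |u - X| := by
  choose C hC0 hC using fun k => exists_abs_rpow_mul_log_pow_sub_le hβ hβ1 k hη
  refine ⟨∑ k ∈ Finset.range n, ‖A k / (k.factorial : ℂ)‖ * C k, Finset.sum_nonneg fun k _ =>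
    mul_nonneg (norm_nonneg _) (hC0 k).le, fun X hX u hu => ?_⟩
  rw [mainTerm, mainTerm, ← Finset.sum_sub_distrib, Finset.sum_mul, Finset.sum_mul]
  refine norm_sum_le_of_le _ fun k _ => ?_
  rw [← mul_sub, norm_mul, ← Complex.ofReal_sub, Complex.norm_real, Real.norm_eq_abs, mul_assoc,
    mul_assoc]
  refine mul_le_mul_of_nonneg_left ?_ (norm_nonneg _)
  rw [← mul_assoc]
  exact hC k X hX u hu

lemma exists_norm_integral_errorTerm_short_le {a : ℝ} (ha : 0.459085 ≤ a) (ha1 : a < 1 / 2)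
    {l : ℕ} (hl : l ≤ 8) : ∃ A B : ℕ → ℂ, ∀ ε : ℝ, 0 < ε → ∃ J : ℝ, 0 ≤ J ∧ ∀ X x y : ℝ,
      1 ≤ X → 1 < x → y ≤ 2 * X → y - x = √X / 2 →
      ‖∫ u in x..y, errorTerm l a A B u‖ ≤ √X / 2 * (J * X ^ (1 / 2 + ε)) := by
  obtain ⟨A, B, h⟩ := exists_norm_integral_errorTerm_le ha ha1 hl
  refine ⟨A, B, fun ε hε => ?_⟩
  obtain ⟨J, hJ, hE⟩ := h (min ε 1) (by positivity) (min_le_right _ _)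
  refine ⟨J * (2 * 16), by positivity, fun X x y hX hx hy hyx => ?_⟩
  have hX0 : 0 < X := by linarith
  have hs : 0 < √X := Real.sqrt_pos.2 hX0
  have hy0 : 0 < y := by linarith
  refine (hE x y hx (by linarith)).trans ?_
  rw [hyx]
  have hθ : 0 < min ε 1 := by positivity
  have b₁ : y ^ (1 / 2 : ℝ) ≤ 2 * X ^ (1 / 2 : ℝ) := by
    calc y ^ (1 / 2 : ℝ) ≤ (2 * X) ^ (1 / 2 : ℝ) := by gcongr
      _ = 2 ^ (1 / 2 : ℝ) * X ^ (1 / 2 : ℝ) := mul_rpow (by norm_num) hX0.le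
      _ ≤ 2 ^ (1 : ℝ) * X ^ (1 / 2 : ℝ) := by gcongr <;> norm_num
      _ = _ := by rw [rpow_one]
  have b₂ : (4 * y / (√X / 2)) ^ (min ε 1) ≤ 16 * X ^ ε := by
    have : 4 * y / (√X / 2) ≤ 16 * X := by
      rw [div_le_iff₀ (by positivity)]
      have : 1 ≤ √X := Real.one_le_sqrt.2 hX
      nlinarith
    calc _ ≤ (16 * X) ^ (min ε 1) := by gcongr
      _ = 16 ^ (min ε 1) * X ^ (min ε 1) := mul_rpow (by norm_num) hX0.le
      _ ≤ 16 ^ (1 : ℝ) * X ^ ε := by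
          gcongr
          · norm_num
          · exact min_le_right _ _
          · exact min_le_left _ _
      _ = _ := by rw [rpow_one]
  calc _ ≤ J * (√X / 2 * (2 * X ^ (1 / 2 : ℝ)) * (16 * X ^ ε)) := by gcongr
    _ = _ := by rw [rpow_add hX0]; ring

lemma mainTerm_re (n : ℕ) (β : ℝ) (A : ℕ → ℂ) (x : ℝ) : (mainTerm n β A x).re =
    x ^ β * ∑ k : Fin n, (A k / ((k : ℕ).factorial : ℂ)).re * Real.log x ^ (k : ℕ) := by
  rw [mainTerm, Complex.re_sum, Finset.mul_sum,
    Fin.sum_univ_eq_sum_range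
      (fun k => x ^ β * ((A k / (k.factorial : ℂ)).re * Real.log x ^ k)) n]
  refine Finset.sum_congr rfl fun k _ => ?_
  rw [Complex.re_mul_ofReal]
  ring

lemma exists_abs_errorTerm_re_le {a : ℝ} (ha : 0.459085 ≤ a) (ha1 : a < 1 / 2)
    {l : ℕ} (hl : l ≤ 8) : ∃ A B : ℕ → ℂ, ∀ ε : ℝ, 0 < ε → ∃ C : ℝ, 0 < C ∧ ∀ X : ℝ, 2 ≤ X →
      |(errorTerm l a A B X).re| ≤ C * X ^ (1 / 2 + ε) := by
  obtain ⟨A, B, hAB⟩ := exists_norm_integral_errorTerm_short_le ha ha1 hl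
  refine ⟨A, B, fun ε hε => ?_⟩
  obtain ⟨J, hJ, hE⟩ := hAB ε hε
  obtain ⟨C₁, hC₁, h₁⟩ := exists_norm_mainTerm_sub_le 4 zero_le_one le_rfl A hε
  obtain ⟨C₂, hC₂, h₂⟩ := exists_norm_mainTerm_sub_le l (β := 1 - a) (by linarith) (by linarith)
    B hε
  refine ⟨J + (C₁ + C₂) + 1, by positivity, fun X hX => ?_⟩
  have hX0 : 0 < X := by linarith
  have hs : 0 < √X := Real.sqrt_pos.2 hX0
  have hsq : √X * √X = X := Real.mul_self_sqrt hX0.le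
  have hsX : √X / 2 ≤ X - √X / 2 - 1 / 100 := by nlinarith [sq_nonneg (√X - 1.41)]
  have hlow : 1 < X - √X / 2 := by nlinarith [sq_nonneg (√X - 1.41)]
  set S : ℝ → ℝ := fun x => ∑ n ∈ Finset.Icc 1 ⌊x⌋₊, dWeighted l a n with hS
  set M : ℝ → ℝ := fun x => (mainTerm 4 1 A x).re + (mainTerm l (1 - a) B x).re with hM
  have hSM : ∀ u, S u - M u = (errorTerm l a A B u).re := by
    intro u
    rw [errorTerm, Complex.sub_re, Complex.sub_re, Complex.ofReal_re, hS, hM]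
    ring
  have hInt : ∀ x y : ℝ, 1 ≤ x → 1 ≤ y →
      IntervalIntegrable (errorTerm l a A B) MeasureTheory.volume x y := fun x y hx hy =>
    (intervalIntegrable_errorTerm l a A B hx).symm.trans (intervalIntegrable_errorTerm l a A B hy)
  have hintre : ∀ x y : ℝ, 1 ≤ x → 1 ≤ y →
      IntervalIntegrable (fun u => S u - M u) MeasureTheory.volume x y := by
    intro x y hx hy
    simp only [hSM]
    exact ⟨(hInt x y hx hy).1.re, (hInt x y hx hy).2.re⟩
  have hre : ∀ x y : ℝ, 1 ≤ x → 1 ≤ y →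
      |∫ u in x..y, (S u - M u)| ≤ ‖∫ u in x..y, errorTerm l a A B u‖ := by
    intro x y hx hy
    simp only [hSM]
    have := Complex.reCLM.intervalIntegral_comp_comm (hInt x y hx hy)
    simp only [Complex.reCLM_apply] at this
    rw [this]
    exact Complex.abs_re_le_norm _
  rw [← hSM]
  have hp : 0 < X ^ (1 / 2 + ε) := by positivity
  refine (abs_le_of_monotone_sub (S := S) (M := M) (monotone_sum_dWeighted l a) (X := X)
    (h := √X / 2) (G := J * X ^ (1 / 2 + ε)) (D := (C₁ + C₂) * X ^ (1 / 2 + ε)) (by positivity)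
    (fun u hu => ?_) (hintre _ _ hlow.le (by linarith)) (hintre _ _ (by linarith) (by linarith))
    ((hre _ _ hlow.le (by linarith)).trans (hE X _ _ (by linarith) hlow (by linarith) (by ring)))
    ((hre _ _ (by linarith) (by linarith)).trans
      (hE X _ _ (by linarith) (by linarith) (by linarith) (by ring)))).trans ?_
  · have hu' : u ∈ Set.Icc 1 (2 * X) := ⟨by linarith [hu.1], by linarith [hu.2]⟩
    have b₁ := h₁ X (by linarith) u hu'
    have b₂ := h₂ X (by linarith) u hu'
    have hd : |u - X| ≤ X ^ (1 / 2 : ℝ) := by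
      rw [← Real.sqrt_eq_rpow, abs_le]
      exact ⟨by linarith [hu.1], by linarith [hu.2]⟩
    have e : M u - M X = (mainTerm 4 1 A u - mainTerm 4 1 A X).re +
        (mainTerm l (1 - a) B u - mainTerm l (1 - a) B X).re := by
      simp only [hM, Complex.sub_re]; ring
    rw [e]
    calc _ ≤ C₁ * X ^ ε * |u - X| + C₂ * X ^ ε * |u - X| :=
          (abs_add_le _ _).trans (add_le_add ((Complex.abs_re_le_norm _).trans b₁)
            ((Complex.abs_re_le_norm _).trans b₂))
      _ = (C₁ + C₂) * X ^ ε * |u - X| := by ring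
      _ ≤ (C₁ + C₂) * X ^ ε * X ^ (1 / 2 : ℝ) := by gcongr
      _ = _ := by rw [rpow_add hX0]; ring
  · linarith

/-- Corollary 2 of Ivić–Zhai, case `ℓ ∈ {7, 8}`: for fixed `a` in the stated range, the
error term `E_{4,ℓ}(X)` in the asymptotic formula for `∑_{n ≤ X} d_{4,ℓ}(n;a)` is
`≪_ε X^{1/2+ε}`. -/
theorem weighted_divisor_error_l7_l8 (ℓ : ℕ) (hℓ : ℓ = 7 ∨ ℓ = 8)
    (a : ℝ) (ha₁ : 0.459085 ≤ a) (ha₂ : a < 1 / 2) :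
    ∃ c : Fin 4 → ℝ, ∃ c' : Fin ℓ → ℝ, ∀ ε : ℝ, 0 < ε → ∃ C : ℝ, 0 < C ∧
      ∀ X : ℝ, 2 ≤ X →
        |(∑ n ∈ Finset.Icc 1 ⌊X⌋₊, dWeighted ℓ a n) -
            X * ∑ k : Fin 4, c k * Real.log X ^ (k : ℕ) -
            X ^ (1 - a) * ∑ k : Fin ℓ, c' k * Real.log X ^ (k : ℕ)| ≤
          C * X ^ (1 / 2 + ε) := by
  obtain ⟨A, B, h⟩ := exists_abs_errorTerm_re_le ha₁ ha₂ (l := ℓ) (by omega)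
  refine ⟨fun k => (A k / ((k : ℕ).factorial : ℂ)).re,
    fun k => (B k / ((k : ℕ).factorial : ℂ)).re, fun ε hε => ?_⟩
  obtain ⟨C, hC, hE⟩ := h ε hε
  refine ⟨C, hC, fun X hX => ?_⟩
  have := hE X hX
  rwa [errorTerm, Complex.sub_re, Complex.sub_re, Complex.ofReal_re, mainTerm_re, mainTerm_re,
    rpow_one] at this
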